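/- arXiv:1909.00851 — 7 statements merged into one kernel-verified Lean document; each statement's English description precedes it below -/
import Mathlib

section
/- Let p be a prime, e ≥ 2, and let G be a non-abelian metacyclic Beauville p-group of exponent p^e. Then p ≥ 5 and there exists an integer i with 1 ≤ i ≤ e−1 such that G is isomorphic to the group with presentation ⟨a, b ∣ a^{p^e} = b^{p^e} = 1, [a,b] = a^{p^i}⟩. -/
/-- The commutator `[a,b] = a⁻¹ b⁻¹ a b`. -/
def commG {G : Type*} [Group G] (a b : G) : G := a⁻¹ * b⁻¹ * a * b

/-- `Σ(x,y) = ⋃_{g ∈ G} (⟨x⟩^g ∪ ⟨y⟩^g ∪ ⟨xy⟩^g)`. -/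
def beauvilleSigma {G : Type*} [Group G] (x y : G) : Set G :=
  ⋃ g : G, ((fun h => g⁻¹ * h * g) '' (Subgroup.zpowers x : Set G) ∪
            (fun h => g⁻¹ * h * g) '' (Subgroup.zpowers y : Set G) ∪
            (fun h => g⁻¹ * h * g) '' (Subgroup.zpowers (x * y) : Set G))

/-- `{x₁,y₁}` and `{x₂,y₂}` form a Beauville structure for `G`. -/
def IsBeauvilleStructure {G : Type*} [Group G] (x₁ y₁ x₂ y₂ : G) : Prop :=
  Subgroup.closure {x₁, y₁} = ⊤ ∧ Subgroup.closure {x₂, y₂} = ⊤ ∧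
    beauvilleSigma x₁ y₁ ∩ beauvilleSigma x₂ y₂ = {1}

/-- `G` is a Beauville group. -/
def IsBeauvilleGroup (G : Type*) [Group G] : Prop :=
  ∃ x₁ y₁ x₂ y₂ : G, IsBeauvilleStructure x₁ y₁ x₂ y₂

/-- The Beauville structure `{x₁,y₁}, {x₂,y₂}` is strongly real: there are an automorphism
`θ` and elements `g₁, g₂` with `gᵢ θ(xᵢ) gᵢ⁻¹ = xᵢ⁻¹` and `gᵢ θ(yᵢ) gᵢ⁻¹ = yᵢ⁻¹`. -/
def IsStronglyRealStructure {G : Type*} [Group G] (x₁ y₁ x₂ y₂ : G) : Prop :=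
  ∃ θ : G ≃* G, ∃ g₁ g₂ : G,
    g₁ * θ x₁ * g₁⁻¹ = x₁⁻¹ ∧ g₁ * θ y₁ * g₁⁻¹ = y₁⁻¹ ∧
    g₂ * θ x₂ * g₂⁻¹ = x₂⁻¹ ∧ g₂ * θ y₂ * g₂⁻¹ = y₂⁻¹

/-- `G` is metacyclic: it has a cyclic normal subgroup with cyclic quotient. -/
def IsMetacyclic (G : Type*) [Group G] : Prop :=
  ∃ N : Subgroup G, IsCyclic N ∧ ∃ hN : N.Normal,
    haveI := hN
    IsCyclic (G ⧸ N)

/-- The relations of the presentation `⟨a, b ∣ a^{p^e} = b^{p^e} = 1, [a,b] = a^{p^i}⟩`,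
where `a` and `b` are the images of `0` and `1` respectively. -/
def metacyclicRels (p e i : ℕ) : Set (FreeGroup (Fin 2)) :=
  { FreeGroup.of 0 ^ p ^ e, FreeGroup.of 1 ^ p ^ e,
    commG (FreeGroup.of 0) (FreeGroup.of 1) * (FreeGroup.of 0 ^ p ^ i)⁻¹ }


/-- The geometric sum `1 + c + ⋯ + c ^ (j - 1)`. -/
def geomSum (c j : ℕ) : ℕ := ∑ i ∈ Finset.range j, c ^ i

lemma geomSum_succ (c j : ℕ) : geomSum c (j + 1) = c * geomSum c j + 1 := by
  simp only [geomSum, Finset.sum_range_succ', Finset.mul_sum, pow_succ', pow_zero]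

lemma geomSum_mul (c q j : ℕ) : geomSum c (q * j) = geomSum c q * geomSum (c ^ q) j := by
  unfold geomSum
  induction j with
  | zero => simp
  | succ j ih =>
    rw [Nat.mul_succ, Finset.sum_range_add, ih, Finset.sum_range_succ, mul_add, Finset.sum_mul]
    congr 1
    rw [Finset.sum_mul]
    exact Finset.sum_congr rfl fun i _ => by rw [pow_add, pow_mul, mul_comm]

lemma geomSum_odd_prime {p c : ℕ} (hp : p.Prime) (hp2 : p ≠ 2) (hc : c ≡ 1 [MOD p]) :
    ∃ w, geomSum c p = p * w ∧ ¬ p ∣ w := by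
  obtain ⟨d, hd⟩ := (Nat.modEq_iff_dvd.mp hc.symm : (p : ℤ) ∣ (c : ℤ) - (1 : ℕ))
  have h := odd_sq_dvd_geom_sum₂_sub (1 : ℤ) d (hp.odd_of_ne_two hp2)
  have hcd : (1 : ℤ) + p * d = c := by push_cast at hd; linarith
  rw [hcd] at h
  have hs : (∑ i ∈ Finset.range p, (c : ℤ) ^ i * 1 ^ (p - 1 - i)) = (geomSum c p : ℕ) := by
    simp [geomSum]
  rw [hs, one_pow, mul_one] at h
  obtain ⟨v, hv⟩ := h
  have hp0 : (p : ℤ) ≠ 0 := by exact_mod_cast hp.ne_zero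
  have hdiv : p ∣ geomSum c p := by
    have : (p : ℤ) ∣ (geomSum c p : ℕ) := ⟨p * v + 1, by linear_combination hv⟩
    exact_mod_cast this
  obtain ⟨w, hw⟩ := hdiv
  refine ⟨w, hw, fun ⟨u, hu⟩ => ?_⟩
  rw [hw, hu] at hv
  push_cast at hv
  have h1 : (p : ℤ) * (u - v) = 1 := by
    apply mul_left_cancel₀ hp0
    linear_combination hv
  have : (p : ℤ) ∣ 1 := ⟨_, h1.symm⟩
  have : p ∣ 1 := by exact_mod_cast this
  exact hp.one_lt.ne' (Nat.dvd_one.mp this)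

lemma geomSum_prime_pow {p c : ℕ} (hp : p.Prime) (hp2 : p ≠ 2) (hc : c ≡ 1 [MOD p]) (n : ℕ) :
    ∃ w, geomSum c (p ^ n) = p ^ n * w ∧ ¬ p ∣ w := by
  induction n with
  | zero => exact ⟨1, by simp [geomSum], by simpa using hp.one_lt.ne'⟩
  | succ n ih =>
    obtain ⟨w, hw, hpw⟩ := ih
    obtain ⟨v, hv, hpv⟩ := geomSum_odd_prime hp hp2 (c := c ^ p ^ n) (by simpa using hc.pow (p ^ n))
    refine ⟨w * v, ?_, hp.not_dvd_mul hpw hpv⟩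
    rw [pow_succ, geomSum_mul, hw, hv]
    ring

/-- The step from `p ^ n` to `p ^ (n + 1)` contributes exactly one factor `p` to a geometric sum. -/
lemma geomSum_step {p c : ℕ} (hp : p.Prime) (hc : c ≡ 1 [MOD p]) (n : ℕ) (h : p ≠ 2 ∨ n ≠ 0) :
    ∃ w, geomSum c (p ^ (n + 1)) = p * geomSum c (p ^ n) * w ∧ ¬ p ∣ w := by
  suffices ∃ w, geomSum (c ^ p ^ n) p = p * w ∧ ¬ p ∣ w by
    obtain ⟨w, hw, hpw⟩ := this
    exact ⟨w, by rw [pow_succ, geomSum_mul, hw]; ring, hpw⟩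
  by_cases hp2 : p = 2
  · subst hp2
    obtain ⟨k, rfl⟩ := Nat.exists_eq_succ_of_ne_zero (h.resolve_left (by simp))
    have hodd : Odd (c ^ 2 ^ k) := Odd.pow (Nat.odd_iff.mpr hc)
    obtain ⟨s, hs⟩ := hodd
    refine ⟨2 * (s * s + s) + 1, ?_, by omega⟩
    rw [Nat.succ_eq_add_one, pow_succ 2 k, pow_mul, hs]
    simp [geomSum, Finset.sum_range_succ]
    ring
  · exact geomSum_odd_prime hp hp2 (by simpa using hc.pow (p ^ n))

lemma mem_zpowers_of_orderOf_eq {α : Type*} [Group α] [Finite α] [IsCyclic α] {x y : α}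
    (h : orderOf x = orderOf y) : y ∈ Subgroup.zpowers x := by
  classical
  have := Fintype.ofFinite α
  have hsub : (Finset.univ.filter (· ∈ Subgroup.zpowers x)) ⊆
      (Finset.univ.filter fun g : α => g ^ orderOf x = 1) := by
    intro g hg
    obtain ⟨j, rfl⟩ := Subgroup.mem_zpowers_iff.mp (Finset.mem_filter.mp hg).2
    have : (x ^ j) ^ orderOf x = 1 := by
      rw [← zpow_natCast, zpow_comm, zpow_natCast, pow_orderOf_eq_one, one_zpow]
    simp [this]
  have hcard : (Finset.univ.filter (· ∈ Subgroup.zpowers x)).card = orderOf x := by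
    rw [← Nat.card_zpowers, Nat.card_eq_fintype_card, Fintype.card_subtype]
  have heq := Finset.eq_of_subset_of_card_le hsub
    ((IsCyclic.card_pow_eq_one_le (orderOf_pos x)).trans hcard.ge)
  have : y ∈ (Finset.univ.filter fun g : α => g ^ orderOf x = 1) := by
    simp [h, pow_orderOf_eq_one]
  rw [← heq] at this
  exact (Finset.mem_filter.mp this).2

lemma exists_pow_modEq_one_add {p e r : ℕ} (hp : p.Prime) (hp2 : p ≠ 2) (hr : r ≡ 1 [MOD p])
    (hre : ¬ r ≡ 1 [MOD p ^ e]) :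
    ∃ i t, 1 ≤ i ∧ i < e ∧ t.Coprime p ∧ r ^ t ≡ 1 + p ^ i [MOD p ^ e] := by
  have hp3 : 3 ≤ p := by have := hp.two_le; omega
  have hr1 : 1 ≤ r := by
    by_contra h
    obtain rfl : r = 0 := by omega
    exact hp.one_lt.ne' (Nat.dvd_one.mp ((Nat.modEq_zero_iff_dvd).mp hr.symm))
  have hr2 : r - 1 ≠ 0 := fun h => hre (by rw [show r = 1 by omega])
  obtain ⟨i, u, hu, hru⟩ := Nat.exists_eq_pow_mul_and_not_dvd hr2 p hp.ne_one
  have hr' : r = 1 + p ^ i * u := by omega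
  have hi1 : 1 ≤ i := by
    by_contra h
    obtain rfl : i = 0 := by omega
    have := (Nat.modEq_iff_dvd' hr1).mp hr.symm
    rw [hru, pow_zero, one_mul] at this
    exact hu this
  have hie : i < e := by
    by_contra h
    refine hre ((Nat.modEq_iff_dvd' hr1).mpr ?_).symm
    rw [hru]
    exact (pow_dvd_pow p (by omega)).mul_right u
  obtain ⟨k, rfl⟩ : ∃ k, e = k + i := ⟨e - i, by omega⟩
  have : NeZero (p ^ (k + i)) := ⟨pow_ne_zero _ hp.ne_zero⟩
  have hpi : i + 2 ≤ p * i := by nlinarith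
  have o1 : orderOf ((r : ℕ) : ZMod (p ^ (k + i))) = p ^ k := by
    have := ZMod.orderOf_one_add_mul_prime_pow hp i (by omega) hpi (u : ℤ) (by exact_mod_cast hu) k
    rw [hr']; push_cast at this ⊢; exact this
  have o2 : orderOf ((1 + p ^ i : ℕ) : ZMod (p ^ (k + i))) = p ^ k := by
    have := ZMod.orderOf_one_add_mul_prime_pow hp i (by omega) hpi 1
      (fun h => hp.one_lt.ne' (by exact_mod_cast Int.eq_one_of_dvd_one (by positivity) h)) k
    push_cast at this ⊢; simpa using this
  have c1 : ∀ c : ℕ, c ≡ 1 [MOD p] → c.Coprime (p ^ (k + i)) := fun c hc =>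
    Nat.Coprime.pow_right _ (by rw [Nat.Coprime, hc.gcd_eq]; simp)
  have c2 : 1 + p ^ i ≡ 1 [MOD p] := by
    have : p ∣ p ^ i := dvd_pow_self p (by omega)
    exact ((Nat.modEq_iff_dvd' (by omega)).mpr (by simpa using this)).symm
  have := ZMod.isCyclic_units_of_prime_pow p hp hp2 (k + i)
  set x := ZMod.unitOfCoprime r (c1 r hr) with hx
  set y := ZMod.unitOfCoprime _ (c1 _ c2) with hy
  have ox : orderOf x = p ^ k := by rw [← orderOf_units, hx, ZMod.coe_unitOfCoprime, o1]
  have oy : orderOf y = p ^ k := by rw [← orderOf_units, hy, ZMod.coe_unitOfCoprime, o2]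
  have hmem : y ∈ Subgroup.zpowers x :=
    mem_zpowers_of_orderOf_eq (ox.trans oy.symm)
  rw [← mem_powers_iff_mem_zpowers] at hmem
  obtain ⟨t, ht⟩ := hmem
  refine ⟨i, t, hi1, hie, ?_, ?_⟩
  · rw [Nat.coprime_comm, hp.coprime_iff_not_dvd]
    rintro ⟨s, rfl⟩
    have hk : k ≠ 0 := by omega
    obtain ⟨l, rfl⟩ := Nat.exists_eq_succ_of_ne_zero hk
    have h1 : y ^ p ^ l = 1 := by
      have : x ^ p ^ (l + 1) = 1 := by rw [← Nat.succ_eq_add_one, ← ox, pow_orderOf_eq_one]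
      rw [← ht]
      show (x ^ (p * s)) ^ p ^ l = 1
      rw [← pow_mul, show p * s * p ^ l = p ^ (l + 1) * s by ring, pow_mul, this, one_pow]
    have h2 := orderOf_dvd_of_pow_eq_one h1
    rw [oy] at h2
    have := (Nat.pow_dvd_pow_iff_le_right hp.one_lt).mp h2
    omega
  · have h := congrArg (Units.val) ht
    simp only [Units.val_pow_eq_pow_val, hx, hy, ZMod.coe_unitOfCoprime] at h
    rw [← ZMod.natCast_eq_natCast_iff]
    push_cast at h ⊢
    exact h

section CommutationRelation

variable {G : Type*} [Group G] {a b : G} {c : ℕ}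

lemma pow_mul_of_mul_eq (h : a * b = b * a ^ c) (l : ℕ) : a ^ l * b = b * a ^ (c * l) := by
  induction l with
  | zero => simp
  | succ l ih => rw [pow_succ, mul_assoc, h, ← mul_assoc, ih, mul_assoc, ← pow_add, mul_add_one]

lemma mul_pow_of_mul_eq (h : a * b = b * a ^ c) (s : ℕ) : a * b ^ s = b ^ s * a ^ c ^ s := by
  induction s with
  | zero => simp
  | succ s ih =>
    rw [pow_succ, ← mul_assoc, ih, mul_assoc, pow_mul_of_mul_eq h, ← mul_assoc, pow_succ' c]

lemma pow_pow_of_mul_eq (h : a * b = b * a ^ c) (k j : ℕ) :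
    (b * a ^ k) ^ j = b ^ j * a ^ (k * geomSum c j) := by
  induction j with
  | zero => simp [geomSum]
  | succ j ih =>
    rw [pow_succ, ih, geomSum_succ, mul_assoc, ← mul_assoc _ b, pow_mul_of_mul_eq h, mul_assoc b,
      ← pow_add, ← mul_assoc, ← pow_succ]
    congr 2
    ring

lemma exists_eq_pow_mul_pow_of_mem_closure (ha : IsOfFinOrder a) (hb : IsOfFinOrder b)
    (h : a * b = b * a ^ c) {x : G} (hx : x ∈ Subgroup.closure {a, b}) :
    ∃ s k : ℕ, x = b ^ s * a ^ k := by
  have key : ∀ y ∈ ({a, b} : Set G), ∀ j s k : ℕ, ∃ s' k' : ℕ,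
      b ^ s * a ^ k * y ^ j = b ^ s' * a ^ k' := by
    rintro y (rfl | rfl) j s k
    · exact ⟨s, k + j, by rw [mul_assoc, ← pow_add]⟩
    · exact ⟨s + j, c ^ j * k, by
        rw [mul_assoc, pow_mul_of_mul_eq (mul_pow_of_mul_eq h j), ← mul_assoc, ← pow_add]⟩
  have hfin : ∀ y ∈ ({a, b} : Set G), ∃ j : ℕ, y⁻¹ = y ^ j := by
    intro y hy
    have hy' : IsOfFinOrder y := by
      rcases hy with rfl | rfl
      · exact ha
      · exact hb
    obtain ⟨j, hj⟩ := (hy'.mem_powers_iff_mem_zpowers).mpr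
      (inv_mem (Subgroup.mem_zpowers y))
    exact ⟨j, hj.symm⟩
  induction hx using Subgroup.closure_induction_right with
  | one => exact ⟨0, 0, by simp⟩
  | mul_right x _ y hy ih =>
    obtain ⟨s, k, rfl⟩ := ih
    simpa using key y hy 1 s k
  | mul_inv_cancel x _ y hy ih =>
    obtain ⟨s, k, rfl⟩ := ih
    obtain ⟨j, hj⟩ := hfin y hy
    rw [hj]
    exact key y hy j s k

end CommutationRelation

section BeauvilleSigma

variable {G : Type*} [Group G] {x y u : G}

lemma mem_beauvilleSigma :
    u ∈ beauvilleSigma x y ↔ ∃ g v : G, (v = x ∨ v = y ∨ v = x * y) ∧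
      ∃ h ∈ Subgroup.zpowers v, g⁻¹ * h * g = u := by
  simp only [beauvilleSigma, Set.mem_iUnion, Set.mem_union, Set.mem_image, SetLike.mem_coe]
  constructor
  · rintro ⟨g, (h | h) | h⟩
    exacts [⟨g, x, by simp, h⟩, ⟨g, y, by simp, h⟩, ⟨g, x * y, by simp, h⟩]
  · rintro ⟨g, v, rfl | rfl | rfl, h⟩
    exacts [⟨g, .inl (.inl h)⟩, ⟨g, .inl (.inr h)⟩, ⟨g, .inr h⟩]

lemma beauvilleSigma_pow (h : u ∈ beauvilleSigma x y) (j : ℕ) : u ^ j ∈ beauvilleSigma x y := by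
  obtain ⟨g, v, hv, w, hw, rfl⟩ := mem_beauvilleSigma.mp h
  refine mem_beauvilleSigma.mpr ⟨g, v, hv, w ^ j, pow_mem hw j, ?_⟩
  have := (conj_pow (i := j) (a := g⁻¹) (b := w)).symm
  simpa using this

lemma beauvilleSigma_conj (h : u ∈ beauvilleSigma x y) (g : G) :
    g⁻¹ * u * g ∈ beauvilleSigma x y := by
  obtain ⟨g', v, hv, w, hw, rfl⟩ := mem_beauvilleSigma.mp h
  exact mem_beauvilleSigma.mpr ⟨g' * g, v, hv, w, hw, by group⟩

lemma mem_beauvilleSigma_of_mem_zpowers {v : G} (hv : v = x ∨ v = y ∨ v = x * y)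
    (h : u ∈ Subgroup.zpowers v) : u ∈ beauvilleSigma x y :=
  mem_beauvilleSigma.mpr ⟨1, v, hv, u, h, by simp⟩

/-- If a proper subgroup `H` is given, two of `x`, `y`, `x * y` lie outside `H` and generate. -/
lemma exists_generators_notMem (hxy : Subgroup.closure {x, y} = ⊤) {H : Subgroup G}
    (hH : H ≠ ⊤) : ∃ u v : G, (u = x ∨ u = y ∨ u = x * y) ∧ (v = x ∨ v = y ∨ v = x * y) ∧
      u ∉ H ∧ v ∉ H ∧ Subgroup.closure {u, v} = ⊤ := by
  by_cases hx : x ∈ H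
  · by_cases hy : y ∈ H
    · refine absurd (top_le_iff.mp (hxy ▸ ?_)) hH
      rw [Subgroup.closure_le]
      rintro _ (rfl | rfl) <;> assumption
    · refine ⟨y, x * y, by simp, by simp, hy, fun h => hy ((H.mul_mem_cancel_left hx).mp h), ?_⟩
      rw [← top_le_iff, ← hxy, Subgroup.closure_le]
      have h1 : y ∈ Subgroup.closure {y, x * y} := Subgroup.subset_closure (by simp)
      have h2 : x * y ∈ Subgroup.closure {y, x * y} := Subgroup.subset_closure (by simp)
      rintro _ (rfl | rfl)
      · exact (Subgroup.mul_mem_cancel_right _ h1).mp h2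
      · exact h1
  · by_cases hy : y ∈ H
    · refine ⟨x, x * y, by simp, by simp, hx, fun h => hx ((H.mul_mem_cancel_right hy).mp h), ?_⟩
      rw [← top_le_iff, ← hxy, Subgroup.closure_le]
      have h1 : x ∈ Subgroup.closure {x, x * y} := Subgroup.subset_closure (by simp)
      have h2 : x * y ∈ Subgroup.closure {x, x * y} := Subgroup.subset_closure (by simp)
      rintro _ (rfl | rfl)
      · exact h1
      · exact (Subgroup.mul_mem_cancel_left _ h1).mp h2
    · exact ⟨x, y, by simp, by simp, hx, hy, hxy⟩

end BeauvilleSigma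

/-- `⟨a⟩` is a normal subgroup of order `p ^ m`, the image of `b` generates `G ⧸ ⟨a⟩`, which has
order `p ^ n`, and `a ^ b = a ^ r`. -/
structure IsMetacyclicPair {G : Type*} [Group G] (p m n r : ℕ) (a b : G) : Prop where
  orderOf_left : orderOf a = p ^ m
  mul_eq : a * b = b * a ^ r
  pow_mem_iff : ∀ j : ℕ, b ^ j ∈ Subgroup.zpowers a ↔ p ^ n ∣ j
  exists_eq : ∀ g : G, ∃ s k : ℕ, g = b ^ s * a ^ k

lemma IsMetacyclic.exists_isMetacyclicPair {G : Type*} [Group G] [Finite G] {p : ℕ}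
    (hp : p.Prime) (hpG : IsPGroup p G) (h : IsMetacyclic G) :
    ∃ m n r : ℕ, ∃ a b : G, IsMetacyclicPair p m n r a b := by
  have := Fact.mk hp
  obtain ⟨N, hcyc, hN, hq⟩ := h
  obtain ⟨a, rfl⟩ := (Subgroup.isCyclic_iff_exists_zpowers_eq_top N).mp hcyc
  obtain ⟨b', hb'⟩ := hq.exists_generator
  obtain ⟨b, rfl⟩ := QuotientGroup.mk_surjective b'
  obtain ⟨m, hm⟩ := IsPGroup.iff_orderOf.mp hpG a
  obtain ⟨n, hn⟩ := IsPGroup.iff_orderOf.mp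
    (hpG.to_quotient (Subgroup.zpowers a)) (b : G ⧸ Subgroup.zpowers a)
  have hconj : b⁻¹ * a * b ∈ Subgroup.zpowers a := by
    simpa using hN.conj_mem a (Subgroup.mem_zpowers a) b⁻¹
  obtain ⟨r, hr⟩ := mem_powers_iff_mem_zpowers.mpr hconj
  refine ⟨m, n, r, a, b, hm, ?_, fun j => ?_, fun g => ?_⟩
  · simp only at hr
    rw [hr]; group
  · rw [← QuotientGroup.eq_one_iff, QuotientGroup.mk_pow, ← orderOf_dvd_iff_pow_eq_one, hn]
  · obtain ⟨s, hs⟩ := mem_powers_iff_mem_zpowers.mpr (hb' g)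
    have : (b ^ s)⁻¹ * g ∈ Subgroup.zpowers a := by
      rw [← QuotientGroup.eq, QuotientGroup.mk_pow]
      exact hs
    obtain ⟨k, hk⟩ := mem_powers_iff_mem_zpowers.mpr this
    simp only at hk
    exact ⟨s, k, by rw [hk]; group⟩

namespace IsMetacyclicPair

variable {G : Type*} [Group G] {p m n r : ℕ} {a b : G}

lemma commute_of_commute (h : IsMetacyclicPair p m n r a b) (hab : Commute a b) (x y : G) :
    x * y = y * x := by
  obtain ⟨s, k, rfl⟩ := h.exists_eq x
  obtain ⟨s', k', rfl⟩ := h.exists_eq y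
  have h1 : ∀ s k, Commute (b ^ s) (a ^ k) := fun s k => (hab.pow_pow k s).symm
  have h2 : ∀ s k, Commute (b ^ s) (b ^ k) := fun s k => (Commute.refl b).pow_pow s k
  have h3 : ∀ s k, Commute (a ^ s) (a ^ k) := fun s k => (Commute.refl a).pow_pow s k
  exact ((h2 s s').mul_right (h1 s k')).mul_left (((h1 s' k).symm).mul_right (h3 k k'))

lemma left_exponent_ne_zero (h : IsMetacyclicPair p m n r a b) (hab : ¬ Commute a b) : m ≠ 0 := by
  rintro rfl
  have := h.orderOf_left
  rw [pow_zero, orderOf_eq_one_iff] at this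
  exact hab (this ▸ Commute.one_left b)

lemma right_exponent_ne_zero (h : IsMetacyclicPair p m n r a b) (hab : ¬ Commute a b) :
    n ≠ 0 := by
  rintro rfl
  have := (h.pow_mem_iff 1).mpr (by simp)
  rw [pow_one] at this
  obtain ⟨j, rfl⟩ := Subgroup.mem_zpowers_iff.mp this
  exact hab (Commute.self_zpow a j)

lemma modEq_one (h : IsMetacyclicPair p m n r a b) (hp : p.Prime) (hab : ¬ Commute a b) :
    r ≡ 1 [MOD p] := by
  have := Fact.mk hp
  have hmem : b ^ p ^ n ∈ Subgroup.zpowers a := (h.pow_mem_iff _).mpr dvd_rfl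
  obtain ⟨j, hj⟩ := Subgroup.mem_zpowers_iff.mp hmem
  have h1 := mul_pow_of_mul_eq h.mul_eq (p ^ n)
  rw [← hj, (Commute.self_zpow a j).eq] at h1
  have h2 : a ^ r ^ p ^ n = a ^ 1 := by rw [pow_one]; exact (mul_left_cancel h1).symm
  rw [pow_eq_pow_iff_modEq, h.orderOf_left] at h2
  have h3 := h2.of_dvd (dvd_pow_self p (h.left_exponent_ne_zero hab))
  rw [← ZMod.natCast_eq_natCast_iff] at h3 ⊢
  rw [Nat.cast_pow, ZMod.pow_card_pow] at h3
  exact h3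

lemma exists_zpowers_eq (h : IsMetacyclicPair p m n r a b) (hp : p.Prime) (hpG : IsPGroup p G)
    {u : G} (hu : u ∉ Subgroup.closure {a, b ^ p}) :
    ∃ k : ℕ, b * a ^ k ∈ Subgroup.zpowers u ∧ u ∈ Subgroup.zpowers (b * a ^ k) := by
  have := Fact.mk hp
  obtain ⟨s, k, rfl⟩ := h.exists_eq u
  have hs : ¬ p ∣ s := by
    rintro ⟨s, rfl⟩
    refine hu (mul_mem ?_ (pow_mem (Subgroup.subset_closure (by simp)) k))
    rw [pow_mul]
    exact pow_mem (Subgroup.subset_closure (by simp)) s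
  obtain ⟨d, hd⟩ := IsPGroup.iff_orderOf.mp hpG b
  obtain ⟨f, hf⟩ := IsPGroup.iff_orderOf.mp hpG (b ^ s * a ^ k)
  have hcop : s.Coprime (p ^ (d + 1)) :=
    Nat.Coprime.pow_right _ ((Nat.Prime.coprime_iff_not_dvd hp).mpr hs).symm
  obtain ⟨t, -, ht⟩ := Nat.exists_mul_mod_eq_one_of_coprime hcop (Nat.one_lt_pow (by simp) hp.one_lt)
  have ht' : s * t ≡ 1 [MOD p ^ (d + 1)] := by
    rw [Nat.ModEq, ht, Nat.mod_eq_of_lt (Nat.one_lt_pow (by simp) hp.one_lt)]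
  have hbt : b ^ (s * t) = b := by
    conv_rhs => rw [← pow_one b]
    rw [pow_eq_pow_iff_modEq, hd]
    exact ht'.of_dvd (pow_dvd_pow p (by simp))
  have htp : t.Coprime p := by
    rw [Nat.coprime_comm, hp.coprime_iff_not_dvd]
    rintro ⟨t, rfl⟩
    have h1 := ht'.of_dvd (dvd_pow_self p (by simp))
    have h0 : s * (p * t) ≡ 0 [MOD p] := (Nat.modEq_zero_iff_dvd).mpr ⟨s * t, by ring⟩
    exact hp.one_lt.ne' (Nat.dvd_one.mp ((Nat.modEq_zero_iff_dvd).mp (h1.symm.trans h0)))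
  have hpow : (b ^ s * a ^ k) ^ t = b * a ^ (k * geomSum (r ^ s) t) := by
    rw [pow_pow_of_mul_eq (mul_pow_of_mul_eq h.mul_eq s), ← pow_mul, hbt]
  refine ⟨k * geomSum (r ^ s) t, ?_, ?_⟩
  · rw [← hpow]; exact Subgroup.npow_mem_zpowers _ _
  · rw [← hpow]
    obtain ⟨w, hw⟩ := exists_pow_eq_self_of_coprime (x := b ^ s * a ^ k) (n := t)
      (hf ▸ htp.pow_right f)
    exact Subgroup.mem_zpowers_iff.mpr ⟨w, by rw [zpow_natCast, hw]⟩

variable [Finite G]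

lemma shift (h : IsMetacyclicPair p m n r a b) (k : ℕ) :
    IsMetacyclicPair p m n r a (b * a ^ k) := by
  refine ⟨h.orderOf_left, ?_, fun j => ?_, fun g => ?_⟩
  · rw [← mul_assoc, h.mul_eq, mul_assoc, mul_assoc, (Commute.refl a).pow_pow]
  · rw [pow_pow_of_mul_eq h.mul_eq, ← h.pow_mem_iff j]
    exact Subgroup.mul_mem_cancel_right _ (Subgroup.npow_mem_zpowers _ _)
  · obtain ⟨s, l, rfl⟩ := h.exists_eq g
    have : (a ^ (k * geomSum r s))⁻¹ * a ^ l ∈ Subgroup.zpowers a :=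
      mul_mem (inv_mem (Subgroup.npow_mem_zpowers _ _)) (Subgroup.npow_mem_zpowers _ _)
    obtain ⟨l', hl'⟩ := mem_powers_iff_mem_zpowers.mpr this
    simp only at hl'
    exact ⟨s, l', by rw [hl', pow_pow_of_mul_eq h.mul_eq]; group⟩

/-- The subgroup `⟨a, b ^ p⟩` is proper. -/
lemma closure_pow_ne_top (h : IsMetacyclicPair p m n r a b) (hp : p.Prime)
    (hab : ¬ Commute a b) : Subgroup.closure {a, b ^ p} ≠ ⊤ := by
  intro htop
  have hb : b ∈ Subgroup.closure {a, b ^ p} := htop ▸ Subgroup.mem_top b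
  obtain ⟨s, k, hs⟩ := exists_eq_pow_mul_pow_of_mem_closure (isOfFinOrder_of_finite _)
    (isOfFinOrder_of_finite _) (mul_pow_of_mul_eq h.mul_eq p) hb
  have hpn : 1 ≤ p ^ n := Nat.one_le_pow _ _ hp.pos
  have hmem : b ^ ((p ^ n - 1) + p * s) ∈ Subgroup.zpowers a := by
    have hprod : b ^ ((p ^ n - 1) + p * s) * a ^ k = b ^ p ^ n := by
      rw [pow_add, pow_mul, mul_assoc, ← hs, ← pow_succ, Nat.sub_add_cancel hpn]
    rw [← Subgroup.mul_mem_cancel_right _ (Subgroup.npow_mem_zpowers a k), hprod,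
      h.pow_mem_iff]
  rw [h.pow_mem_iff] at hmem
  have hpp : p ∣ p ^ n := dvd_pow_self p (h.right_exponent_ne_zero hab)
  have h1 : p ∣ (p ^ n - 1) := (Nat.dvd_add_left (dvd_mul_right p s)).mp (hpp.trans hmem)
  have h2 : p ∣ 1 := by
    have := (Nat.dvd_sub hpp h1)
    rwa [Nat.sub_sub_self hpn] at this
  exact hp.one_lt.ne' (Nat.dvd_one.mp h2)

lemma commute_of_closure_pow_eq_top (h : IsMetacyclicPair p m n r a b)
    (htop : Subgroup.closure {a ^ p, b} = ⊤) : Commute a b := by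
  have hrel : a ^ p * b = b * (a ^ p) ^ r := by
    rw [pow_mul_of_mul_eq h.mul_eq, ← pow_mul, mul_comm]
  obtain ⟨s, l, hs⟩ := exists_eq_pow_mul_pow_of_mem_closure (isOfFinOrder_of_finite _)
    (isOfFinOrder_of_finite _) hrel (x := a) (htop ▸ Subgroup.mem_top a)
  have h1 : a ^ ((1 : ℤ) - p * l) = b ^ s := by
    rw [zpow_sub, zpow_one, zpow_mul, zpow_natCast, zpow_natCast]
    rw [mul_inv_eq_iff_eq_mul, ← zpow_natCast a p, zpow_natCast, ← hs]
  obtain ⟨x, y, hxy⟩ : IsCoprime ((1 : ℤ) - p * l) ((p : ℤ) ^ m) :=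
    IsCoprime.pow_right ⟨1, l, by ring⟩
  have h2 : a = (b ^ s) ^ x := by
    have : a ^ ((p : ℤ) ^ m) = 1 := by
      rw [← Nat.cast_pow, zpow_natCast, ← h.orderOf_left, pow_orderOf_eq_one]
    conv_lhs => rw [← zpow_one a, ← hxy, zpow_add, mul_comm, mul_comm y, zpow_mul, h1, zpow_mul,
      this, one_zpow, mul_one]
  rw [h2]
  exact ((Commute.refl b).pow_left s).zpow_left x

lemma not_modEq_of_closure_eq_top (h : IsMetacyclicPair p m n r a b) (hab : ¬ Commute a b)
    {k l : ℕ} (hkl : Subgroup.closure {b * a ^ k, b * a ^ l} = ⊤) : ¬ k ≡ l [MOD p] := by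
  wlog hle : k ≤ l generalizing k l
  · exact fun hm => this (by rwa [Set.pair_comm]) (by omega) hm.symm
  intro hm
  obtain ⟨d, hd⟩ := (Nat.modEq_iff_dvd' hle).mp hm
  obtain rfl : l = k + p * d := by omega
  have htop : Subgroup.closure {a ^ p, b * a ^ k} = ⊤ := by
    rw [← top_le_iff, ← hkl, Subgroup.closure_le]
    have h1 : b * a ^ k ∈ Subgroup.closure {a ^ p, b * a ^ k} := Subgroup.subset_closure (by simp)
    have h2 : a ^ p ∈ Subgroup.closure {a ^ p, b * a ^ k} := Subgroup.subset_closure (by simp)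
    rintro _ (rfl | rfl)
    · exact h1
    · rw [pow_add, pow_mul, ← mul_assoc]
      exact mul_mem h1 (pow_mem h2 d)
  have hc := (h.shift k).commute_of_closure_pow_eq_top htop
  apply hab
  have := hc.mul_right ((Commute.refl a).pow_right k).inv_right
  simpa using this

/-- For every generating pair, `Σ(x, y)` contains `b * a ^ k` for two values of `k` that are
distinct modulo `p`. -/
lemma exists_mem_beauvilleSigma (h : IsMetacyclicPair p m n r a b) (hp : p.Prime)
    (hpG : IsPGroup p G) (hab : ¬ Commute a b) {x y : G} (hxy : Subgroup.closure {x, y} = ⊤) :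
    ∃ k l : ℕ, ¬ k ≡ l [MOD p] ∧ b * a ^ k ∈ beauvilleSigma x y ∧
      b * a ^ l ∈ beauvilleSigma x y := by
  obtain ⟨u, v, hu, hv, huH, hvH, huv⟩ :=
    exists_generators_notMem hxy (h.closure_pow_ne_top hp hab)
  obtain ⟨k, hk, hk'⟩ := h.exists_zpowers_eq hp hpG huH
  obtain ⟨l, hl, hl'⟩ := h.exists_zpowers_eq hp hpG hvH
  refine ⟨k, l, h.not_modEq_of_closure_eq_top hab ?_, mem_beauvilleSigma_of_mem_zpowers hu hk,
    mem_beauvilleSigma_of_mem_zpowers hv hl⟩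
  rw [← top_le_iff, ← huv, Subgroup.closure_le]
  rintro _ (rfl | rfl)
  · exact Subgroup.zpowers_le.mpr (Subgroup.subset_closure (by simp)) hk'
  · exact Subgroup.zpowers_le.mpr (Subgroup.subset_closure (by simp)) hl'

end IsMetacyclicPair

section Disjoint

variable {G : Type*} [Group G] {p m n r : ℕ} {a b : G}

lemma exists_pow_pow_eq_of_ne_one (hp : p.Prime) (ha : orderOf a = p ^ m) {j : ℕ}
    (hj : a ^ j ≠ 1) : ∃ l : ℕ, (a ^ j) ^ l = a ^ p ^ (m - 1) := by
  have hj0 : j ≠ 0 := by rintro rfl; simp at hj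
  obtain ⟨v, w, hw, rfl⟩ := Nat.exists_eq_pow_mul_and_not_dvd hj0 p hp.ne_one
  have hvm : v < m := by
    by_contra hvm
    refine hj (orderOf_dvd_iff_pow_eq_one.mp ?_)
    rw [ha]
    exact (pow_dvd_pow p (by omega)).mul_right w
  have hcop : w.Coprime (orderOf (a ^ p ^ (m - 1))) := by
    refine Nat.Coprime.coprime_dvd_right (orderOf_pow_dvd _) ?_
    rw [ha]
    exact Nat.Coprime.pow_right _ (hp.coprime_iff_not_dvd.mpr hw).symm
  obtain ⟨t, ht⟩ := exists_pow_eq_self_of_coprime hcop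
  refine ⟨p ^ (m - 1 - v) * t, ?_⟩
  rw [← ht, ← pow_mul, ← pow_mul, ← pow_mul]
  congr 1
  rw [show p ^ (m - 1) = p ^ v * p ^ (m - 1 - v) by rw [← pow_add]; congr 1; omega]
  ring

namespace IsMetacyclicPair

lemma pow_eq_one_iff (h : IsMetacyclicPair p m n r a b) (k : ℕ) : a ^ k = 1 ↔ p ^ m ∣ k := by
  rw [← orderOf_dvd_iff_pow_eq_one, h.orderOf_left]

lemma dvd_geomSum (h : IsMetacyclicPair p m n r a b) (hp : p.Prime) {k l : ℕ}
    (hkl : ¬ k ≡ l [MOD p]) (hk : (b * a ^ k) ^ p ^ n = 1) (hl : (b * a ^ l) ^ p ^ n = 1) :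
    p ^ m ∣ geomSum r (p ^ n) := by
  rw [pow_pow_of_mul_eq h.mul_eq] at hk hl
  have h1 := mul_left_cancel (hk.trans hl.symm)
  rw [pow_eq_pow_iff_modEq, h.orderOf_left, Nat.modEq_iff_dvd] at h1
  have h2 : ((p ^ m : ℕ) : ℤ) ∣ ((l : ℤ) - k) * (geomSum r (p ^ n) : ℕ) := by
    rw [sub_mul]; exact_mod_cast h1
  have hcop : IsCoprime ((p ^ m : ℕ) : ℤ) ((l : ℤ) - k) := by
    push_cast
    refine IsCoprime.pow_left ?_
    rw [(Nat.prime_iff_prime_int.mp hp).coprime_iff_not_dvd]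
    exact fun hd => hkl (Nat.modEq_iff_dvd.mpr hd)
  exact_mod_cast hcop.dvd_of_dvd_mul_left h2

lemma orderOf_right (h : IsMetacyclicPair p m n r a b) (hb : b ^ p ^ n = 1) :
    orderOf b = p ^ n :=
  Nat.dvd_antisymm (orderOf_dvd_of_pow_eq_one hb)
    ((h.pow_mem_iff _).mp (by rw [pow_orderOf_eq_one]; exact one_mem _))

lemma exponent_eq (h : IsMetacyclicPair p n n r a b) (hp : p.Prime) (hp2 : p ≠ 2)
    (hab : ¬ Commute a b) (hb : b ^ p ^ n = 1) : Monoid.exponent G = p ^ n := by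
  refine Nat.dvd_antisymm (Monoid.exponent_dvd_of_forall_pow_eq_one fun g => ?_)
    (h.orderOf_left ▸ Monoid.order_dvd_exponent a)
  obtain ⟨s, k, rfl⟩ := h.exists_eq g
  obtain ⟨w, hw, -⟩ := geomSum_prime_pow hp hp2 (c := r ^ s)
    (by simpa using (h.modEq_one hp hab).pow s) n
  rw [pow_pow_of_mul_eq (mul_pow_of_mul_eq h.mul_eq s), pow_right_comm, hb, one_pow, one_mul,
    h.pow_eq_one_iff, hw]
  exact (dvd_mul_right _ w).mul_left k

variable [Finite G]

lemma exists_pow_eq_of_pow_ne_one (h : IsMetacyclicPair p m n r a b) (hp : p.Prime)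
    (hb : b ^ p ^ n ≠ 1) : ∃ l : ℕ, b ^ l = a ^ p ^ (m - 1) := by
  obtain ⟨j, hj⟩ := mem_powers_iff_mem_zpowers.mpr ((h.pow_mem_iff (p ^ n)).mpr dvd_rfl)
  simp only at hj
  obtain ⟨l, hl⟩ := exists_pow_pow_eq_of_ne_one hp h.orderOf_left (hj ▸ hb)
  exact ⟨p ^ n * l, by rw [pow_mul, ← hj, hl]⟩

/-- A Beauville structure forces the existence of a cyclic complement of `⟨a⟩`. -/
lemma exists_complement (h : IsMetacyclicPair p m n r a b) (hp : p.Prime)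
    (hpG : IsPGroup p G) (hab : ¬ Commute a b) {x₁ y₁ x₂ y₂ : G}
    (hB : IsBeauvilleStructure x₁ y₁ x₂ y₂) :
    ∃ b' : G, IsMetacyclicPair p m n r a b' ∧ b' ^ p ^ n = 1 ∧ p ^ m ∣ geomSum r (p ^ n) := by
  obtain ⟨h₁, h₂, hd⟩ := hB
  obtain ⟨k₁, l₁, hkl₁, hk₁, hl₁⟩ := h.exists_mem_beauvilleSigma hp hpG hab h₁
  obtain ⟨k₂, l₂, hkl₂, hk₂, hl₂⟩ := h.exists_mem_beauvilleSigma hp hpG hab h₂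
  have key : ∀ {x y : G} {k l : ℕ}, ¬ k ≡ l [MOD p] → b * a ^ k ∈ beauvilleSigma x y →
      b * a ^ l ∈ beauvilleSigma x y → a ^ p ^ (m - 1) ∉ beauvilleSigma x y →
      ∃ b' : G, IsMetacyclicPair p m n r a b' ∧ b' ^ p ^ n = 1 ∧
        p ^ m ∣ geomSum r (p ^ n) := by
    intro x y k l hkl hk hl hz
    have hone : ∀ k, b * a ^ k ∈ beauvilleSigma x y → (b * a ^ k) ^ p ^ n = 1 := by
      intro k hk
      by_contra hne
      obtain ⟨t, ht⟩ := (h.shift k).exists_pow_eq_of_pow_ne_one hp hne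
      exact hz (ht ▸ beauvilleSigma_pow hk t)
    exact ⟨b * a ^ k, h.shift k, hone k hk, h.dvd_geomSum hp hkl (hone k hk) (hone l hl)⟩
  by_cases hz₁ : a ^ p ^ (m - 1) ∈ beauvilleSigma x₁ y₁
  · refine key hkl₂ hk₂ hl₂ fun hz₂ => ?_
    have hz : a ^ p ^ (m - 1) = 1 := by
      have : a ^ p ^ (m - 1) ∈ beauvilleSigma x₁ y₁ ∩ beauvilleSigma x₂ y₂ := ⟨hz₁, hz₂⟩
      rwa [hd] at this
    rw [h.pow_eq_one_iff, Nat.pow_dvd_pow_iff_le_right hp.one_lt] at hz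
    have := h.left_exponent_ne_zero hab
    omega
  · exact key hkl₁ hk₁ hl₁ hz₁

lemma not_modEq_mul_geomSum (h : IsMetacyclicPair p m n r a b) (hp : p.Prime) (hn : n ≠ 0)
    {x₁ y₁ x₂ y₂ : G} (hB : IsBeauvilleStructure x₁ y₁ x₂ y₂) {k l : ℕ}
    (hk : b * a ^ k ∈ beauvilleSigma x₁ y₁) (hl : b * a ^ l ∈ beauvilleSigma x₂ y₂) :
    ¬ k * geomSum r (p ^ (n - 1)) ≡ l * geomSum r (p ^ (n - 1)) [MOD p ^ m] := by
  intro hkl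
  have heq : (b * a ^ k) ^ p ^ (n - 1) = (b * a ^ l) ^ p ^ (n - 1) := by
    rw [pow_pow_of_mul_eq h.mul_eq, pow_pow_of_mul_eq h.mul_eq]
    congr 1
    rwa [pow_eq_pow_iff_modEq, h.orderOf_left]
  have hmem : (b * a ^ k) ^ p ^ (n - 1) ∈ beauvilleSigma x₁ y₁ ∩ beauvilleSigma x₂ y₂ :=
    ⟨beauvilleSigma_pow hk _, heq ▸ beauvilleSigma_pow hl _⟩
  rw [hB.2.2, Set.mem_singleton_iff] at hmem
  have h1 := ((h.shift k).pow_mem_iff (p ^ (n - 1))).mp (hmem ▸ one_mem _)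
  rw [Nat.pow_dvd_pow_iff_le_right hp.one_lt] at h1
  omega

lemma not_modEq_of_mem (h : IsMetacyclicPair p m n r a b) (hp : p.Prime) (hab : ¬ Commute a b)
    (hS : p ^ m ∣ geomSum r (p ^ n))
    {x₁ y₁ x₂ y₂ : G} (hB : IsBeauvilleStructure x₁ y₁ x₂ y₂) {k l : ℕ}
    (hk : b * a ^ k ∈ beauvilleSigma x₁ y₁) (hl : b * a ^ l ∈ beauvilleSigma x₂ y₂) :
    ¬ k ≡ l [MOD p] := by
  intro hkl
  have hn := h.right_exponent_ne_zero hab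
  obtain ⟨d, rfl⟩ := Nat.exists_eq_succ_of_ne_zero hn
  by_cases hcase : p ≠ 2 ∨ d ≠ 0
  · refine h.not_modEq_mul_geomSum hp hn hB hk hl ?_
    obtain ⟨w, hw, hpw⟩ := geomSum_step hp (h.modEq_one hp hab) d hcase
    rw [Nat.succ_eq_add_one, hw] at hS
    have hS' : p ^ m ∣ p * geomSum r (p ^ d) :=
      (Nat.Coprime.pow_left m (hp.coprime_iff_not_dvd.mpr hpw)).dvd_of_dvd_mul_right hS
    rw [Nat.succ_sub_one]
    exact (hkl.mul_right' _).of_dvd hS'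
  · push Not at hcase
    obtain ⟨rfl, rfl⟩ := hcase
    have hS1 : 2 ^ m ∣ r + 1 := by
      have : geomSum r (2 ^ (0 + 1)) = r + 1 := by simp [geomSum, Finset.sum_range_succ, add_comm]
      rwa [← this]
    obtain ⟨c, hc⟩ : ∃ c, k + l = 2 * c :=
      ⟨(k + l) / 2, by have := hkl; unfold Nat.ModEq at this; omega⟩
    obtain ⟨q, hq⟩ : ∃ q, 2 ^ m = q + 1 :=
      ⟨2 ^ m - 1, (Nat.sub_add_cancel Nat.one_le_two_pow).symm⟩
    set t := c + q * k with ht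
    have hconj : (a ^ t)⁻¹ * (b * a ^ k) * a ^ t = b * a ^ l := by
      rw [mul_assoc, inv_mul_eq_iff_eq_mul, ← mul_assoc, pow_mul_of_mul_eq h.mul_eq, mul_assoc,
        mul_assoc, ← pow_add, ← pow_add]
      congr 1
      rw [pow_eq_pow_iff_modEq, h.orderOf_left, Nat.modEq_iff_dvd]
      obtain ⟨f, hf⟩ := hS1
      refine ⟨f * t - 2 * k, ?_⟩
      have hf' : (r : ℤ) + 1 = (2 ^ m : ℕ) * f := by exact_mod_cast hf
      have hc' : (k : ℤ) + l = 2 * c := by exact_mod_cast hc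
      have hq' : ((2 ^ m : ℕ) : ℤ) = q + 1 := by exact_mod_cast hq
      have ht' : (t : ℤ) = c + q * k := by exact_mod_cast ht
      push_cast at *
      linear_combination (t : ℤ) * hf' + hc' + 2 * (k : ℤ) * hq' - 2 * ht'
    have hmem : b * a ^ l ∈ beauvilleSigma x₁ y₁ ∩ beauvilleSigma x₂ y₂ :=
      ⟨hconj ▸ beauvilleSigma_conj hk (a ^ t), hl⟩
    rw [hB.2.2, Set.mem_singleton_iff] at hmem
    have h1 := ((h.shift l).pow_mem_iff 1).mp (by rw [pow_one, hmem]; exact one_mem _)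
    simp at h1

/-- In the Beauville case `p ≥ 5` and `⟨a⟩` and its complement have the same order. -/
lemma five_le_and_eq (h : IsMetacyclicPair p m n r a b) (hp : p.Prime) (hpG : IsPGroup p G)
    (hab : ¬ Commute a b) (hS : p ^ m ∣ geomSum r (p ^ n))
    {x₁ y₁ x₂ y₂ : G} (hB : IsBeauvilleStructure x₁ y₁ x₂ y₂) : 5 ≤ p ∧ m = n := by
  obtain ⟨k₁, l₁, hkl₁, hk₁, hl₁⟩ := h.exists_mem_beauvilleSigma hp hpG hab hB.1
  obtain ⟨k₂, l₂, hkl₂, hk₂, hl₂⟩ := h.exists_mem_beauvilleSigma hp hpG hab hB.2.1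
  have e₁ := h.not_modEq_of_mem hp hab hS hB hk₁ hk₂
  have e₂ := h.not_modEq_of_mem hp hab hS hB hk₁ hl₂
  have e₃ := h.not_modEq_of_mem hp hab hS hB hl₁ hk₂
  have e₄ := h.not_modEq_of_mem hp hab hS hB hl₁ hl₂
  have h5 : 5 ≤ p := by
    by_contra h5
    have h2 := hp.two_le
    unfold Nat.ModEq at *
    have h4 : p ≠ 4 := by rintro rfl; exact absurd hp (by norm_num)
    obtain rfl | rfl : p = 2 ∨ p = 3 := by omega
    all_goals omega
  refine ⟨h5, ?_⟩
  have hn := h.right_exponent_ne_zero hab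
  have hr := h.modEq_one hp hab
  have hle : ∀ d w, p ^ d ∣ p ^ n * w → ¬ p ∣ w → d ≤ n := fun d w hd hw =>
    (Nat.pow_dvd_pow_iff_le_right hp.one_lt).mp
      ((Nat.Coprime.pow_left d (hp.coprime_iff_not_dvd.mpr hw)).dvd_of_dvd_mul_right hd)
  obtain ⟨w, hw, hpw⟩ := geomSum_prime_pow hp (by omega) hr n
  have hmn : m ≤ n := hle m w (hw ▸ hS) hpw
  refine le_antisymm hmn (not_lt.mp fun hlt => h.not_modEq_mul_geomSum hp hn hB hk₁ hk₂ ?_)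
  obtain ⟨v, hv, -⟩ := geomSum_prime_pow hp (by omega) hr (n - 1)
  have hdvd : p ^ m ∣ geomSum r (p ^ (n - 1)) :=
    hv ▸ (pow_dvd_pow p (by omega)).mul_right v
  exact ((Nat.modEq_zero_iff_dvd).mpr (hdvd.mul_left k₁)).trans
    ((Nat.modEq_zero_iff_dvd).mpr (hdvd.mul_left k₂)).symm

lemma disjoint_zpowers (h : IsMetacyclicPair p m n r a b) (hb : b ^ p ^ n = 1) :
    Disjoint (Subgroup.zpowers b) (Subgroup.zpowers a) := by
  rw [Subgroup.disjoint_def]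
  intro x hx hxa
  obtain ⟨j, rfl⟩ := mem_powers_iff_mem_zpowers.mpr hx
  obtain ⟨d, rfl⟩ := (h.pow_mem_iff j).mp hxa
  simp [pow_mul, hb]

lemma le_card (h : IsMetacyclicPair p m n r a b) (hb : b ^ p ^ n = 1) :
    p ^ n * p ^ m ≤ Nat.card G := by
  rw [← h.orderOf_right hb, ← h.orderOf_left, ← Nat.card_zpowers, ← Nat.card_zpowers,
    ← Nat.card_prod]
  exact Nat.card_le_card_of_injective _ (Subgroup.mul_injective_of_disjoint (h.disjoint_zpowers hb))

end IsMetacyclicPair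

end Disjoint

section Presentation

variable {p e i : ℕ}

lemma mul_eq_of_commG_eq {G : Type*} [Group G] {a b : G} {q : ℕ} (h : commG a b = a ^ q) :
    a * b = b * a ^ (1 + q) := by
  rw [pow_add, ← h, commG]; group

lemma finite_and_card_presentedGroup_le (hp : p.Prime) :
    Finite (PresentedGroup (metacyclicRels p e i)) ∧
      Nat.card (PresentedGroup (metacyclicRels p e i)) ≤ p ^ e * p ^ e := by
  set A : PresentedGroup (metacyclicRels p e i) := PresentedGroup.of 0 with hA
  set B : PresentedGroup (metacyclicRels p e i) := PresentedGroup.of 1 with hB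
  have hAp : A ^ p ^ e = 1 := PresentedGroup.one_of_mem (x := FreeGroup.of 0 ^ p ^ e)
    (by simp [metacyclicRels])
  have hBp : B ^ p ^ e = 1 := PresentedGroup.one_of_mem (x := FreeGroup.of 1 ^ p ^ e)
    (by simp [metacyclicRels])
  have hAB : commG A B = A ^ p ^ i := PresentedGroup.mk_eq_mk_of_mul_inv_mem
    (x := commG (FreeGroup.of 0) (FreeGroup.of 1)) (y := FreeGroup.of 0 ^ p ^ i)
    (by simp [metacyclicRels])
  have hpe : 0 < p ^ e := pow_pos hp.pos e
  have hfA : IsOfFinOrder A := isOfFinOrder_iff_pow_eq_one.mpr ⟨_, hpe, hAp⟩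
  have hfB : IsOfFinOrder B := isOfFinOrder_iff_pow_eq_one.mpr ⟨_, hpe, hBp⟩
  let f : Fin (p ^ e) × Fin (p ^ e) → PresentedGroup (metacyclicRels p e i) :=
    fun z => B ^ (z.1 : ℕ) * A ^ (z.2 : ℕ)
  have hf : Function.Surjective f := by
    intro x
    have hx : x ∈ Subgroup.closure {A, B} := by
      refine PresentedGroup.generated_by _ _ (fun j => ?_) x
      fin_cases j
      · exact Subgroup.subset_closure (by simp [hA])
      · exact Subgroup.subset_closure (by simp [hB])
    obtain ⟨s, k, rfl⟩ :=
      exists_eq_pow_mul_pow_of_mem_closure hfA hfB (mul_eq_of_commG_eq hAB) hx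
    refine ⟨(⟨s % p ^ e, Nat.mod_lt _ hpe⟩, ⟨k % p ^ e, Nat.mod_lt _ hpe⟩), ?_⟩
    simp only [f]
    rw [← pow_eq_pow_mod _ hBp, ← pow_eq_pow_mod _ hAp]
  refine ⟨Finite.of_surjective f hf, ?_⟩
  simpa using Nat.card_le_card_of_surjective f hf

lemma nonempty_mulEquiv_presentedGroup {G : Type*} [Group G] [Finite G] {a b : G}
    (hp : p.Prime) (ha : a ^ p ^ e = 1) (hb : b ^ p ^ e = 1)
    (hab : a * b = b * a ^ (1 + p ^ i)) (hgen : ∀ g : G, ∃ s k : ℕ, g = b ^ s * a ^ k)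
    (hcard : p ^ e * p ^ e ≤ Nat.card G) :
    Nonempty (G ≃* PresentedGroup (metacyclicRels p e i)) := by
  obtain ⟨hfin, hle⟩ := finite_and_card_presentedGroup_le (e := e) (i := i) hp
  have hrel : ∀ w ∈ metacyclicRels p e i, FreeGroup.lift ![a, b] w = 1 := by
    rintro w (rfl | rfl | rfl)
    · simpa using ha
    · simpa using hb
    · have hcomm : a⁻¹ * b⁻¹ * a * b = a ^ p ^ i := by
        rw [mul_assoc, hab, pow_add, pow_one]; group
      simp [commG, hcomm]
  let φ := PresentedGroup.toGroup hrel
  have hφ : Function.Surjective φ := by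
    intro g
    obtain ⟨s, k, rfl⟩ := hgen g
    exact ⟨PresentedGroup.of 1 ^ s * PresentedGroup.of 0 ^ k, by simp [φ]⟩
  exact ⟨(MulEquiv.ofBijective φ (hφ.bijective_of_nat_card_le (hle.trans hcard))).symm⟩

end Presentation

/-- A non-abelian metacyclic Beauville `p`-group of exponent `p^e` (with
`e ≥ 2`) satisfies `p ≥ 5` and is isomorphic to
`⟨a, b ∣ a^{p^e} = b^{p^e} = 1, [a,b] = a^{p^i}⟩` for some `1 ≤ i ≤ e - 1`. -/
theorem stmt0 (p e : ℕ) (hp : p.Prime) (he : 2 ≤ e)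
    (G : Type*) [Group G] [Finite G] (hpG : IsPGroup p G)
    (hna : ∃ a b : G, a * b ≠ b * a) (hmc : IsMetacyclic G)
    (hexp : Monoid.exponent G = p ^ e) (hB : IsBeauvilleGroup G) :
    5 ≤ p ∧ ∃ i : ℕ, 1 ≤ i ∧ i ≤ e - 1 ∧
      Nonempty (G ≃* PresentedGroup (metacyclicRels p e i)) := by
  obtain ⟨m, n, r, a, b₀, h₀⟩ := hmc.exists_isMetacyclicPair hp hpG
  obtain ⟨x₁, y₁, x₂, y₂, hB⟩ := hB
  have hnc : ∀ b : G, IsMetacyclicPair p m n r a b → ¬ Commute a b := by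
    intro b h hab
    obtain ⟨x, y, hxy⟩ := hna
    exact hxy (h.commute_of_commute hab x y)
  obtain ⟨b, h, hb, hS⟩ := h₀.exists_complement hp hpG (hnc b₀ h₀) hB
  have hab := hnc b h
  obtain ⟨h5, rfl⟩ := h.five_le_and_eq hp hpG hab hS hB
  obtain rfl : m = e := Nat.pow_right_injective hp.two_le
    ((h.exponent_eq hp (by omega) hab hb).symm.trans hexp)
  refine ⟨h5, ?_⟩
  have hr : ¬ r ≡ 1 [MOD p ^ m] := fun hr => hab <| by
    have : a ^ r = a ^ 1 := by rwa [pow_eq_pow_iff_modEq, h.orderOf_left]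
    have hmul := h.mul_eq
    rwa [this, pow_one] at hmul
  obtain ⟨i, t, hi1, hie, htp, ht⟩ :=
    exists_pow_modEq_one_add hp (by omega) (h.modEq_one hp hab) hr
  have htb : t.Coprime (orderOf b) := by
    rw [h.orderOf_right hb]
    exact htp.pow_right m
  obtain ⟨w, hw⟩ := exists_pow_eq_self_of_coprime htb
  refine ⟨i, hi1, by omega, nonempty_mulEquiv_presentedGroup (a := a) (b := b ^ t) hp
    (h.orderOf_left ▸ pow_orderOf_eq_one a) (by rw [pow_right_comm, hb, one_pow]) ?_
    (fun g => ?_) (h.le_card hb)⟩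
  · rw [mul_pow_of_mul_eq h.mul_eq]
    congr 1
    rwa [pow_eq_pow_iff_modEq, h.orderOf_left]
  · obtain ⟨s, k, rfl⟩ := h.exists_eq g
    exact ⟨w * s, k, by rw [pow_mul, hw]⟩
end

section
/- Let p be an odd prime, e ≥ 2, 1 ≤ i ≤ e−1, and let G be the group with presentation ⟨a, b ∣ a^{p^e} = b^{p^e} = 1, [a,b] = a^{p^i}⟩. For elements u, v ∈ G, there exists an automorphism θ of G with θ(a) = u and θ(b) = v if and only if there exist integers m, n, r, s with 1 ≤ m, r ≤ p^i, 1 ≤ n, s ≤ p^e and p ∤ n such that u = b^{m p^{e−i}} a^n and v = b^{1 + r p^{e−i}} a^s. -/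
theorem dvd_geom_sum_of_pow_dvd {p d : ℕ} (hd : d ≡ 1 [MOD p]) (j : ℕ) :
    ∀ x : ℕ, p ^ j ∣ x → p ^ j ∣ ∑ l ∈ Finset.range x, d ^ l := by
  induction j generalizing d with
  | zero => simp
  | succ j ih =>
    rintro _ ⟨t, rfl⟩
    have hsplit : ∑ l ∈ Finset.range (p * (p ^ j * t)), d ^ l =
        (∑ l ∈ Finset.range p, d ^ l) * ∑ l ∈ Finset.range (p ^ j * t), (d ^ p) ^ l := by
      generalize p ^ j * t = n
      induction n with
      | zero => simp
      | succ n ihn =>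
        rw [mul_add_one, Finset.sum_range_add, ihn, Finset.sum_range_succ, mul_add, ← pow_mul,
          mul_comm _ (d ^ (p * n))]
        simp only [pow_add, Finset.mul_sum]
    have hfirst : p ∣ ∑ l ∈ Finset.range p, d ^ l := by
      rw [← Nat.modEq_zero_iff_dvd]
      calc ∑ l ∈ Finset.range p, d ^ l ≡ ∑ l ∈ Finset.range p, 1 [MOD p] :=
            Nat.ModEq.sum fun l _ => by simpa using hd.pow l
        _ ≡ 0 [MOD p] := by simp
    rw [pow_succ', mul_assoc, hsplit]
    exact mul_dvd_mul hfirst (ih (by simpa using hd.pow p) _ (dvd_mul_right _ _))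

theorem coprime_one_add_of_dvd {p x : ℕ} (h : p ∣ x) : Nat.Coprime p (1 + x) := by
  obtain ⟨t, rfl⟩ := h
  simp

theorem one_add_pow_modEq_one_iff {p i j n : ℕ} (hp : p.Prime) (hodd : Odd p) (hi : 1 ≤ i) :
    (1 + p ^ i) ^ n ≡ 1 [MOD p ^ (i + j)] ↔ p ^ j ∣ n := by
  have hdvd : p ∣ 1 + p ^ i - 1 := by
    simpa using dvd_pow_self p (by omega : i ≠ 0)
  have hndvd : ¬ p ∣ 1 + p ^ i := hp.coprime_iff_not_dvd.mp
    (coprime_one_add_of_dvd (dvd_pow_self p (by omega)))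
  have hlte := Nat.emultiplicity_pow_sub_pow hp hodd hdvd hndvd n
  rw [one_pow, Nat.add_sub_cancel_left, hp.emultiplicity_pow_self] at hlte
  rw [Nat.ModEq.comm, Nat.modEq_iff_dvd' (Nat.one_le_pow _ _ (by omega)),
    pow_dvd_iff_le_emultiplicity, hlte, pow_dvd_iff_le_emultiplicity, Nat.cast_add]
  exact ENat.add_le_add_iff_left (ENat.natCast_ne_top i)

theorem exists_modEq_of_pos {M : ℕ} (hM : 0 < M) (x : ℕ) :
    ∃ y, 1 ≤ y ∧ y ≤ M ∧ y ≡ x [MOD M] := by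
  by_cases h : x % M = 0
  · exact ⟨M, hM, le_rfl, by simp [Nat.ModEq, h]⟩
  · exact ⟨x % M, by omega, (Nat.mod_lt x hM).le, Nat.mod_modEq x M⟩

section Metacyclic

variable {G : Type*} [Group G] {a b : G} {c : ℕ}

theorem pow_mul_pow_of_mul_eq (h : a * b = b * a ^ c) (y x : ℕ) :
    a ^ y * b ^ x = b ^ x * a ^ (y * c ^ x) := by
  have hy : ∀ y : ℕ, a ^ y * b = b * a ^ (y * c) := fun y => by
    rw [mul_comm y c, pow_mul]
    exact ((SemiconjBy.pow_right (show SemiconjBy b (a ^ c) a from h.symm) y)).symm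
  induction x generalizing y with
  | zero => simp
  | succ x ih => rw [pow_succ' b, ← mul_assoc, hy, mul_assoc, ih, pow_succ' c, mul_assoc, mul_assoc]

theorem mul_pow_mul_pow_of_mul_eq (h : a * b = b * a ^ c) (x y x' y' : ℕ) :
    b ^ x * a ^ y * (b ^ x' * a ^ y') = b ^ (x + x') * a ^ (y * c ^ x' + y') := by
  rw [mul_assoc, ← mul_assoc (a ^ y), pow_mul_pow_of_mul_eq h, pow_add, pow_add]
  simp only [mul_assoc]

theorem pow_mul_pow_pow_of_mul_eq (h : a * b = b * a ^ c) (k s x : ℕ) :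
    (b ^ k * a ^ s) ^ x = b ^ (k * x) * a ^ (s * ∑ l ∈ Finset.range x, (c ^ k) ^ l) := by
  induction x with
  | zero => simp
  | succ x ih =>
    rw [pow_succ, ih, mul_pow_mul_pow_of_mul_eq h, Finset.sum_range_succ', pow_zero]
    simp only [pow_succ (c ^ k), ← Finset.sum_mul]
    congr 2; ring

end Metacyclic

section Presentation

variable {p e i : ℕ}

theorem metacyclic_of_zero_pow :
    (PresentedGroup.of 0 : PresentedGroup (metacyclicRels p e i)) ^ p ^ e = 1 :=
  PresentedGroup.one_of_mem (rels := metacyclicRels p e i) (Or.inl rfl)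

theorem metacyclic_of_one_pow :
    (PresentedGroup.of 1 : PresentedGroup (metacyclicRels p e i)) ^ p ^ e = 1 :=
  PresentedGroup.one_of_mem (rels := metacyclicRels p e i) (Or.inr (Or.inl rfl))

theorem commG_eq_pow_iff {G : Type*} [Group G] {a b : G} {n : ℕ} :
    commG a b * (a ^ n)⁻¹ = 1 ↔ a * b = b * a ^ (1 + n) := by
  rw [mul_inv_eq_one, commG, pow_add, pow_one, ← mul_assoc, mul_assoc _ a b, mul_assoc,
    inv_mul_eq_iff_eq_mul, inv_mul_eq_iff_eq_mul, mul_assoc b]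

theorem metacyclic_mul_eq :
    (PresentedGroup.of 0 : PresentedGroup (metacyclicRels p e i)) * PresentedGroup.of 1 =
      PresentedGroup.of 1 * PresentedGroup.of 0 ^ (1 + p ^ i) :=
  commG_eq_pow_iff.mp
    (PresentedGroup.one_of_mem (rels := metacyclicRels p e i) (Or.inr (Or.inr rfl)))

theorem exists_metacyclic_hom {G : Type*} [Group G] {u v : G} (hu : u ^ p ^ e = 1)
    (hv : v ^ p ^ e = 1) (huv : u * v = v * u ^ (1 + p ^ i)) :
    ∃ f : PresentedGroup (metacyclicRels p e i) →* G,
      f (PresentedGroup.of 0) = u ∧ f (PresentedGroup.of 1) = v := by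
  have hrels : ∀ r ∈ metacyclicRels p e i, FreeGroup.lift ![u, v] r = 1 := by
    rintro _ (rfl | rfl | rfl)
    · simpa using hu
    · simpa using hv
    · simpa [commG] using commG_eq_pow_iff.mpr huv
  exact ⟨PresentedGroup.toGroup hrels, PresentedGroup.toGroup.of hrels,
    PresentedGroup.toGroup.of hrels⟩

theorem metacyclic_exists_normal_form (hp : 0 < p) (g : PresentedGroup (metacyclicRels p e i)) :
    ∃ x y : ℕ, g = PresentedGroup.of 1 ^ x * PresentedGroup.of 0 ^ y := by
  have hinv : ∀ h : PresentedGroup (metacyclicRels p e i), h ^ p ^ e = 1 →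
      h⁻¹ = h ^ (p ^ e - 1) := fun h hh => by
    rw [inv_eq_iff_mul_eq_one, ← pow_succ', Nat.sub_add_cancel (Nat.one_le_pow _ _ hp), hh]
  have hmul : ∀ (j : Fin 2) (x y : ℕ), ∃ x' y' : ℕ,
      (PresentedGroup.of j : PresentedGroup (metacyclicRels p e i)) *
        (PresentedGroup.of 1 ^ x * PresentedGroup.of 0 ^ y) =
        PresentedGroup.of 1 ^ x' * PresentedGroup.of 0 ^ y' := by
    intro j x y
    fin_cases j
    · exact ⟨_, _, by simpa using mul_pow_mul_pow_of_mul_eq metacyclic_mul_eq 0 1 x y⟩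
    · exact ⟨x + 1, y, by simp [pow_succ', mul_assoc]⟩
  have hpow : ∀ (j : Fin 2) (n x y : ℕ), ∃ x' y' : ℕ,
      (PresentedGroup.of j : PresentedGroup (metacyclicRels p e i)) ^ n *
        (PresentedGroup.of 1 ^ x * PresentedGroup.of 0 ^ y) =
        PresentedGroup.of 1 ^ x' * PresentedGroup.of 0 ^ y' := by
    intro j n x y
    induction n with
    | zero => exact ⟨x, y, by simp⟩
    | succ n ih =>
      obtain ⟨x', y', h⟩ := ih
      rw [pow_succ', mul_assoc, h]
      exact hmul j x' y'
  have hg : g ∈ Subgroup.closure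
      (Set.range (PresentedGroup.of : Fin 2 → PresentedGroup (metacyclicRels p e i))) := by
    simp
  induction hg using Subgroup.closure_induction_left with
  | one => exact ⟨0, 0, by simp⟩
  | mul_left g hg h _ ih =>
    obtain ⟨j, rfl⟩ := hg
    obtain ⟨x, y, rfl⟩ := ih
    exact hmul j x y
  | inv_mul_cancel g hg h _ ih =>
    obtain ⟨j, rfl⟩ := hg
    obtain ⟨x, y, rfl⟩ := ih
    rw [hinv]
    · exact hpow j _ x y
    · fin_cases j
      exacts [metacyclic_of_zero_pow, metacyclic_of_one_pow]

theorem finite_metacyclic (hp : 0 < p) : Finite (PresentedGroup (metacyclicRels p e i)) := by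
  refine Finite.of_surjective (fun x : Fin (p ^ e) × Fin (p ^ e) =>
    (PresentedGroup.of 1 ^ (x.1 : ℕ) * PresentedGroup.of 0 ^ (x.2 : ℕ) :
      PresentedGroup (metacyclicRels p e i))) fun g => ?_
  obtain ⟨x, y, rfl⟩ := metacyclic_exists_normal_form hp g
  have hN : 0 < p ^ e := Nat.pow_pos hp
  exact ⟨⟨⟨x % p ^ e, Nat.mod_lt _ hN⟩, ⟨y % p ^ e, Nat.mod_lt _ hN⟩⟩, congrArg₂ _
    (pow_eq_pow_of_modEq (Nat.mod_modEq _ _) metacyclic_of_one_pow)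
    (pow_eq_pow_of_modEq (Nat.mod_modEq _ _) metacyclic_of_zero_pow)⟩

theorem metacyclic_modEq_right (hp : p.Prime) (hodd : Odd p) (hi : 1 ≤ i) {y y' : ℕ}
    (h : (PresentedGroup.of 0 : PresentedGroup (metacyclicRels p e i)) ^ y =
      PresentedGroup.of 0 ^ y') : y ≡ y' [MOD p ^ e] := by
  have hc : ((1 + p ^ i : ℕ) : ZMod (p ^ e)) ^ p ^ e = 1 := by
    have := (one_add_pow_modEq_one_iff (j := e) (n := p ^ e) hp hodd hi).mpr dvd_rfl
    exact_mod_cast (ZMod.natCast_eq_natCast_iff _ _ _).mpr (this.of_dvd (pow_dvd_pow p (by omega)))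
  let c : (ZMod (p ^ e))ˣ := Units.ofPowEqOne _ _ hc (Nat.pow_pos hp.pos).ne'
  have hadd : ∀ n : ℕ, ∀ x : ZMod (p ^ e), (Equiv.addLeft (1 : ZMod (p ^ e)) ^ n) x = n + x := by
    intro n x
    induction n with
    | zero => simp
    | succ n ih => rw [pow_succ', Equiv.Perm.mul_apply, ih]; simp; ring
  obtain ⟨f, hf, -⟩ := exists_metacyclic_hom (p := p) (e := e) (i := i)
    (u := Equiv.addLeft (1 : ZMod (p ^ e))) (v := MulAction.toPermHom _ _ c⁻¹)
    (by ext x; simp)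
    (by rw [← map_pow, inv_pow, (Units.pow_ofPowEqOne hc _ : c ^ p ^ e = 1), inv_one, map_one])
    (by
      ext x
      have : (1 : ZMod (p ^ e)) = c⁻¹ • ((1 + p ^ i : ℕ) : ZMod (p ^ e)) := by
        rw [eq_inv_smul_iff]; simp [c, Units.smul_def]
      simp only [Equiv.Perm.mul_apply, hadd, MulAction.toPermHom_apply, MulAction.toPerm_apply,
        smul_add, ← this, Equiv.coe_addLeft])
  have := congrArg (fun σ => σ (0 : ZMod (p ^ e))) (congrArg f h)
  simp only [map_pow, hf, hadd, add_zero] at this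
  exact (ZMod.natCast_eq_natCast_iff _ _ _).mp this

theorem metacyclic_normal_form_eq_iff (hp : p.Prime) (hodd : Odd p) (hi : 1 ≤ i)
    {x y x' y' : ℕ} :
    (PresentedGroup.of 1 ^ x * PresentedGroup.of 0 ^ y : PresentedGroup (metacyclicRels p e i)) =
      PresentedGroup.of 1 ^ x' * PresentedGroup.of 0 ^ y' ↔
      x ≡ x' [MOD p ^ e] ∧ y ≡ y' [MOD p ^ e] := by
  refine ⟨fun h => ?_, fun h => congrArg₂ _ (pow_eq_pow_of_modEq h.1 metacyclic_of_one_pow)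
    (pow_eq_pow_of_modEq h.2 metacyclic_of_zero_pow)⟩
  have hx : x ≡ x' [MOD p ^ e] := by
    obtain ⟨f, hf₀, hf₁⟩ := exists_metacyclic_hom (p := p) (e := e) (i := i) (u := 1)
      (v := Multiplicative.ofAdd (1 : ZMod (p ^ e))) (one_pow _)
      (by rw [← ofAdd_nsmul]; simp) (by simp)
    have := congrArg f h
    simp only [map_mul, map_pow, hf₀, hf₁, one_pow, mul_one, ← ofAdd_nsmul,
      nsmul_one, Multiplicative.ofAdd.apply_eq_iff_eq] at this
    exact (ZMod.natCast_eq_natCast_iff _ _ _).mp this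
  rw [pow_eq_pow_of_modEq hx metacyclic_of_one_pow, mul_right_inj] at h
  exact ⟨hx, metacyclic_modEq_right hp hodd hi h⟩

end Presentation

/-- Description of the automorphisms of
`G = ⟨a, b ∣ a^{p^e} = b^{p^e} = 1, [a,b] = a^{p^i}⟩` for `p` an odd prime,
`e ≥ 2` and `1 ≤ i ≤ e - 1`: a map sending `a ↦ u`, `b ↦ v` extends to an automorphism
iff `u = b^{m p^{e-i}} a^n` and `v = b^{1 + r p^{e-i}} a^s` with `1 ≤ m, r ≤ p^i`,
`1 ≤ n, s ≤ p^e` and `p ∤ n`. -/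
theorem stmt6 (p e i : ℕ) (hp : p.Prime) (hodd : Odd p)
    (he : 2 ≤ e) (hi1 : 1 ≤ i) (hie : i ≤ e - 1)
    (u v : PresentedGroup (metacyclicRels p e i)) :
    (∃ θ : PresentedGroup (metacyclicRels p e i) ≃* PresentedGroup (metacyclicRels p e i),
        θ (PresentedGroup.of 0) = u ∧ θ (PresentedGroup.of 1) = v) ↔
      (∃ m n r s : ℕ,
        1 ≤ m ∧ m ≤ p ^ i ∧ 1 ≤ r ∧ r ≤ p ^ i ∧
        1 ≤ n ∧ n ≤ p ^ e ∧ 1 ≤ s ∧ s ≤ p ^ e ∧ ¬ p ∣ n ∧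
        u = PresentedGroup.of 1 ^ (m * p ^ (e - i)) * PresentedGroup.of 0 ^ n ∧
        v = PresentedGroup.of 1 ^ (1 + r * p ^ (e - i)) * PresentedGroup.of 0 ^ s) := by
  have hN : 0 < p ^ e := Nat.pow_pos hp.pos
  have hqN : p ^ (e - i) * p ^ i = p ^ e := by rw [← pow_add]; congr 1; omega
  have hc (n : ℕ) : (1 + p ^ i) ^ n ≡ 1 [MOD p ^ e] ↔ p ^ (e - i) ∣ n := by
    rw [← one_add_pow_modEq_one_iff hp hodd hi1, Nat.add_sub_cancel' (by omega : i ≤ e)]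
  have hcp (n : ℕ) : (1 + p ^ i) ^ n ≡ 1 [MOD p] := by
    have : 1 + p ^ i ≡ 1 + 0 [MOD p] :=
      (Nat.modEq_zero_iff_dvd.mpr (dvd_pow_self p (by omega))).add_left 1
    simpa using this.pow n
  have hcop : Nat.Coprime (p ^ e) (1 + p ^ i) :=
    (coprime_one_add_of_dvd (dvd_pow_self p (by omega))).pow_left e
  have hrel := metacyclic_mul_eq (p := p) (e := e) (i := i)
  have heq (x y x' y' : ℕ) := metacyclic_normal_form_eq_iff (e := e) (x := x) (y := y) (x' := x')
    (y' := y') hp hodd hi1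
  have hone (x y : ℕ) : (PresentedGroup.of 1 ^ x * PresentedGroup.of 0 ^ y :
      PresentedGroup (metacyclicRels p e i)) = 1 ↔ p ^ e ∣ x ∧ p ^ e ∣ y := by
    simpa [Nat.modEq_zero_iff_dvd] using heq x y 0 0
  have hexp (x y : ℕ) : (PresentedGroup.of 1 ^ x * PresentedGroup.of 0 ^ y :
      PresentedGroup (metacyclicRels p e i)) ^ p ^ e = 1 := by
    rw [pow_mul_pow_pow_of_mul_eq hrel, hone]
    exact ⟨dvd_mul_left _ _,
      (dvd_geom_sum_of_pow_dvd (hcp x) e _ dvd_rfl).mul_left y⟩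
  have hpow (m y n : ℕ) : (PresentedGroup.of 1 ^ (m * p ^ (e - i)) * PresentedGroup.of 0 ^ y :
      PresentedGroup (metacyclicRels p e i)) ^ n =
      PresentedGroup.of 1 ^ (m * p ^ (e - i) * n) * PresentedGroup.of 0 ^ (y * n) := by
    rw [pow_mul_pow_pow_of_mul_eq hrel, heq]
    refine ⟨rfl, Nat.ModEq.mul_left y ?_⟩
    calc ∑ l ∈ Finset.range n, ((1 + p ^ i) ^ (m * p ^ (e - i))) ^ l
        ≡ ∑ l ∈ Finset.range n, 1 [MOD p ^ e] := Nat.ModEq.sum fun l _ => by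
          simpa using ((hc _).mpr (dvd_mul_left _ m)).pow l
      _ ≡ n [MOD p ^ e] := by simp [Nat.ModEq.refl]
  have hpowi (m y : ℕ) : (PresentedGroup.of 1 ^ (m * p ^ (e - i)) * PresentedGroup.of 0 ^ y :
      PresentedGroup (metacyclicRels p e i)) ^ (1 + p ^ i) =
      PresentedGroup.of 1 ^ (m * p ^ (e - i)) * PresentedGroup.of 0 ^ (y * (1 + p ^ i)) := by
    rw [hpow, heq]
    refine ⟨?_, rfl⟩
    rw [mul_add, mul_one, mul_assoc, hqN]
    simp [Nat.ModEq]
  constructor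
  · rintro ⟨θ, rfl, rfl⟩
    obtain ⟨x, y, hu⟩ := metacyclic_exists_normal_form hp.pos (θ (PresentedGroup.of 0))
    obtain ⟨w, t, hv⟩ := metacyclic_exists_normal_form hp.pos (θ (PresentedGroup.of 1))
    obtain ⟨w', hw1, -, hww⟩ := exists_modEq_of_pos hN w
    obtain ⟨n, hn1, hnN, hny⟩ := exists_modEq_of_pos hN y
    obtain ⟨s, hs1, hsN, hst⟩ := exists_modEq_of_pos hN t
    have hv' := hv.trans ((heq w t w' s).mpr ⟨hww.symm, hst.symm⟩)
    have hθ := congrArg θ hrel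
    rw [map_mul, map_mul, map_pow, hu, hv', pow_mul_pow_pow_of_mul_eq hrel,
      mul_pow_mul_pow_of_mul_eq hrel, mul_pow_mul_pow_of_mul_eq hrel, heq] at hθ
    have hx : p ^ (e - i) ∣ x := by
      have h := hθ.1
      have h' : x + w' + x * p ^ i ≡ x + w' + 0 [MOD p ^ e] := by
        convert h.symm using 1 <;> ring
      have h'' := Nat.modEq_zero_iff_dvd.mp (Nat.ModEq.add_left_cancel' _ h')
      rw [← hqN] at h''
      exact Nat.dvd_of_mul_dvd_mul_right (Nat.pow_pos hp.pos) h''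
    obtain ⟨x, rfl⟩ := hx
    obtain ⟨m, hm1, hmp, hmx⟩ := exists_modEq_of_pos (Nat.pow_pos (n := i) hp.pos) x
    have hu' : θ (PresentedGroup.of 0) =
        PresentedGroup.of 1 ^ (m * p ^ (e - i)) * PresentedGroup.of 0 ^ n := by
      rw [hu, heq, mul_comm m, ← hqN]
      exact ⟨(hmx.mul_left' _).symm, hqN ▸ hny.symm⟩
    have hn : ¬ p ∣ n := by
      rintro ⟨n, rfl⟩
      have h : θ (PresentedGroup.of 0 ^ p ^ (e - 1)) = 1 := by
        have hpe : p * p ^ (e - 1) = p ^ e := by rw [← pow_succ']; congr 1; omega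
        rw [map_pow, hu', hpow, hone]
        constructor
        · rw [mul_assoc, ← pow_add]
          exact (pow_dvd_pow p (by omega)).mul_left m
        · rw [mul_comm p n, mul_assoc, hpe]
          exact dvd_mul_left _ _
      rw [map_eq_one_iff θ θ.injective] at h
      have := (hone 0 (p ^ (e - 1))).mp (by simpa using h)
      have := (Nat.pow_dvd_pow_iff_le_right hp.one_lt).mp this.2
      omega
    have hθ := congrArg θ hrel
    rw [map_mul, map_mul, map_pow, hu', hv', hpowi,
      mul_pow_mul_pow_of_mul_eq hrel, mul_pow_mul_pow_of_mul_eq hrel, heq] at hθ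
    obtain ⟨k, rfl⟩ := Nat.exists_eq_add_of_le hw1
    have hk : p ^ (e - i) ∣ k := by
      have h₁ : s * (1 + p ^ i) ^ (m * p ^ (e - i)) ≡ s * 1 [MOD p ^ e] :=
        ((hc _).mpr (dvd_mul_left _ m)).mul_left s
      have h₂ : s + n * (1 + p ^ i) * (1 + p ^ i) ^ k ≡ s + n * (1 + p ^ i) * 1 [MOD p ^ e] := by
        refine Nat.ModEq.trans ?_ (hθ.2.trans ((h₁.add_right _).trans ?_))
        · rw [pow_add, pow_one, mul_assoc, add_comm]
        · simp [Nat.ModEq.refl]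
      rw [← hc]
      refine Nat.ModEq.cancel_left_of_coprime ?_ (Nat.ModEq.add_left_cancel' _ h₂)
      exact Nat.Coprime.mul_right ((hp.coprime_iff_not_dvd.mpr hn).pow_left e) hcop
    obtain ⟨k, rfl⟩ := hk
    obtain ⟨r, hr1, hrp, hrk⟩ := exists_modEq_of_pos (Nat.pow_pos (n := i) hp.pos) k
    refine ⟨m, n, r, s, hm1, hmp, hr1, hrp, hn1, hnN, hs1, hsN, hn, hu', ?_⟩
    rw [hv', heq, mul_comm r]
    exact ⟨(hqN ▸ hrk.mul_left' _).symm.add_left 1, rfl⟩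
  · rintro ⟨m, n, r, s, -, -, -, -, -, -, -, -, hn, rfl, rfl⟩
    obtain ⟨f, hf₀, hf₁⟩ := exists_metacyclic_hom (hexp (m * p ^ (e - i)) n)
      (hexp (1 + r * p ^ (e - i)) s) (i := i) (by
        rw [hpowi, mul_pow_mul_pow_of_mul_eq hrel, mul_pow_mul_pow_of_mul_eq hrel, heq]
        refine ⟨by rw [add_comm], ?_⟩
        rw [add_comm (s * _)]
        refine Nat.ModEq.add ?_ ?_
        · rw [pow_add, pow_one, ← mul_assoc]
          simpa using ((hc _).mpr (dvd_mul_left _ r)).mul_left (n * (1 + p ^ i))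
        · simpa using (((hc _).mpr (dvd_mul_left _ m)).mul_left s).symm)
    have hinj : Function.Injective f := by
      rw [injective_iff_map_eq_one]
      intro g hg
      obtain ⟨x, y, rfl⟩ := metacyclic_exists_normal_form hp.pos g
      rw [map_mul, map_pow, map_pow, hf₀, hf₁, hpow, pow_mul_pow_pow_of_mul_eq hrel,
        mul_pow_mul_pow_of_mul_eq hrel, hone] at hg
      rw [hone]
      have key : ∀ j ≤ e, p ^ j ∣ x ∧ p ^ j ∣ y := by
        intro j
        induction j with
        | zero => simp
        | succ j ih =>
          intro hj
          obtain ⟨hx, hy⟩ := ih (by omega)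
          have hpq : p ∣ p ^ (e - i) := dvd_pow_self p (by omega)
          have hx' : p ^ (j + 1) ∣ x := by
            have h₁ : p ^ (j + 1) ∣ m * p ^ (e - i) * y := by
              rw [pow_succ', mul_assoc]
              exact (mul_dvd_mul hpq hy).mul_left m
            have h₂ := (Nat.dvd_add_iff_left h₁).mpr ((pow_dvd_pow p hj).trans hg.1)
            exact Nat.Coprime.dvd_of_dvd_mul_left
              ((coprime_one_add_of_dvd (hpq.mul_left r)).pow_left _) h₂
          refine ⟨hx', ?_⟩
          have h₁ := (dvd_geom_sum_of_pow_dvd (hcp (1 + r * p ^ (e - i))) (j + 1) x hx').mul_left s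
          have h₂ := (Nat.dvd_add_iff_right (h₁.mul_right _)).mpr ((pow_dvd_pow p hj).trans hg.2)
          exact Nat.Coprime.dvd_of_dvd_mul_left
            ((hp.coprime_iff_not_dvd.mpr hn).pow_left _) h₂
      exact key e le_rfl
    have := finite_metacyclic (e := e) (i := i) hp.pos
    exact ⟨MulEquiv.ofBijective f (Finite.injective_iff_bijective.mp hinj), hf₀, hf₁⟩
end

section
/- Let p be an odd prime, let 0 < k < j ≤ i ≤ e with e = i + j − k, and let G be the group with presentation ⟨a, b ∣ a^{p^e} = [b,a]^{p^j} = [b,a,a] = [b,a,b] = 1, b^{p^i} = [b,a]^{p^k}⟩. For elements u, v ∈ G, there exists an automorphism θ of G with θ(a) = u and θ(b) = v if and only if there exist integers m, n, r, s with 1 ≤ m, n, r, s ≤ p^i and p ∤ s, and elements c_a, c_b ∈ G′, such that u = a^{1 + m p^{e−i}} b^n c_a and v = a^{r p^{e−i}} b^s c_b. -/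
/-- The relations of the presentation
`⟨a, b ∣ a^{p^e} = [b,a]^{p^j} = [b,a,a] = [b,a,b] = 1, b^{p^i} = [b,a]^{p^k}⟩`,
where `a` and `b` are the images of `0` and `1` respectively. -/
def class2Rels (p e i j k : ℕ) : Set (FreeGroup (Fin 2)) :=
  { FreeGroup.of 0 ^ p ^ e,
    commG (FreeGroup.of 1) (FreeGroup.of 0) ^ p ^ j,
    commG (commG (FreeGroup.of 1) (FreeGroup.of 0)) (FreeGroup.of 0),
    commG (commG (FreeGroup.of 1) (FreeGroup.of 0)) (FreeGroup.of 1),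
    FreeGroup.of 1 ^ p ^ i * (commG (FreeGroup.of 1) (FreeGroup.of 0) ^ p ^ k)⁻¹ }

open scoped commutatorElement

section Heisenberg

variable {G : Type*} [Group G] {a b c : G}

theorem zpow_mul_zpow_of_mul_eq (hba : b * a = a * b * c) (hca : Commute c a) (hcb : Commute c b)
    (x y : ℤ) : b ^ y * a ^ x = a ^ x * b ^ y * c ^ (y * x) := by
  have h₁ : SemiconjBy b a (a * c) := by
    rw [SemiconjBy, hba, mul_assoc, mul_assoc, hcb.eq]
  have h₂ : b * a ^ x = a ^ x * (b * c ^ x) := by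
    rw [(h₁.zpow_right x).eq, hca.symm.mul_zpow, mul_assoc, (hcb.zpow_left x).eq]
  have h₃ : SemiconjBy (a ^ x) (b * c ^ x) b := h₂.symm
  rw [← (h₃.zpow_right y).eq, (hcb.zpow_left x).symm.mul_zpow, ← zpow_mul, mul_assoc, mul_comm x]

theorem heisenberg_mul (hba : b * a = a * b * c) (hca : Commute c a) (hcb : Commute c b)
    (x y z x' y' z' : ℤ) :
    a ^ x * b ^ y * c ^ z * (a ^ x' * b ^ y' * c ^ z') =
      a ^ (x + x') * b ^ (y + y') * c ^ (z + z' + y * x') := by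
  have h := zpow_mul_zpow_of_mul_eq hba hca hcb x' y
  have ha := (hca.zpow_zpow z x').eq
  have hb := (hcb.zpow_zpow z y').eq
  have hb' := (hcb.zpow_zpow (y * x') y').eq
  calc _ = a ^ x * b ^ y * (c ^ z * a ^ x') * b ^ y' * c ^ z' := by group
    _ = a ^ x * (b ^ y * a ^ x') * (c ^ z * b ^ y') * c ^ z' := by rw [ha]; group
    _ = a ^ x * a ^ x' * b ^ y * (c ^ (y * x') * b ^ y') * c ^ z * c ^ z' := by
      rw [h, hb]; group
    _ = _ := by rw [hb']; group

theorem heisenberg_pow (hba : b * a = a * b * c) (hca : Commute c a) (hcb : Commute c b)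
    (x y z : ℤ) (n : ℕ) :
    (a ^ x * b ^ y * c ^ z) ^ n =
      a ^ (n * x) * b ^ (n * y) * c ^ (n * z + n.choose 2 * (y * x)) := by
  induction n with
  | zero => simp
  | succ n ih =>
    rw [pow_succ, ih, heisenberg_mul hba hca hcb, Nat.choose_succ_succ' n 1]
    congr 1
    · congr 1 <;> (congr 1; push_cast; ring)
    · congr 1
      rw [Nat.choose_one_right]
      push_cast; ring

theorem heisenberg_inv (hba : b * a = a * b * c) (hca : Commute c a) (hcb : Commute c b)
    (x y z : ℤ) :
    (a ^ x * b ^ y * c ^ z)⁻¹ = a ^ (-x) * b ^ (-y) * c ^ (-z + y * x) := by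
  rw [inv_eq_iff_mul_eq_one, heisenberg_mul hba hca hcb,
    show z + (-z + y * x) + y * -x = 0 by ring]
  simp

theorem exists_heisenberg_zpow (hba : b * a = a * b * c) (hca : Commute c a) (hcb : Commute c b)
    (x y z n : ℤ) :
    ∃ t : ℤ, (a ^ x * b ^ y * c ^ z) ^ n = a ^ (n * x) * b ^ (n * y) * c ^ t := by
  obtain ⟨m, rfl | rfl⟩ := n.eq_nat_or_neg
  · exact ⟨_, (zpow_natCast _ m).trans (heisenberg_pow hba hca hcb x y z m)⟩
  · rw [zpow_neg, zpow_natCast, heisenberg_pow hba hca hcb, heisenberg_inv hba hca hcb,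
      neg_mul, neg_mul]
    exact ⟨_, rfl⟩

theorem heisenberg_mul_swap (hba : b * a = a * b * c) (hca : Commute c a) (hcb : Commute c b)
    (x y z x' y' z' : ℤ) :
    a ^ x * b ^ y * c ^ z * (a ^ x' * b ^ y' * c ^ z') =
      a ^ x' * b ^ y' * c ^ z' * (a ^ x * b ^ y * c ^ z) * c ^ (y * x' - y' * x) := by
  rw [heisenberg_mul hba hca hcb, heisenberg_mul hba hca hcb, mul_assoc _ (c ^ _) (c ^ _),
    ← zpow_add, add_comm x, add_comm y]
  congr 2
  ring

theorem heisenberg_commG (hba : b * a = a * b * c) (hca : Commute c a) (hcb : Commute c b)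
    (x y z x' y' z' : ℤ) :
    commG (a ^ x * b ^ y * c ^ z) (a ^ x' * b ^ y' * c ^ z') = c ^ (y * x' - y' * x) := by
  have h := heisenberg_mul_swap hba hca hcb x y z x' y' z'
  rw [commG, mul_assoc, h]
  group

theorem exists_heisenberg_of_mem_closure (hba : b * a = a * b * c) (hca : Commute c a)
    (hcb : Commute c b) {g : G} (hg : g ∈ Subgroup.closure {a, b}) :
    ∃ x y z : ℤ, g = a ^ x * b ^ y * c ^ z := by
  induction hg using Subgroup.closure_induction with
  | mem g hg =>
    rcases hg with rfl | rfl
    · exact ⟨1, 0, 0, by simp⟩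
    · exact ⟨0, 1, 0, by simp⟩
  | one => exact ⟨0, 0, 0, by simp⟩
  | mul g h _ _ hg hh =>
    obtain ⟨x, y, z, rfl⟩ := hg
    obtain ⟨x', y', z', rfl⟩ := hh
    exact ⟨_, _, _, heisenberg_mul hba hca hcb x y z x' y' z'⟩
  | inv g _ hg =>
    obtain ⟨x, y, z, rfl⟩ := hg
    exact ⟨_, _, _, heisenberg_inv hba hca hcb x y z⟩

theorem commG_eq_one_iff {x y : G} : commG x y = 1 ↔ Commute x y := by
  have : commG x y = (y * x)⁻¹ * (x * y) := by simp [commG, mul_assoc]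
  rw [this, inv_mul_eq_one, eq_comm, Commute, SemiconjBy]

theorem mul_eq_of_commG (x y : G) : y * x = x * y * commG y x := by
  rw [commG]; group

theorem map_commG {H : Type*} [Group H] (f : G →* H) (x y : G) :
    f (commG x y) = commG (f x) (f y) := by
  simp [commG]

theorem mem_of_zpow_mem_of_coprime {H : Subgroup G} {g : G} {d : ℤ} {N : ℕ}
    (hd : IsCoprime d (N : ℤ)) (hN : g ^ N = 1) (hg : g ^ d ∈ H) : g ∈ H := by
  obtain ⟨r, s, h⟩ := hd
  have : g = (g ^ d) ^ r := by
    rw [← zpow_mul, mul_comm d r, eq_sub_of_add_eq h, zpow_sub, mul_comm s, zpow_mul g N,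
      zpow_natCast, hN]
    simp
  rw [this]
  exact H.zpow_mem hg r

theorem zpow_eq_one_of_dvd' {g : G} {N : ℕ} (hN : g ^ N = 1) {x : ℤ} (h : (N : ℤ) ∣ x) :
    g ^ x = 1 := by
  obtain ⟨t, rfl⟩ := h
  rw [zpow_mul, zpow_natCast, hN, one_zpow]

end Heisenberg

theorem exists_nat_mem_Icc_dvd_sub (x : ℤ) {N : ℕ} (hN : 0 < N) :
    ∃ m : ℕ, 1 ≤ m ∧ m ≤ N ∧ (N : ℤ) ∣ x - m := by
  have h₀ := Int.emod_nonneg (x - 1) (b := N) (by omega)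
  have h₁ := Int.emod_lt_of_pos (x - 1) (b := N) (by omega)
  refine ⟨((x - 1) % N).toNat + 1, by omega, by omega, ?_⟩
  have : x - ((((x - 1) % N).toNat + 1 : ℕ) : ℤ) = (x - 1) - (x - 1) % N := by
    push_cast [Int.toNat_of_nonneg h₀]; ring
  rw [this]
  exact Int.dvd_self_sub_emod

theorem Odd.dvd_choose_two {N : ℕ} (hN : Odd N) : N ∣ N.choose 2 := by
  rw [Nat.choose_two_right]
  obtain ⟨t, rfl⟩ := hN
  exact ⟨t, by rw [Nat.add_sub_cancel, mul_left_comm, Nat.mul_div_cancel_left _ two_pos]⟩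

namespace Class2

variable {p e i j k : ℕ}

section Lift

variable {H : Type*} [Group H] {x y : H}

/-- The homomorphism `a ↦ x`, `b ↦ y`, for `x` and `y` satisfying the defining relations. -/
theorem exists_lift (h₁ : x ^ p ^ e = 1) (h₂ : commG y x ^ p ^ j = 1)
    (h₃ : Commute (commG y x) x) (h₄ : Commute (commG y x) y)
    (h₅ : y ^ p ^ i = commG y x ^ p ^ k) :
    ∃ f : PresentedGroup (class2Rels p e i j k) →* H,
      f (PresentedGroup.of 0) = x ∧ f (PresentedGroup.of 1) = y := by
  have h : ∀ r ∈ class2Rels p e i j k, FreeGroup.lift ![x, y] r = 1 := by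
    rintro r (rfl | rfl | rfl | rfl | rfl) <;>
      simp only [map_mul, map_inv, map_pow, map_commG, FreeGroup.lift_apply_of,
        Matrix.cons_val_zero, Matrix.cons_val_one]
    · exact h₁
    · exact h₂
    · exact commG_eq_one_iff.mpr h₃
    · exact commG_eq_one_iff.mpr h₄
    · rw [h₅, mul_inv_cancel]
  exact ⟨PresentedGroup.toGroup h, by simp, by simp⟩

end Lift

variable (p e i j k)

/-- The first generator. -/
abbrev genA : PresentedGroup (class2Rels p e i j k) := PresentedGroup.of 0

/-- The second generator. -/
abbrev genB : PresentedGroup (class2Rels p e i j k) := PresentedGroup.of 1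

/-- The commutator `[b, a]` of the generators. -/
def genC : PresentedGroup (class2Rels p e i j k) := commG (genB p e i j k) (genA p e i j k)

theorem mk_commG (x y : FreeGroup (Fin 2)) :
    PresentedGroup.mk (class2Rels p e i j k) (commG x y) =
      commG (PresentedGroup.mk (class2Rels p e i j k) x) (PresentedGroup.mk _ y) :=
  map_commG _ _ _

theorem genA_pow : genA p e i j k ^ p ^ e = 1 := by
  have := PresentedGroup.one_of_mem (rels := class2Rels p e i j k)
    (x := FreeGroup.of 0 ^ p ^ e) (by simp [class2Rels])
  rwa [map_pow] at this

theorem genC_pow : genC p e i j k ^ p ^ j = 1 := by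
  have := PresentedGroup.one_of_mem (rels := class2Rels p e i j k)
    (x := commG (FreeGroup.of 1) (FreeGroup.of 0) ^ p ^ j) (by simp [class2Rels])
  rwa [map_pow, mk_commG] at this

theorem genC_comm_genA : Commute (genC p e i j k) (genA p e i j k) := by
  have := PresentedGroup.one_of_mem (rels := class2Rels p e i j k)
    (x := commG (commG (FreeGroup.of 1) (FreeGroup.of 0)) (FreeGroup.of 0)) (by simp [class2Rels])
  rw [mk_commG, mk_commG] at this
  exact commG_eq_one_iff.mp this

theorem genC_comm_genB : Commute (genC p e i j k) (genB p e i j k) := by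
  have := PresentedGroup.one_of_mem (rels := class2Rels p e i j k)
    (x := commG (commG (FreeGroup.of 1) (FreeGroup.of 0)) (FreeGroup.of 1)) (by simp [class2Rels])
  rw [mk_commG, mk_commG] at this
  exact commG_eq_one_iff.mp this

theorem genB_pow : genB p e i j k ^ p ^ i = genC p e i j k ^ p ^ k := by
  have := PresentedGroup.one_of_mem (rels := class2Rels p e i j k)
    (x := FreeGroup.of 1 ^ p ^ i * (commG (FreeGroup.of 1) (FreeGroup.of 0) ^ p ^ k)⁻¹)
    (by simp [class2Rels])
  rw [map_mul, map_inv, map_pow, map_pow, mk_commG] at this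
  exact mul_inv_eq_one.mp this

theorem genB_mul_genA :
    genB p e i j k * genA p e i j k = genA p e i j k * genB p e i j k * genC p e i j k :=
  mul_eq_of_commG _ _

theorem exists_normal_form (g : PresentedGroup (class2Rels p e i j k)) :
    ∃ x y z : ℤ, g = genA p e i j k ^ x * genB p e i j k ^ y * genC p e i j k ^ z := by
  apply exists_heisenberg_of_mem_closure (genB_mul_genA p e i j k) (genC_comm_genA p e i j k)
    (genC_comm_genB p e i j k)
  have h : ({genA p e i j k, genB p e i j k} : Set _) = Set.range PresentedGroup.of := by
    ext; simp [Fin.exists_fin_two, eq_comm]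
  rw [h, PresentedGroup.closure_range_of]
  trivial

theorem genC_mem_commutator :
    genC p e i j k ∈ commutator (PresentedGroup (class2Rels p e i j k)) := by
  have h : genC p e i j k = ⁅(genB p e i j k)⁻¹, (genA p e i j k)⁻¹⁆ := by
    simp [genC, commG, commutatorElement_def]
  rw [h]
  exact Subgroup.commutator_mem_commutator (Subgroup.mem_top _) (Subgroup.mem_top _)

theorem exists_zpow_of_mem_commutator {g : PresentedGroup (class2Rels p e i j k)}
    (hg : g ∈ commutator (PresentedGroup (class2Rels p e i j k))) :
    ∃ z : ℤ, g = genC p e i j k ^ z := by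
  suffices h : commutator (PresentedGroup (class2Rels p e i j k)) ≤
      Subgroup.zpowers (genC p e i j k) by
    obtain ⟨z, hz⟩ := h hg
    exact ⟨z, hz.symm⟩
  rw [commutator_def, Subgroup.commutator_le]
  intro g _ h _
  have hk : ⁅g, h⁆ = commG g⁻¹ h⁻¹ := by simp [commG, commutatorElement_def]
  obtain ⟨x, y, z, hx⟩ := exists_normal_form p e i j k g⁻¹
  obtain ⟨x', y', z', hy⟩ := exists_normal_form p e i j k h⁻¹
  rw [hk, hx, hy, heisenberg_commG (genB_mul_genA p e i j k) (genC_comm_genA p e i j k)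
    (genC_comm_genB p e i j k)]
  exact ⟨_, rfl⟩

variable {p e i j k}

theorem genB_pow_exponent (heijk : e + k = i + j) (hie : i ≤ e) :
    genB p e i j k ^ p ^ e = 1 := by
  have h : p ^ e = p ^ i * p ^ (e - i) := by rw [← pow_add, Nat.add_sub_of_le hie]
  rw [h, pow_mul, genB_pow, ← pow_mul, ← pow_add, show k + (e - i) = j by omega, genC_pow]

theorem finite (hp : p.Prime) (heijk : e + k = i + j) (hie : i ≤ e) :
    Finite (PresentedGroup (class2Rels p e i j k)) := by
  have hA : IsOfFinOrder (genA p e i j k) :=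
    isOfFinOrder_iff_pow_eq_one.mpr ⟨_, pow_pos hp.pos _, genA_pow p e i j k⟩
  have hB : IsOfFinOrder (genB p e i j k) :=
    isOfFinOrder_iff_pow_eq_one.mpr ⟨_, pow_pos hp.pos _, genB_pow_exponent heijk hie⟩
  have hC : IsOfFinOrder (genC p e i j k) :=
    isOfFinOrder_iff_pow_eq_one.mpr ⟨_, pow_pos hp.pos _, genC_pow p e i j k⟩
  have := (finite_zpowers.mpr hA).to_subtype
  have := (finite_zpowers.mpr hB).to_subtype
  have := (finite_zpowers.mpr hC).to_subtype
  refine Finite.of_surjective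
    (fun t : Subgroup.zpowers (genA p e i j k) × Subgroup.zpowers (genB p e i j k) ×
      Subgroup.zpowers (genC p e i j k) => t.1.1 * t.2.1.1 * t.2.2.1) fun g => ?_
  obtain ⟨x, y, z, rfl⟩ := exists_normal_form p e i j k g
  exact ⟨⟨⟨_, x, rfl⟩, ⟨_, y, rfl⟩, ⟨_, z, rfl⟩⟩, rfl⟩

theorem dvd_of_genA_zpow {x y z : ℤ}
    (h : genA p e i j k ^ x * genB p e i j k ^ y * genC p e i j k ^ z = 1) :
    (p : ℤ) ^ e ∣ x := by
  obtain ⟨f, hA, hB⟩ := exists_lift (p := p) (e := e) (i := i) (j := j) (k := k)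
    (x := Multiplicative.ofAdd (1 : ZMod (p ^ e))) (y := 1)
    (by rw [← ofAdd_nsmul]; simp) (by simp [commG]) (by simp [commG]) (by simp [commG])
    (by simp [commG])
  have hC : f (genC p e i j k) = 1 := by rw [genC, map_commG, hA, hB]; simp [commG]
  have := congrArg f h
  rw [map_mul, map_mul, map_zpow, map_zpow, map_zpow, hA, hB, hC, map_one f, one_zpow, one_zpow,
    mul_one, mul_one, ← ofAdd_zsmul, ofAdd_eq_one, zsmul_one, 
    ZMod.intCast_zmod_eq_zero_iff_dvd] at this
  exact_mod_cast this

theorem dvd_of_genC_zpow (hp : p.Prime) (hkj : k < j) (hji : j ≤ i)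
    (heijk : e + k = i + j) {z : ℤ} (h : genC p e i j k ^ z = 1) : (p : ℤ) ^ j ∣ z := by
  let R := ZMod (p ^ e)
  let γ : R := (p : R) ^ (i - k)
  have hpe : (p : R) ^ e = 0 := by
    have := ZMod.natCast_self (p ^ e)
    exact_mod_cast this
  have hvanish : ∀ n, e ≤ n → (p : R) ^ n = 0 := fun n hn => pow_eq_zero_of_le hn hpe
  let A : Equiv.Perm (R × R) :=
    { toFun := fun t => (t.1 + 1, t.2)
      invFun := fun t => (t.1 - 1, t.2)
      left_inv := fun t => by simp
      right_inv := fun t => by simp }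
  let S (l m : R) : Equiv.Perm (R × R) :=
    { toFun := fun t => (t.1, t.2 + (l + m * t.1))
      invFun := fun t => (t.1, t.2 - (l + m * t.1))
      left_inv := fun t => by simp
      right_inv := fun t => by simp }
  have hA : ∀ n : ℕ, ∀ t : R × R, (A ^ n) t = (t.1 + n, t.2) := by
    intro n
    induction n with
    | zero => simp
    | succ n ih =>
      intro t
      rw [pow_succ, Equiv.Perm.mul_apply, ih]
      ext <;> simp [A]
      ring
  have hSmul : ∀ l m l' m', S l m * S l' m' = S (l + l') (m + m') := by
    intro l m l' m'
    ext t <;> simp [S]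
    ring
  have hS0 : S 0 0 = 1 := by ext t <;> simp [S]
  have hS : ∀ (l m : R) (n : ℕ), S l m ^ n = S (n * l) (n * m) := by
    intro l m n
    induction n with
    | zero => simp [hS0]
    | succ n ih =>
      rw [pow_succ, ih, hSmul]
      congr 1 <;> (push_cast; ring)
  have hC : commG (S 1 γ) A = S γ 0 := by
    have : S 1 γ * A = A * S 1 γ * S γ 0 := by
      ext t <;> simp [S, A]
      ring
    rw [commG, mul_assoc, this]
    group
  have hpk : (p : R) ^ k * γ = (p : R) ^ i := by
    rw [← pow_add]; congr 1; omega
  obtain ⟨f, hfA, hfB⟩ := exists_lift (p := p) (e := e) (i := i) (j := j) (k := k)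
    (x := A) (y := S 1 γ)
    (by ext t <;> simp [hA])
    (by
      rw [hC, hS, mul_zero]
      push_cast
      rw [← pow_add, hvanish _ (by omega), hS0])
    (by
      rw [hC]
      ext t <;> simp [S, A])
    (by
      rw [hC, Commute, SemiconjBy, hSmul, hSmul, add_comm, add_comm 0])
    (by
      rw [hC, hS, hS]
      push_cast
      rw [hpk, mul_zero, mul_one, ← pow_add, hvanish (i + (i - k)) (by omega)])
  have hfC : f (genC p e i j k) = S γ 0 := by rw [genC, map_commG, hfA, hfB, hC]
  have hSz : ∀ z : ℤ, S γ 0 ^ z = S (z * γ) 0 := by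
    intro z
    obtain ⟨n, rfl | rfl⟩ := z.eq_nat_or_neg
    · rw [zpow_natCast, hS]; simp
    · rw [zpow_neg, zpow_natCast, hS, inv_eq_iff_mul_eq_one, hSmul, ← hS0]
      congr 1
      · push_cast; ring
      · simp
  have h' := congrArg f h
  rw [map_zpow, hfC, hSz, map_one] at h'
  have h0 : ((z * (p : ℤ) ^ (i - k) : ℤ) : R) = 0 := by
    have := congrArg (fun σ : Equiv.Perm (R × R) => (σ (0, 0)).2) h'
    push_cast
    simpa [S, γ] using this
  rw [ZMod.intCast_zmod_eq_zero_iff_dvd] at h0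
  push_cast at h0
  rw [show e = j + (i - k) by omega, pow_add] at h0
  exact Int.dvd_of_mul_dvd_mul_right (pow_ne_zero _ (by exact_mod_cast hp.ne_zero)) h0

variable (p e i j k) in
theorem normal_form_pow_exponent (hodd : Odd p) (hie : i ≤ e) (hji : j ≤ i)
    (heijk : e + k = i + j) (x y z : ℤ) :
    (genA p e i j k ^ x * genB p e i j k ^ y * genC p e i j k ^ z) ^ p ^ e = 1 := by
  have hj : ((p ^ j : ℕ) : ℤ) ∣ (p ^ e : ℕ) :=
    Int.natCast_dvd_natCast.mpr (pow_dvd_pow p (hji.trans hie))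
  have hch : ((p ^ e : ℕ) : ℤ) ∣ ((p ^ e).choose 2 : ℕ) :=
    Int.natCast_dvd_natCast.mpr hodd.pow.dvd_choose_two
  rw [heisenberg_pow (genB_mul_genA p e i j k) (genC_comm_genA p e i j k)
      (genC_comm_genB p e i j k),
    zpow_eq_one_of_dvd' (genA_pow p e i j k) (dvd_mul_right _ _),
    zpow_eq_one_of_dvd' (genB_pow_exponent heijk hie) (dvd_mul_right _ _),
    zpow_eq_one_of_dvd' (genC_pow p e i j k)
      (dvd_add (hj.mul_right _) ((hj.trans hch).mul_right _)), one_mul, one_mul]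

variable (p e i j k) in
theorem genB_zpow_mul (y : ℤ) :
    genB p e i j k ^ ((p ^ i : ℕ) * y) = genC p e i j k ^ ((p ^ k : ℕ) * y) := by
  rw [zpow_mul, zpow_natCast, genB_pow, ← zpow_natCast, ← zpow_mul]

theorem normal_form_pow (hodd : Odd p) (hji : j ≤ i) (x y z : ℤ) :
    (genA p e i j k ^ x * genB p e i j k ^ y * genC p e i j k ^ z) ^ p ^ i =
      genA p e i j k ^ ((p ^ i : ℕ) * x) * genC p e i j k ^ ((p ^ k : ℕ) * y) := by
  have hj : ((p ^ j : ℕ) : ℤ) ∣ (p ^ i : ℕ) := Int.natCast_dvd_natCast.mpr (pow_dvd_pow p hji)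
  have hch : ((p ^ i : ℕ) : ℤ) ∣ ((p ^ i).choose 2 : ℕ) :=
    Int.natCast_dvd_natCast.mpr hodd.pow.dvd_choose_two
  rw [heisenberg_pow (genB_mul_genA p e i j k) (genC_comm_genA p e i j k)
      (genC_comm_genB p e i j k), genB_zpow_mul,
    zpow_eq_one_of_dvd' (genC_pow p e i j k)
      (dvd_add (hj.mul_right _) ((hj.trans hch).mul_right _)), mul_one]

/-- The last defining relation for a pair of elements in normal form, in terms of exponents. -/
theorem relation_iff (hp : p.Prime) (hodd : Odd p) (hkj : k < j) (hji : j ≤ i) (hie : i ≤ e)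
    (heijk : e + k = i + j) (x y z x' y' z' : ℤ) :
    (genA p e i j k ^ x' * genB p e i j k ^ y' * genC p e i j k ^ z') ^ p ^ i =
      commG (genA p e i j k ^ x' * genB p e i j k ^ y' * genC p e i j k ^ z')
        (genA p e i j k ^ x * genB p e i j k ^ y * genC p e i j k ^ z) ^ p ^ k ↔
      (p : ℤ) ^ (e - i) ∣ x' ∧ (p : ℤ) ^ (e - i) ∣ y' * x - y * x' - y' := by
  have hp0 (n : ℕ) : (p : ℤ) ^ n ≠ 0 := pow_ne_zero _ (by exact_mod_cast hp.ne_zero)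
  have he : (p : ℤ) ^ e = p ^ i * p ^ (e - i) := by rw [← pow_add, Nat.add_sub_of_le hie]
  have hj : (p : ℤ) ^ j = p ^ k * p ^ (e - i) := by rw [← pow_add]; congr 1; omega
  rw [normal_form_pow hodd hji, heisenberg_commG (genB_mul_genA p e i j k)
    (genC_comm_genA p e i j k) (genC_comm_genB p e i j k), ← zpow_natCast, ← zpow_mul]
  constructor
  · intro h
    have h' : genA p e i j k ^ (((p ^ i : ℕ) : ℤ) * x') * genB p e i j k ^ (0 : ℤ) *
        genC p e i j k ^ (((p ^ k : ℕ) : ℤ) * y' - (y' * x - y * x') * (p ^ k : ℕ)) = 1 := by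
      rw [zpow_zero, mul_one, zpow_sub, ← mul_assoc, h, mul_inv_cancel]
    have hx := dvd_of_genA_zpow h'
    push_cast at hx
    rw [he] at hx
    have hx' := Int.dvd_of_mul_dvd_mul_left (hp0 i) hx
    refine ⟨hx', ?_⟩
    rw [zpow_zero, mul_one, zpow_eq_one_of_dvd' (genA_pow p e i j k)
      (by push_cast; rwa [he]), one_mul] at h'
    have hc := dvd_of_genC_zpow hp hkj hji heijk h'
    rw [hj, show ((p ^ k : ℕ) : ℤ) * y' - (y' * x - y * x') * (p ^ k : ℕ) =
      p ^ k * -(y' * x - y * x' - y') by push_cast; ring] at hc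
    exact (dvd_neg).mp (Int.dvd_of_mul_dvd_mul_left (hp0 k) hc)
  · rintro ⟨hx, hy⟩
    rw [zpow_eq_one_of_dvd' (genA_pow p e i j k)
      (by push_cast; rw [he]; exact mul_dvd_mul_left _ hx), one_mul, eq_comm, ← mul_inv_eq_one,
      ← zpow_sub]
    apply zpow_eq_one_of_dvd' (genC_pow p e i j k)
    push_cast
    rw [hj, show (y' * x - y * x') * (p : ℤ) ^ k - p ^ k * y' =
      p ^ k * (y' * x - y * x' - y') by ring]
    exact mul_dvd_mul_left _ hy

theorem genB_pow_ne_one (hp : p.Prime) (hkj : k < j) (hji : j ≤ i) (heijk : e + k = i + j) :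
    genB p e i j k ^ p ^ (e - 1) ≠ 1 := by
  intro h
  have he : p ^ (e - 1) = p ^ i * p ^ (e - 1 - i) := by rw [← pow_add]; congr 1; omega
  rw [he, pow_mul, genB_pow, ← pow_mul, ← pow_add, show k + (e - 1 - i) = j - 1 by omega,
    ← zpow_natCast] at h
  have := dvd_of_genC_zpow hp hkj hji heijk h
  rw [← Nat.cast_pow, Int.natCast_dvd_natCast, Nat.pow_dvd_pow_iff_le_right hp.one_lt] at this
  omega

theorem normal_form_pow_eq_one (hkj : k < j) (hji : j ≤ i) (heijk : e + k = i + j)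
    (hodd : Odd p) {x y : ℤ} (z : ℤ) (hx : (p : ℤ) ∣ x) (hy : (p : ℤ) ∣ y) :
    (genA p e i j k ^ x * genB p e i j k ^ y * genC p e i j k ^ z) ^ p ^ (e - 1) = 1 := by
  have hj : ((p ^ j : ℕ) : ℤ) ∣ (p ^ (e - 1) : ℕ) :=
    Int.natCast_dvd_natCast.mpr (pow_dvd_pow p (by omega))
  have he : ((p ^ e : ℕ) : ℤ) = (p ^ (e - 1) : ℕ) * p := by
    rw [← Nat.cast_mul, ← pow_succ]; congr 2; omega
  have hch : ((p ^ (e - 1) : ℕ) : ℤ) ∣ ((p ^ (e - 1)).choose 2 : ℕ) :=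
    Int.natCast_dvd_natCast.mpr hodd.pow.dvd_choose_two
  rw [heisenberg_pow (genB_mul_genA p e i j k) (genC_comm_genA p e i j k)
      (genC_comm_genB p e i j k),
    zpow_eq_one_of_dvd' (genA_pow p e i j k) (by rw [he]; exact mul_dvd_mul_left _ hx),
    zpow_eq_one_of_dvd' (genB_pow_exponent heijk (by omega))
      (by rw [he]; exact mul_dvd_mul_left _ hy),
    zpow_eq_one_of_dvd' (genC_pow p e i j k)
      (dvd_add (hj.mul_right _) ((hj.trans hch).mul_right _)), one_mul, one_mul]

theorem closure_eq_top_of_isCoprime (hie : i ≤ e)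
    (heijk : e + k = i + j) {x y z x' y' z' : ℤ} (hd : IsCoprime (y' * x - y * x') (p : ℤ)) :
    Subgroup.closure {genA p e i j k ^ x * genB p e i j k ^ y * genC p e i j k ^ z,
      genA p e i j k ^ x' * genB p e i j k ^ y' * genC p e i j k ^ z'} = ⊤ := by
  set u := genA p e i j k ^ x * genB p e i j k ^ y * genC p e i j k ^ z with hu
  set v := genA p e i j k ^ x' * genB p e i j k ^ y' * genC p e i j k ^ z' with hv
  set H := Subgroup.closure {u, v}
  have huH : u ∈ H := Subgroup.subset_closure (by simp)
  have hvH : v ∈ H := Subgroup.subset_closure (by simp)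
  have hd' (n : ℕ) : IsCoprime (y' * x - y * x') ((p ^ n : ℕ) : ℤ) := by
    push_cast; exact hd.pow_right
  have hC : genC p e i j k ∈ H := by
    apply mem_of_zpow_mem_of_coprime (hd' j) (genC_pow p e i j k)
    rw [← heisenberg_commG (genB_mul_genA p e i j k)
      (genC_comm_genA p e i j k) (genC_comm_genB p e i j k) x' y' z' x y z, ← hu, ← hv, commG]
    exact H.mul_mem (H.mul_mem (H.mul_mem (H.inv_mem hvH) (H.inv_mem huH)) hvH) huH
  have hcomb (m n : ℤ) :
      genA p e i j k ^ (m * x + n * x') * genB p e i j k ^ (m * y + n * y') ∈ H := by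
    obtain ⟨t, ht⟩ := exists_heisenberg_zpow (genB_mul_genA p e i j k) (genC_comm_genA p e i j k)
      (genC_comm_genB p e i j k) x y z m
    obtain ⟨t', ht'⟩ := exists_heisenberg_zpow (genB_mul_genA p e i j k)
      (genC_comm_genA p e i j k) (genC_comm_genB p e i j k) x' y' z' n
    have h := H.mul_mem (H.zpow_mem huH m) (H.zpow_mem hvH n)
    rw [hu, hv, ht, ht', heisenberg_mul (genB_mul_genA p e i j k)
      (genC_comm_genA p e i j k) (genC_comm_genB p e i j k)] at h
    exact (H.mul_mem_cancel_right (H.zpow_mem hC _)).mp h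
  have hB : genB p e i j k ∈ H := by
    apply mem_of_zpow_mem_of_coprime (hd' e) (genB_pow_exponent heijk hie)
    have h := hcomb (-x') x
    rwa [show -x' * x + x * x' = 0 by ring, zpow_zero, one_mul,
      show -x' * y + x * y' = y' * x - y * x' by ring] at h
  have hA : genA p e i j k ∈ H := by
    apply mem_of_zpow_mem_of_coprime (hd' e) (genA_pow p e i j k)
    have h := hcomb y' (-y)
    rwa [show y' * y + -y * y' = 0 by ring, zpow_zero, mul_one,
      show y' * x + -y * x' = y' * x - y * x' by ring] at h
  rw [eq_top_iff]
  intro g _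
  obtain ⟨x, y, z, rfl⟩ := exists_normal_form p e i j k g
  exact H.mul_mem (H.mul_mem (H.zpow_mem hA x) (H.zpow_mem hB y)) (H.zpow_mem hC z)

theorem exists_mulEquiv_iff (hp : p.Prime) (hodd : Odd p) (hkj : k < j) (hji : j ≤ i)
    (hie : i ≤ e) (heijk : e + k = i + j) (x y z x' y' z' : ℤ) :
    (∃ θ : PresentedGroup (class2Rels p e i j k) ≃* PresentedGroup (class2Rels p e i j k),
      θ (PresentedGroup.of 0) = genA p e i j k ^ x * genB p e i j k ^ y * genC p e i j k ^ z ∧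
      θ (PresentedGroup.of 1) =
        genA p e i j k ^ x' * genB p e i j k ^ y' * genC p e i j k ^ z') ↔
      (p : ℤ) ^ (e - i) ∣ x - 1 ∧ (p : ℤ) ^ (e - i) ∣ x' ∧ ¬ (p : ℤ) ∣ y' := by
  have hpp : Prime (p : ℤ) := Nat.prime_iff_prime_int.mp hp
  have hpe : (p : ℤ) ∣ p ^ (e - i) := dvd_pow_self _ (by omega)
  constructor
  · rintro ⟨θ, hu, hv⟩
    have hrel := congrArg θ.toMonoidHom (genB_pow p e i j k)
    rw [genC, map_pow, map_pow, map_commG] at hrel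
    change θ (PresentedGroup.of 1) ^ _ =
      commG (θ (PresentedGroup.of 1)) (θ (PresentedGroup.of 0)) ^ _ at hrel
    rw [hu, hv, relation_iff hp hodd hkj hji hie heijk] at hrel
    obtain ⟨hx', h⟩ := hrel
    have hy' : ¬ (p : ℤ) ∣ y' := fun hy' => by
      have h₁ := normal_form_pow_eq_one (k := k) hkj hji heijk hodd z' (hpe.trans hx') hy'
      rw [← hv, ← map_pow, map_eq_one_iff θ θ.injective] at h₁
      exact genB_pow_ne_one hp hkj hji heijk h₁
    refine ⟨?_, hx', hy'⟩
    have h₂ : (p : ℤ) ^ (e - i) ∣ y' * (x - 1) := by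
      have := dvd_add h (hx'.mul_left y)
      rwa [show y' * x - y * x' - y' + y * x' = y' * (x - 1) by ring] at this
    exact ((hpp.coprime_iff_not_dvd.mpr hy').pow_left).dvd_of_dvd_mul_left h₂
  · rintro ⟨hx, hx', hy'⟩
    have hd : (p : ℤ) ^ (e - i) ∣ y' * x - y * x' - y' := by
      rw [show y' * x - y * x' - y' = y' * (x - 1) - y * x' by ring]
      exact dvd_sub (hx.mul_left _) (hx'.mul_left _)
    have hcop : IsCoprime (y' * x - y * x') (p : ℤ) := by
      rw [isCoprime_comm, hpp.coprime_iff_not_dvd]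
      exact fun h => hy' ((dvd_sub_right h).mp (hpe.trans hd))
    have hcomm := heisenberg_commG (genB_mul_genA p e i j k)
      (genC_comm_genA p e i j k) (genC_comm_genB p e i j k) x' y' z' x y z
    have hcentral (d x y z : ℤ) : Commute (genC p e i j k ^ d)
        (genA p e i j k ^ x * genB p e i j k ^ y * genC p e i j k ^ z) :=
      (((genC_comm_genA p e i j k).zpow_zpow d x).mul_right
        ((genC_comm_genB p e i j k).zpow_zpow d y)).mul_right
        ((Commute.refl _).zpow_zpow d z)
    obtain ⟨f, hu, hv⟩ := exists_lift (normal_form_pow_exponent p e i j k hodd hie hji heijk x y z)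
      (by rw [hcomm, ← zpow_natCast, zpow_comm, zpow_natCast, genC_pow, one_zpow])
      (by rw [hcomm]; exact hcentral _ _ _ _) (by rw [hcomm]; exact hcentral _ _ _ _)
      ((relation_iff hp hodd hkj hji hie heijk x y z x' y' z').mpr ⟨hx', hd⟩)
    have hsurj : Function.Surjective f := by
      rw [← MonoidHom.range_eq_top, eq_top_iff,
        ← closure_eq_top_of_isCoprime hie heijk (z := z) (z' := z') hcop,
        Subgroup.closure_le]
      rintro g (rfl | rfl)
      exacts [⟨_, hu⟩, ⟨_, hv⟩]
    have := finite hp heijk hie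
    exact ⟨MulEquiv.ofBijective f ⟨Finite.injective_iff_surjective.mpr hsurj, hsurj⟩, hu, hv⟩

theorem exists_genB_zpow_eq (hp : p.Prime) (y : ℤ) :
    ∃ n : ℕ, 1 ≤ n ∧ n ≤ p ^ i ∧ ((p ^ i : ℕ) : ℤ) ∣ y - n ∧
      ∃ t : ℤ, genB p e i j k ^ y = genB p e i j k ^ n * genC p e i j k ^ t := by
  obtain ⟨n, h₁, h₂, s, hs⟩ := exists_nat_mem_Icc_dvd_sub y (pow_pos hp.pos i)
  refine ⟨n, h₁, h₂, ⟨s, hs⟩, (p ^ k : ℕ) * s, ?_⟩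
  rw [← genB_zpow_mul, ← hs, ← zpow_natCast, ← zpow_add, add_sub_cancel]

theorem exists_genA_zpow_eq (hp : p.Prime) (hie : i ≤ e) (l : ℕ) {x : ℤ}
    (hx : (p : ℤ) ^ (e - i) ∣ x - l) :
    ∃ m : ℕ, 1 ≤ m ∧ m ≤ p ^ i ∧ genA p e i j k ^ x = genA p e i j k ^ (l + m * p ^ (e - i)) := by
  obtain ⟨t, ht⟩ := hx
  obtain ⟨m, h₁, h₂, s, hs⟩ := exists_nat_mem_Icc_dvd_sub t (pow_pos hp.pos i)
  refine ⟨m, h₁, h₂, ?_⟩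
  rw [← zpow_natCast, ← mul_inv_eq_one, ← zpow_sub]
  apply zpow_eq_one_of_dvd' (genA_pow p e i j k)
  refine ⟨s, ?_⟩
  have he : (p : ℤ) ^ e = p ^ i * p ^ (e - i) := by rw [← pow_add, Nat.add_sub_of_le hie]
  push_cast at hs ⊢
  rw [he]
  linear_combination ht + (p : ℤ) ^ (e - i) * hs

end Class2

/-- Description of the automorphisms of
`G = ⟨a, b ∣ a^{p^e} = [b,a]^{p^j} = [b,a,a] = [b,a,b] = 1, b^{p^i} = [b,a]^{p^k}⟩`
for `p` an odd prime and `0 < k < j ≤ i ≤ e` with `e = i + j - k`: a map sending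
`a ↦ u`, `b ↦ v` extends to an automorphism iff `u = a^{1 + m p^{e-i}} b^n c_a` and
`v = a^{r p^{e-i}} b^s c_b` with `1 ≤ m, n, r, s ≤ p^i`, `p ∤ s` and `c_a, c_b ∈ G'`. -/
theorem stmt7 (p e i j k : ℕ) (hp : p.Prime) (hodd : Odd p)
    (hk : 0 < k) (hkj : k < j) (hji : j ≤ i) (hie : i ≤ e) (heijk : e + k = i + j)
    (u v : PresentedGroup (class2Rels p e i j k)) :
    (∃ θ : PresentedGroup (class2Rels p e i j k) ≃* PresentedGroup (class2Rels p e i j k),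
        θ (PresentedGroup.of 0) = u ∧ θ (PresentedGroup.of 1) = v) ↔
      (∃ m n r s : ℕ,
        1 ≤ m ∧ m ≤ p ^ i ∧ 1 ≤ n ∧ n ≤ p ^ i ∧
        1 ≤ r ∧ r ≤ p ^ i ∧ 1 ≤ s ∧ s ≤ p ^ i ∧ ¬ p ∣ s ∧
        ∃ ca ∈ commutator (PresentedGroup (class2Rels p e i j k)),
        ∃ cb ∈ commutator (PresentedGroup (class2Rels p e i j k)),
          u = PresentedGroup.of 0 ^ (1 + m * p ^ (e - i)) * PresentedGroup.of 1 ^ n * ca ∧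
          v = PresentedGroup.of 0 ^ (r * p ^ (e - i)) * PresentedGroup.of 1 ^ s * cb) := by
  obtain ⟨x, y, z, rfl⟩ := Class2.exists_normal_form p e i j k u
  obtain ⟨x', y', z', rfl⟩ := Class2.exists_normal_form p e i j k v
  have hC := Class2.genC_mem_commutator p e i j k
  constructor
  · intro h
    obtain ⟨hx, hx', hy'⟩ := (Class2.exists_mulEquiv_iff hp hodd hkj hji hie heijk ..).mp h
    obtain ⟨m, hm₁, hm₂, hm⟩ :=
      Class2.exists_genA_zpow_eq (j := j) (k := k) hp hie 1 (by simpa using hx)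
    obtain ⟨r, hr₁, hr₂, hr⟩ :=
      Class2.exists_genA_zpow_eq (j := j) (k := k) hp hie 0 (by simpa using hx')
    obtain ⟨n, hn₁, hn₂, -, t, ht⟩ :=
      Class2.exists_genB_zpow_eq (e := e) (i := i) (j := j) (k := k) hp y
    obtain ⟨s, hs₁, hs₂, hs, t', ht'⟩ :=
      Class2.exists_genB_zpow_eq (e := e) (i := i) (j := j) (k := k) hp y'
    refine ⟨m, n, r, s, hm₁, hm₂, hn₁, hn₂, hr₁, hr₂, hs₁, hs₂, fun hps => hy' ?_,
      _, Subgroup.zpow_mem _ hC (t + z), _, Subgroup.zpow_mem _ hC (t' + z'), ?_, ?_⟩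
    · have hpi : (p : ℤ) ∣ ((p ^ i : ℕ) : ℤ) :=
        Int.natCast_dvd_natCast.mpr (dvd_pow_self p (by omega))
      exact (dvd_iff_dvd_of_dvd_sub (hpi.trans hs)).mpr (Int.natCast_dvd_natCast.mpr hps)
    · rw [hm, ht, zpow_add]
      simp only [mul_assoc]
    · rw [hr, ht', zpow_add, zero_add]
      simp only [mul_assoc]
  · rintro ⟨m, n, r, s, -, -, -, -, -, -, -, -, hs, ca, hca, cb, hcb, hu, hv⟩
    obtain ⟨t, rfl⟩ := Class2.exists_zpow_of_mem_commutator p e i j k hca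
    obtain ⟨t', rfl⟩ := Class2.exists_zpow_of_mem_commutator p e i j k hcb
    rw [hu, hv]
    simp only [← zpow_natCast (PresentedGroup.of _)]
    refine (Class2.exists_mulEquiv_iff hp hodd hkj hji hie heijk ..).mpr ⟨?_, ?_, ?_⟩
    · simp
    · simp
    · rwa [Int.natCast_dvd_natCast]
end

section
/- Let p be an odd prime, e ≥ 2, 1 ≤ i ≤ e−1, and let G be the group with presentation ⟨a, b ∣ a^{p^e} = b^{p^e} = 1, [a,b] = a^{p^i}⟩. Then for every pair x, y ∈ G with ⟨x, y⟩ = G, there do not exist an automorphism θ of G and an element g ∈ G such that θ(x) = g⁻¹x⁻¹g and θ(y) = g⁻¹y⁻¹g. -/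
/-- If `a` and `b` generate `G` and `b` conjugates `a` to powers of `a` in both directions,
so does every element of `G`. -/
theorem exists_conj_eq_zpow_of_closure_pair {G : Type*} [Group G] {a b : G}
    (hgen : Subgroup.closure {a, b} = ⊤) (h₁ : ∃ n : ℤ, b * a * b⁻¹ = a ^ n)
    (h₂ : ∃ n : ℤ, b⁻¹ * a * b = a ^ n) (g : G) : ∃ n : ℤ, g * a * g⁻¹ = a ^ n := by
  suffices h : (∃ n : ℤ, g * a * g⁻¹ = a ^ n) ∧ ∃ n : ℤ, g⁻¹ * a * g = a ^ n from h.1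
  have hg : g ∈ Subgroup.closure {a, b} := hgen ▸ Subgroup.mem_top g
  induction hg using Subgroup.closure_induction with
  | mem z hz =>
    rcases hz with rfl | rfl
    · exact ⟨⟨1, by simp⟩, ⟨1, by simp⟩⟩
    · exact ⟨h₁, h₂⟩
  | one => exact ⟨⟨1, by simp⟩, ⟨1, by simp⟩⟩
  | mul s t _ _ hs ht =>
    obtain ⟨⟨k, hk⟩, l, hl⟩ := hs
    obtain ⟨⟨m, hm⟩, n, hn⟩ := ht
    refine ⟨⟨k * m, ?_⟩, ⟨n * l, ?_⟩⟩
    · calc s * t * a * (s * t)⁻¹ = s * (t * a * t⁻¹) * s⁻¹ := by group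
        _ = a ^ (k * m) := by rw [hm, ← conj_zpow, hk, zpow_mul]
    · calc (s * t)⁻¹ * a * (s * t) = t⁻¹ * (s⁻¹ * a * s) * t⁻¹⁻¹ := by group
        _ = a ^ (n * l) := by rw [hl, ← conj_zpow, inv_inv, hn, zpow_mul]
  | inv s _ hs => simpa using hs.symm

/-- Two elements generating a group and commuting with each other force it to be commutative. -/
theorem commute_of_closure_pair {G : Type*} [Group G] {a b : G}
    (hgen : Subgroup.closure {a, b} = ⊤) (hab : Commute a b) (g h : G) : Commute g h := by
  have key : ∀ z : G, Commute z a → Commute z b → ∀ g : G, Commute z g := by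
    intro z ha hb g
    have hle : Subgroup.closure {a, b} ≤ Subgroup.centralizer {z} := by
      rw [Subgroup.closure_le]
      rintro w (rfl | rfl)
      · exact Subgroup.mem_centralizer_singleton_iff.2 ha.symm
      · exact Subgroup.mem_centralizer_singleton_iff.2 hb.symm
    have hg : g ∈ Subgroup.centralizer {z} := hle (hgen ▸ Subgroup.mem_top g)
    exact (Subgroup.mem_centralizer_singleton_iff.1 hg).symm
  exact key g (key a (Commute.refl a) hab g).symm (key b hab.symm (Commute.refl b) g).symm h

/-- An automorphism which is conjugate to inversion on a generating pair sends each element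
to its inverse modulo any normal subgroup with commutative quotient. -/
theorem map_mul_self_mem_of_conj_inv {G : Type*} [Group G] {N : Subgroup G} [N.Normal]
    (hN : ∀ g h : G ⧸ N, Commute g h) {x y : G} (hgen : Subgroup.closure {x, y} = ⊤)
    (θ : G ≃* G) (g : G) (hx : θ x = g⁻¹ * x⁻¹ * g) (hy : θ y = g⁻¹ * y⁻¹ * g) (z : G) :
    z * θ z ∈ N := by
  have hz : z ∈ Subgroup.closure {x, y} := hgen ▸ Subgroup.mem_top z
  have conj : ∀ w : G, ((g⁻¹ * w⁻¹ * g : G) : G ⧸ N) = (w : G ⧸ N)⁻¹ := by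
    intro w
    rw [QuotientGroup.mk_mul, (hN _ _).eq, ← QuotientGroup.mk_mul,
      mul_inv_cancel_left, QuotientGroup.mk_inv]
  have hinv : ((θ z : G) : G ⧸ N) = (z : G ⧸ N)⁻¹ := by
    induction hz using Subgroup.closure_induction with
    | mem w hw =>
      rcases hw with rfl | rfl
      · rw [hx, conj]
      · rw [hy, conj]
    | one => simp
    | mul s t _ _ hs ht =>
      rw [map_mul, QuotientGroup.mk_mul, QuotientGroup.mk_mul, hs, ht, mul_inv_rev, (hN _ _).eq]
    | inv s _ hs => rw [map_inv, QuotientGroup.mk_inv, QuotientGroup.mk_inv, hs]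
  rw [← QuotientGroup.eq_one_iff, QuotientGroup.mk_mul, hinv, mul_inv_cancel]

/-- In a group generated by `a` and `b` with `a ^ p ^ e = 1` and `[a, b] = a ^ p ^ i`, where `p`
is an odd prime and `i ≠ 0`, an automorphism that is conjugate to inversion on some generating
pair can exist only if `a ^ p ^ i = 1`. -/
theorem pow_eq_one_of_conj_inv {G : Type*} [Group G] {p e i : ℕ} (hp : p.Prime) (hodd : Odd p)
    (hi : i ≠ 0) {a b : G} (hgen : Subgroup.closure {a, b} = ⊤) (ha : a ^ p ^ e = 1)
    (hab : commG a b = a ^ p ^ i) {x y : G} (hxy : Subgroup.closure {x, y} = ⊤)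
    (θ : G ≃* G) (g : G) (hx : θ x = g⁻¹ * x⁻¹ * g) (hy : θ y = g⁻¹ * y⁻¹ * g) :
    a ^ p ^ i = 1 := by
  have hpi : p ∣ p ^ i := dvd_pow_self p hi
  have hcop : ∀ k : ℕ, ¬ p ∣ k → ∀ w : G, w ^ k = 1 → w ^ p ^ e = 1 → w = 1 := by
    intro k hk w h₁ h₂
    have hc : Nat.Coprime k (p ^ e) := ((Nat.Prime.coprime_iff_not_dvd hp).2 hk).symm.pow_right e
    rw [← orderOf_eq_one_iff]
    exact Nat.eq_one_of_dvd_coprimes hc (orderOf_dvd_of_pow_eq_one h₁)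
      (orderOf_dvd_of_pow_eq_one h₂)
  obtain ⟨u, hu⟩ : ∃ u, u = 1 + p ^ i := ⟨_, rfl⟩
  have hconj : b⁻¹ * a * b = a ^ u := by
    rw [hu, pow_add, pow_one, ← hab, commG]; group
  have hu_cop : u.Coprime (orderOf a) := by
    have hpu : ¬ p ∣ u := by
      rw [hu, Nat.dvd_add_left hpi]
      exact hp.one_lt.ne' ∘ Nat.dvd_one.1
    exact Nat.Coprime.coprime_dvd_right (orderOf_dvd_of_pow_eq_one ha)
      (((Nat.Prime.coprime_iff_not_dvd hp).2 hpu).symm.pow_right e)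
  obtain ⟨w, hw⟩ := exists_pow_eq_self_of_coprime hu_cop
  have hconj' : b * a * b⁻¹ = a ^ w := by
    have h : a = b⁻¹ * a ^ w * b := by
      have := conj_pow (i := w) (a := b⁻¹) (b := a)
      rw [inv_inv, hconj, hw] at this
      exact this
    calc b * a * b⁻¹ = b * (b⁻¹ * a ^ w * b) * b⁻¹ := by rw [← h]
      _ = a ^ w := by group
  have hpow := exists_conj_eq_zpow_of_closure_pair hgen ⟨w, by simpa using hconj'⟩
    ⟨u, by simpa using hconj⟩
  have hnormal : (Subgroup.zpowers (a ^ p ^ i)).Normal := by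
    refine ⟨?_⟩
    rintro _ ⟨k, rfl⟩ h
    obtain ⟨n, hn⟩ := hpow h
    refine ⟨n * k, ?_⟩
    change (a ^ p ^ i) ^ (n * k) = h * (a ^ p ^ i) ^ k * h⁻¹
    rw [← conj_zpow, ← conj_pow, hn, ← zpow_natCast, ← zpow_natCast, ← zpow_mul,
      ← zpow_mul, ← zpow_mul]
    ring_nf
  have hcomm : ∀ s t : G ⧸ Subgroup.zpowers (a ^ p ^ i), Commute s t := by
    refine commute_of_closure_pair (a := (a : G ⧸ Subgroup.zpowers (a ^ p ^ i)))
      (b := (b : G ⧸ Subgroup.zpowers (a ^ p ^ i))) ?_ ?_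
    · have h := congrArg (Subgroup.map (QuotientGroup.mk' (Subgroup.zpowers (a ^ p ^ i)))) hgen
      rw [MonoidHom.map_closure, Set.image_pair,
        Subgroup.map_top_of_surjective _ (QuotientGroup.mk'_surjective _)] at h
      exact h
    · have h : ((commG a b : G) : G ⧸ Subgroup.zpowers (a ^ p ^ i)) = 1 :=
        (QuotientGroup.eq_one_iff _).2 (hab ▸ Subgroup.mem_zpowers _)
      have h' : (b * a * commG a b : G) = a * b := by rw [commG]; group
      have hq := congrArg (QuotientGroup.mk (s := Subgroup.zpowers (a ^ p ^ i))) h'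
      rw [QuotientGroup.mk_mul, h, mul_one] at hq
      exact hq.symm
  have hmem := map_mul_self_mem_of_conj_inv hcomm hxy θ g hx hy
  obtain ⟨k, hk⟩ := hmem a
  obtain ⟨l, hl⟩ := hmem b
  obtain ⟨c, hc, hca⟩ : ∃ c, θ b = b⁻¹ * c ∧ Commute c a :=
    ⟨b * θ b, by group, hl ▸ ((Commute.refl a).pow_left _).zpow_left l⟩
  obtain ⟨m, hm⟩ : ∃ m : ℤ, θ a = a ^ m := by
    refine ⟨-1 + (p ^ i : ℕ) * k, ?_⟩
    rw [zpow_add, zpow_mul, zpow_natCast, zpow_neg_one]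
    exact eq_inv_mul_of_mul_eq hk.symm
  have hθ : b * θ a * b⁻¹ = θ a ^ u := by
    have h := congrArg θ hconj
    rw [map_mul, map_mul, map_inv, map_pow, hc] at h
    have hcA : Commute c (θ a ^ u) := hm ▸ (hca.zpow_right m).pow_right u
    calc b * θ a * b⁻¹ = c * ((b⁻¹ * c)⁻¹ * θ a * (b⁻¹ * c)) * c⁻¹ := by group
      _ = θ a ^ u := by rw [h, hcA.eq, mul_inv_cancel_right]
  have hconjA : b⁻¹ * θ a * b = θ a ^ u := by
    have h := conj_zpow (i := m) (a := b⁻¹) (b := a)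
    rw [inv_inv, hconj] at h
    rw [hm, ← h, ← zpow_natCast, ← zpow_natCast, ← zpow_mul, ← zpow_mul, mul_comm]
  have hsq : θ a ^ (u * u) = θ a := by
    have h := conj_pow (i := u) (a := b⁻¹) (b := θ a)
    rw [inv_inv, hconjA] at h
    rw [pow_mul, h, ← hθ]; group
  have hsq' : a ^ (u * u) = a := θ.injective (by rw [map_pow, hsq])
  refine hcop (2 + p ^ i) ?_ _ ?_ ?_
  · rw [Nat.dvd_add_left hpi]
    intro h
    rw [(Nat.prime_dvd_prime_iff_eq hp Nat.prime_two).1 h] at hodd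
    exact absurd hodd (by decide)
  · have hexp : u * u = p ^ i * (2 + p ^ i) + 1 := by rw [hu]; ring
    rw [hexp, pow_succ] at hsq'
    rw [← pow_mul]
    exact mul_eq_right.1 hsq'
  · rw [← pow_mul, mul_comm, pow_mul, ha, one_pow]

/-- The image of `a ^ p ^ i` in the group presented by `metacyclicRels p e i` is nontrivial, as
seen from the action on `ZMod (p ^ e)` with `a` a translation and `b` a multiplication. -/
theorem metacyclic_pow_ne_one {p e i : ℕ} (hp : p.Prime) (hi : i ≠ 0) (hie : i < e) :
    (PresentedGroup.of 0 : PresentedGroup (metacyclicRels p e i)) ^ p ^ i ≠ 1 := by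
  have hu_pow : (1 + (p : ZMod (p ^ e)) ^ i) ^ p ^ e = 1 := by
    have h : ((p : ℤ) ^ (e + 1)) ∣ (1 + (p : ℤ) ^ i) ^ p ^ e - 1 ^ p ^ e :=
      dvd_sub_pow_of_dvd_sub (by simpa using dvd_pow_self (p : ℤ) hi) e
    have h' : ((p ^ e : ℕ) : ℤ) ∣ (1 + (p : ℤ) ^ i) ^ p ^ e - 1 ^ p ^ e := by
      push_cast
      exact (pow_dvd_pow _ e.le_succ).trans h
    have hq := (ZMod.intCast_zmod_eq_zero_iff_dvd _ _).2 h'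
    push_cast at hq
    simpa [sub_eq_zero] using hq
  have hne : p ^ e ≠ 0 := pow_ne_zero _ hp.ne_zero
  let u : (ZMod (p ^ e))ˣ := Units.ofPowEqOne _ _ hu_pow hne
  have hu : (u : ZMod (p ^ e)) = 1 + (p : ZMod (p ^ e)) ^ i := rfl
  let T : Multiplicative (ZMod (p ^ e)) →* Equiv.Perm (ZMod (p ^ e)) :=
    { toFun := fun t => Equiv.addLeft t.toAdd
      map_one' := by ext; simp
      map_mul' := fun s t => by ext; simp }
  let f : Fin 2 → Equiv.Perm (ZMod (p ^ e)) :=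
    ![T (Multiplicative.ofAdd 1), (MulAction.toPermHom (ZMod (p ^ e))ˣ (ZMod (p ^ e))) u⁻¹]
  have hT : ∀ (n : ℕ) (z : ZMod (p ^ e)), (f 0 ^ n) z = n + z := by
    intro n z
    change (T (Multiplicative.ofAdd 1) ^ n) z = _
    rw [← map_pow, ← ofAdd_nsmul]
    simp [T]
  have hrels : ∀ r ∈ metacyclicRels p e i, FreeGroup.lift f r = 1 := by
    rintro r (rfl | rfl | rfl)
    · ext z
      rw [map_pow, FreeGroup.lift_apply_of, hT]
      simp
    · rw [map_pow, FreeGroup.lift_apply_of]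
      change ((MulAction.toPermHom (ZMod (p ^ e))ˣ (ZMod (p ^ e))) u⁻¹) ^ p ^ e = 1
      rw [← map_pow, inv_pow, Units.pow_ofPowEqOne, inv_one, map_one]
    · have h : f 0 * f 1 = f 1 * f 0 * f 0 ^ p ^ i := by
        ext z
        change (f 0) ((f 1) z) = (f 1) ((f 0) ((f 0 ^ p ^ i) z))
        have h₀ : ∀ z, f 0 z = 1 + z := fun z => rfl
        have h₁ : ∀ z, f 1 z = (u⁻¹ : (ZMod (p ^ e))ˣ) * z := fun z => rfl
        have hadd : 1 + ((p : ZMod (p ^ e)) ^ i + z) = u + z := by rw [hu, add_assoc]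
        rw [hT, h₀, h₀, h₁, h₁]
        push_cast
        rw [hadd, mul_add, Units.inv_mul]
      simp only [map_mul, map_inv, map_pow, FreeGroup.lift_apply_of, commG]
      rw [mul_inv_eq_one, mul_assoc, h]
      group
  intro h
  have h' := congrArg (PresentedGroup.toGroup hrels) h
  rw [map_pow, PresentedGroup.toGroup.of, map_one] at h'
  have h0 := congrArg (fun σ : Equiv.Perm (ZMod (p ^ e)) => σ 0) h'
  simp only [hT, add_zero, Equiv.Perm.one_apply] at h0
  rw [ZMod.natCast_eq_zero_iff] at h0
  exact absurd ((Nat.pow_dvd_pow_iff_le_right hp.one_lt).1 h0) (by omega)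

/-- Let `p` be an odd prime, `e ≥ 2`, `1 ≤ i ≤ e - 1` and let
`G = ⟨a, b ∣ a^{p^e} = b^{p^e} = 1, [a,b] = a^{p^i}⟩`. For every generating pair
`x, y` of `G` there are no automorphism `θ` and element `g` with `θ(x) = (x⁻¹)^g`
and `θ(y) = (y⁻¹)^g`. -/
theorem stmt8 (p e i : ℕ) (hp : p.Prime) (hodd : Odd p)
    (he : 2 ≤ e) (hi1 : 1 ≤ i) (hie : i ≤ e - 1) :
    ∀ x y : PresentedGroup (metacyclicRels p e i),
      Subgroup.closure {x, y} = ⊤ →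
      ¬ ∃ (θ : PresentedGroup (metacyclicRels p e i) ≃*
              PresentedGroup (metacyclicRels p e i))
          (g : PresentedGroup (metacyclicRels p e i)),
          θ x = g⁻¹ * x⁻¹ * g ∧ θ y = g⁻¹ * y⁻¹ * g := by
  rintro x y hxy ⟨θ, g, hx, hy⟩
  have hi0 : i ≠ 0 := by omega
  have ha : (PresentedGroup.of 0 : PresentedGroup (metacyclicRels p e i)) ^ p ^ e = 1 :=
    PresentedGroup.one_of_mem (Or.inl rfl)
  have hab : commG (PresentedGroup.of 0 : PresentedGroup (metacyclicRels p e i))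
      (PresentedGroup.of 1) = PresentedGroup.of 0 ^ p ^ i :=
    PresentedGroup.mk_eq_mk_of_mul_inv_mem (Or.inr (Or.inr rfl))
  have hgen : Subgroup.closure {(PresentedGroup.of 0 : PresentedGroup (metacyclicRels p e i)),
      PresentedGroup.of 1} = ⊤ := by
    rw [← PresentedGroup.closure_range_of, ← Set.image_univ]
    congr 1
    ext z
    simp [eq_comm]
  exact metacyclic_pow_ne_one hp hi0 (show i < e by omega)
    (pow_eq_one_of_conj_inv hp hodd hi0 hgen ha hab hxy θ g hx hy)
end

section
/- Let p be a prime and let G be a non-abelian metacyclic Beauville p-group. Then G is a purely non-strongly real Beauville group, i.e., no Beauville structure of G is strongly real. -/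
theorem IsPGroup.mem_zpowers_zpow {p : ℕ} (hp : p.Prime) {G : Type*} [Group G]
    (hG : IsPGroup p G) (g : G) {i : ℤ} (hi : ¬ (p : ℤ) ∣ i) :
    g ∈ Subgroup.zpowers (g ^ i) := by
  obtain ⟨k, hk⟩ := hG g
  have hcop : IsCoprime i ((p : ℤ) ^ k) :=
    (((Nat.prime_iff_prime_int.mp hp).coprime_iff_not_dvd.mpr hi).symm).pow_right
  obtain ⟨u, v, h⟩ := hcop
  refine Subgroup.mem_zpowers_iff.mpr ⟨u, ?_⟩
  have hk' : g ^ ((p : ℤ) ^ k) = 1 := by exact_mod_cast hk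
  calc (g ^ i) ^ u = g ^ (u * i + v * (p : ℤ) ^ k) := by
        rw [zpow_add, mul_comm v, zpow_mul g _ v, hk', one_zpow, mul_one, mul_comm, zpow_mul]
    _ = g := by rw [h, zpow_one]

theorem IsPGroup.eq_one_of_zpow_eq_one {p : ℕ} (hp : p.Prime) {G : Type*} [Group G]
    (hG : IsPGroup p G) {g : G} {i : ℤ} (hi : ¬ (p : ℤ) ∣ i) (h : g ^ i = 1) : g = 1 := by
  simpa [h] using hG.mem_zpowers_zpow hp g hi

/-- Nontrivial subgroups of a cyclic `p`-group meet nontrivially. -/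
theorem IsPGroup.exists_ne_one_mem_zpowers {p : ℕ} (hp : p.Prime) {G : Type*} [Group G]
    (hG : IsPGroup p G) {a g h : G} (hg : g ∈ Subgroup.zpowers a) (hh : h ∈ Subgroup.zpowers a)
    (hg1 : g ≠ 1) (hh1 : h ≠ 1) :
    ∃ z : G, z ≠ 1 ∧ z ∈ Subgroup.zpowers g ∧ z ∈ Subgroup.zpowers h := by
  have key : ∀ f ∈ Subgroup.zpowers a, f ≠ 1 →
      ∃ s : ℕ, a ^ p ^ s ≠ 1 ∧ a ^ p ^ s ∈ Subgroup.zpowers f := by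
    intro f hf hf1
    obtain ⟨i, rfl⟩ := Subgroup.mem_zpowers_iff.mp hf
    have hi : i ≠ 0 := by rintro rfl; simp at hf1
    have hfin : FiniteMultiplicity (p : ℤ) i :=
      Int.finiteMultiplicity_iff.mpr ⟨by simpa using hp.ne_one, hi⟩
    obtain ⟨j, hj, hpj⟩ := hfin.exists_eq_pow_mul_and_not_dvd
    have hpow : a ^ i = (a ^ p ^ multiplicity (p : ℤ) i) ^ j := by
      conv_lhs => rw [hj]
      rw [zpow_mul]; norm_cast
    refine ⟨_, fun h1 => hf1 (by rw [hpow, h1, one_zpow]), ?_⟩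
    rw [hpow]
    exact hG.mem_zpowers_zpow hp _ hpj
  obtain ⟨s, hs1, hs⟩ := key g hg hg1
  obtain ⟨t, ht1, ht⟩ := key h hh hh1
  rcases le_total s t with hst | hst
  · refine ⟨_, ht1, ?_, ht⟩
    rw [← Nat.add_sub_of_le hst, pow_add, pow_mul]
    exact pow_mem hs _
  · refine ⟨_, hs1, hs, ?_⟩
    rw [← Nat.add_sub_of_le hst, pow_add, pow_mul]
    exact pow_mem ht _

theorem Subgroup.exists_forall_conj_eq_zpow {G : Type*} [Group G] (a : G)
    [hN : (Subgroup.zpowers a).Normal] (g : G) :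
    ∃ e : ℤ, ∀ d ∈ Subgroup.zpowers a, g * d * g⁻¹ = d ^ e := by
  obtain ⟨e, he⟩ := Subgroup.mem_zpowers_iff.mp
    (hN.conj_mem a (Subgroup.mem_zpowers a) g)
  refine ⟨e, fun d hd => ?_⟩
  obtain ⟨i, rfl⟩ := Subgroup.mem_zpowers_iff.mp hd
  rw [← conj_zpow, ← he, ← zpow_mul, ← zpow_mul, mul_comm]

section

open scoped commutatorElement

theorem commutator_le_zpowers_of_closure_pair {G : Type*} [Group G] {x y : G}
    (hxy : Subgroup.closure {x, y} = ⊤) (hc : ⁅x, y⁆ ∈ Subgroup.center G) :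
    commutator G ≤ Subgroup.zpowers ⁅x, y⁆ := by
  have hN : (Subgroup.zpowers ⁅x, y⁆).Normal := by
    refine ⟨fun n hn g => ?_⟩
    have : n ∈ Subgroup.center G := (Subgroup.zpowers_le.mpr hc) hn
    rw [(Subgroup.mem_center_iff.mp this g), mul_inv_cancel_right]
    exact hn
  let f := QuotientGroup.mk' (Subgroup.zpowers ⁅x, y⁆)
  have hfxy : f x * f y = f y * f x := by
    rw [← commutatorElement_eq_one_iff_mul_comm, ← map_commutatorElement]
    exact (QuotientGroup.eq_one_iff _).mpr (Subgroup.mem_zpowers _)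
  have hcent : ∀ z ∈ ({x, y} : Set G), ∀ g, f z * f g = f g * f z := by
    intro z hz g
    have hle : Subgroup.closure {x, y} ≤ (Subgroup.centralizer {f z}).comap f := by
      rw [Subgroup.closure_le]
      rintro w hw
      simp only [SetLike.mem_coe, Subgroup.mem_comap, Subgroup.mem_centralizer_singleton_iff]
      rcases hz with rfl | rfl <;> rcases hw with rfl | rfl <;> first | rfl | simp [hfxy]
    have := hle (hxy ▸ Subgroup.mem_top g)
    exact (Subgroup.mem_centralizer_singleton_iff.mp this).symm
  have hall : Subgroup.closure {x, y} ≤ (Subgroup.center _).comap f := by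
    rw [Subgroup.closure_le]
    intro z hz
    refine Subgroup.mem_center_iff.mpr fun q => ?_
    obtain ⟨g, rfl⟩ := QuotientGroup.mk'_surjective _ q
    exact (hcent z hz g).symm
  rw [commutator_def, Subgroup.commutator_le]
  intro g _ h _
  rw [← QuotientGroup.eq_one_iff]
  change f ⁅g, h⁆ = 1
  rw [map_commutatorElement, commutatorElement_eq_one_iff_mul_comm]
  exact (Subgroup.mem_center_iff.mp (hall (hxy ▸ Subgroup.mem_top g)) (f h)).symm

/-- For odd `p`, an automorphism of a metacyclic `p`-group that inverts both elements of a
generating pair forces the group to be abelian. -/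
theorem IsPGroup.mul_comm_of_inverting_mulEquiv {p : ℕ} (hp : p.Prime) (hp2 : p ≠ 2)
    {G : Type*} [Group G] (hG : IsPGroup p G) (a : G) [(Subgroup.zpowers a).Normal]
    [IsCyclic (G ⧸ Subgroup.zpowers a)] {x y : G} (hxy : Subgroup.closure {x, y} = ⊤)
    (ψ : G ≃* G) (hx : ψ x = x⁻¹) (hy : ψ y = y⁻¹) (g h : G) : g * h = h * g := by
  have hp2' : ¬ (p : ℤ) ∣ 2 := by
    intro h2
    have : p ∣ 2 := by exact_mod_cast h2
    exact hp2 ((Nat.prime_dvd_prime_iff_eq hp Nat.prime_two).mp this)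
  have hDN : commutator G ≤ Subgroup.zpowers a := by
    let := IsCyclic.commGroup (α := G ⧸ Subgroup.zpowers a)
    rw [commutator_def, Subgroup.commutator_le]
    intro g _ h _
    rw [← QuotientGroup.eq_one_iff]
    change QuotientGroup.mk' (Subgroup.zpowers a) ⁅g, h⁆ = 1
    rw [map_commutatorElement, commutatorElement_eq_one_iff_mul_comm, mul_comm]
  have hψD : ∀ d ∈ commutator G, ψ.symm d ∈ commutator G := fun d hd =>
    Subgroup.characteristic_iff_le_comap.mp (inferInstance : (commutator G).Characteristic)
      ψ.symm hd
  have hcen : ∀ z : G, ψ z = z⁻¹ → ∀ d ∈ commutator G, z * d = d * z := by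
    intro z hz d hd
    obtain ⟨e, he⟩ := Subgroup.exists_forall_conj_eq_zpow a z
    have h1 := he _ (hDN (hψD d hd))
    apply_fun ψ at h1
    rw [map_mul, map_mul, map_inv, hz, inv_inv, map_zpow, ψ.apply_symm_apply,
      ← he d (hDN hd)] at h1
    have h2 : z ^ (2 : ℤ) ∈ Subgroup.centralizer {d} := by
      rw [Subgroup.mem_centralizer_singleton_iff, zpow_two]
      calc z * z * d = z * (z * d * z⁻¹) * z := by group
        _ = z * (z⁻¹ * d * z) * z := by rw [h1]
        _ = d * (z * z) := by group
    have h3 := (Subgroup.zpowers_le.mpr h2) (hG.mem_zpowers_zpow hp z hp2')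
    exact Subgroup.mem_centralizer_singleton_iff.mp h3
  have hDcen : commutator G ≤ Subgroup.center G := by
    intro d hd
    have hle : Subgroup.closure {x, y} ≤ Subgroup.centralizer {d} := by
      rw [Subgroup.closure_le]
      rintro z (rfl | rfl)
      · exact Subgroup.mem_centralizer_singleton_iff.mpr (hcen _ hx d hd)
      · exact Subgroup.mem_centralizer_singleton_iff.mpr (hcen _ hy d hd)
    exact Subgroup.mem_center_iff.mpr fun g =>
      Subgroup.mem_centralizer_singleton_iff.mp (hle (hxy ▸ Subgroup.mem_top g))
  have hmem : ∀ g h : G, ⁅g, h⁆ ∈ commutator G := fun g h =>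
    Subgroup.commutator_mem_commutator (Subgroup.mem_top g) (Subgroup.mem_top h)
  have hcc := hDcen (hmem x y)
  have hDc := commutator_le_zpowers_of_closure_pair hxy hcc
  set c := ⁅x, y⁆ with hc
  have hψc : ψ c = c := by
    have h1 := Subgroup.mem_center_iff.mp hcc (y * x)
    have h2 : c * (y * x) = x * y := by rw [hc, commutatorElement_def]; group
    rw [hc, map_commutatorElement, hx, hy, commutatorElement_def, inv_inv, inv_inv, ← hc]
    calc x⁻¹ * y⁻¹ * x * y = (y * x)⁻¹ * (x * y) := by group
      _ = c := by rw [← h2, ← h1, inv_mul_cancel_left]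
  have hψa : ψ a * a ∈ commutator G := by
    let f : G →* Abelianization G :=
      Abelianization.of.comp ψ.toMonoidHom * Abelianization.of
    have hle : Subgroup.closure {x, y} ≤ f.ker := by
      rw [Subgroup.closure_le]
      rintro z (rfl | rfl) <;> simp [f, MonoidHom.mem_ker, hx, hy]
    have := hle (hxy ▸ Subgroup.mem_top a)
    rw [← Abelianization.ker_of G, MonoidHom.mem_ker, map_mul]
    exact this
  obtain ⟨j, hj⟩ := Subgroup.mem_zpowers_iff.mp (hDc hψa)
  obtain ⟨k, hk⟩ := Subgroup.mem_zpowers_iff.mp (hDN (hmem x y))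
  rw [← hc] at hk
  by_cases hpk : (p : ℤ) ∣ k
  · have hcj : Commute (c ^ j) a⁻¹ :=
      (Subgroup.mem_center_iff.mp (zpow_mem hcc j) a⁻¹).symm
    have h1 : c = c ^ (j * k) * c⁻¹ := by
      conv_lhs => rw [← hψc, ← hk, map_zpow, eq_mul_inv_of_mul_eq hj.symm, hcj.mul_zpow,
        inv_zpow, hk, ← zpow_mul]
    have h2 : c ^ (2 - j * k) = 1 := by
      rw [zpow_sub, mul_inv_eq_one, zpow_two]
      exact eq_mul_inv_iff_mul_eq.mp h1
    have hc1 : c = 1 := by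
      refine hG.eq_one_of_zpow_eq_one hp (fun hd => hp2' ?_) h2
      have := dvd_add hd (hpk.mul_left j)
      simpa using this
    rw [← commutatorElement_eq_one_iff_mul_comm]
    simpa [hc1] using hDc (hmem g h)
  · have haC : Subgroup.zpowers a ≤ Subgroup.center G := by
      rw [Subgroup.zpowers_le]
      exact (Subgroup.zpowers_le.mpr hcc) (hk ▸ hG.mem_zpowers_zpow hp a hpk)
    have := MonoidHom.isMulCommutative_of_isCyclic_of_ker_le_center
      (QuotientGroup.mk' (Subgroup.zpowers a)) (by rwa [QuotientGroup.ker_mk'])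
    exact mul_comm' g h

end

theorem exists_zpow_mul_pow_two_pow {G : Type*} [Group G] (a v : G) (μ r : ℤ) (hμ : Odd μ)
    (h : v * a * v⁻¹ = a ^ μ) (k : ℕ) :
    ∃ c : ℤ, (μ % 4 = 1 → Odd c) ∧
      (a ^ r * v) ^ 2 ^ k = a ^ (r * 2 ^ k * c) * v ^ 2 ^ k := by
  induction k generalizing v μ r with
  | zero => exact ⟨1, by simp⟩
  | succ k ih =>
    have hconj : ∀ i : ℤ, v * a ^ i = a ^ (μ * i) * v := by
      intro i
      rw [zpow_mul, ← h, conj_zpow]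
      group
    have hsq : v ^ 2 * a * (v ^ 2)⁻¹ = a ^ (μ ^ 2) := by
      have := hconj μ
      calc v ^ 2 * a * (v ^ 2)⁻¹ = v * (v * a * v⁻¹) * v⁻¹ := by rw [pow_two]; group
        _ = a ^ (μ ^ 2) := by rw [h, this, mul_inv_cancel_right, pow_two]
    obtain ⟨c, hc, hpow⟩ := ih (v ^ 2) (μ ^ 2) (r * (1 + μ)) hμ.pow hsq
    obtain ⟨n, hn⟩ := hμ
    refine ⟨(n + 1) * c, fun hμ4 => ?_, ?_⟩
    · refine Odd.mul ?_ (hc ?_)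
      · rw [Int.odd_iff]; omega
      · rw [pow_two, Int.mul_emod, hμ4]; rfl
    · have h2 : (a ^ r * v) ^ 2 = a ^ (r * (1 + μ)) * v ^ 2 := by
        calc (a ^ r * v) ^ 2 = a ^ r * (v * a ^ r) * v := by rw [pow_two]; group
          _ = a ^ (r * (1 + μ)) * v ^ 2 := by
            rw [hconj, mul_add, mul_one, zpow_add, mul_comm μ, pow_two]; group
      rw [pow_succ', pow_mul, h2, hpow, ← pow_mul, hn]
      congr 2
      ring

theorem IsPGroup.exists_odd_forall_conj_eq_zpow {G : Type*} [Group G] (hG : IsPGroup 2 G) (a : G)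
    [(Subgroup.zpowers a).Normal] (g : G) :
    ∃ e : ℤ, Odd e ∧ ∀ d ∈ Subgroup.zpowers a, g * d * g⁻¹ = d ^ e := by
  by_cases ha : a = 1
  · refine ⟨1, odd_one, fun d hd => ?_⟩
    obtain rfl : d = 1 := by simpa [ha] using hd
    simp
  obtain ⟨e, he⟩ := Subgroup.exists_forall_conj_eq_zpow a g
  obtain ⟨f, hf⟩ := Subgroup.exists_forall_conj_eq_zpow a g⁻¹
  have haN := Subgroup.mem_zpowers a
  refine ⟨e, ?_, he⟩
  by_contra hodd
  have h1 : a ^ (1 - e * f) = 1 := by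
    rw [zpow_sub, zpow_one, mul_inv_eq_one, zpow_mul, ← hf _ (zpow_mem haN e), ← he a haN]
    group
  refine ha (hG.eq_one_of_zpow_eq_one Nat.prime_two ?_ h1)
  obtain ⟨k, rfl⟩ := even_iff_two_dvd.mp (Int.not_odd_iff_even.mp hodd)
  rw [mul_assoc]
  push_cast
  omega

theorem exists_eq_zpow_mul_zpow {G : Type*} [Group G] {a u : G} [(Subgroup.zpowers a).Normal]
    (hu : ∀ q : G ⧸ Subgroup.zpowers a, q ∈ Subgroup.zpowers (u : G ⧸ Subgroup.zpowers a))
    (g : G) : ∃ r t : ℤ, g = a ^ r * u ^ t := by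
  obtain ⟨t, ht⟩ := Subgroup.mem_zpowers_iff.mp (hu g)
  have h1 : g * (u ^ t)⁻¹ ∈ Subgroup.zpowers a := by
    rw [← QuotientGroup.eq_one_iff, QuotientGroup.mk_mul, QuotientGroup.mk_inv,
      QuotientGroup.mk_zpow, ht, mul_inv_cancel]
  obtain ⟨r, hr⟩ := Subgroup.mem_zpowers_iff.mp h1
  exact ⟨r, t, by rw [hr, inv_mul_cancel_right]⟩

theorem IsPGroup.pow_two_pow_eq_one_of_disjoint {G : Type*} [Group G]
    (hG : IsPGroup 2 G) {a : G} [(Subgroup.zpowers a).Normal] {m : ℕ}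
    (hcard : Nat.card (G ⧸ Subgroup.zpowers a) = 2 ^ (m + 1)) {u y : G}
    (hgen : Subgroup.closure {u, y} = ⊤)
    (hu : ∀ q : G ⧸ Subgroup.zpowers a, q ∈ Subgroup.zpowers (u : G ⧸ Subgroup.zpowers a))
    (hdu : ∀ z ∈ Subgroup.zpowers u, z ∈ Subgroup.zpowers a → z = 1)
    (hdy : ∀ z ∈ Subgroup.zpowers y, z ∈ Subgroup.zpowers a → z = 1)
    (hduy : ∀ z ∈ Subgroup.zpowers (u * y), z ∈ Subgroup.zpowers a → z = 1) :
    a ^ 2 ^ m = 1 := by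
  have haN := Subgroup.mem_zpowers a
  have hu1 : u ^ 2 ^ (m + 1) = 1 := by
    refine hdu _ (pow_mem (Subgroup.mem_zpowers u) _) ?_
    rw [← QuotientGroup.eq_one_iff, QuotientGroup.mk_pow, ← hcard, pow_card_eq_one']
  have core : ∀ r s : ℤ, Odd r → (∀ z ∈ Subgroup.zpowers (a ^ r * u ^ (2 * s)),
      z ∈ Subgroup.zpowers a → z = 1) → a ^ 2 ^ m = 1 := by
    intro r s hr hd
    obtain ⟨e, ⟨k, rfl⟩, he⟩ := hG.exists_odd_forall_conj_eq_zpow a (u ^ s)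
    have hconj : u ^ (2 * s) * a * (u ^ (2 * s))⁻¹ = a ^ ((2 * k + 1) * (2 * k + 1)) := by
      rw [mul_comm 2 s, zpow_mul a, ← he a haN, ← he _ (Subgroup.Normal.conj_mem inferInstance a haN _)]
      group
    have hμ : ((2 * k + 1) * (2 * k + 1)) % 4 = 1 := by
      have : (2 * k + 1) * (2 * k + 1) = 4 * (k * k + k) + 1 := by ring
      omega
    obtain ⟨c, hc, hpow⟩ := exists_zpow_mul_pow_two_pow a (u ^ (2 * s)) _ r
      (Odd.mul ⟨k, rfl⟩ ⟨k, rfl⟩) hconj m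
    have hv : (u ^ (2 * s)) ^ 2 ^ m = 1 := by
      have : (u ^ (2 * s)) ^ 2 ^ m = (u ^ 2 ^ (m + 1)) ^ s := by
        rw [← zpow_natCast, ← zpow_natCast, ← zpow_mul, ← zpow_mul]
        congr 1
        push_cast
        ring
      rw [this, hu1, one_zpow]
    rw [hv, mul_one] at hpow
    have h1 := hd _ (pow_mem (Subgroup.mem_zpowers _) (2 ^ m)) (hpow ▸ zpow_mem haN _)
    have h2 : (a ^ 2 ^ m) ^ (r * c) = 1 := by
      rw [← h1, hpow, ← zpow_natCast, ← zpow_mul]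
      congr 1
      push_cast
      ring
    refine hG.eq_one_of_zpow_eq_one Nat.prime_two ?_ h2
    exact_mod_cast Int.two_dvd_ne_zero.mpr (Int.odd_iff.mp (hr.mul (hc hμ)))
  obtain ⟨r, t, hy⟩ := exists_eq_zpow_mul_zpow hu y
  by_cases ha : a = 1
  · rw [ha, one_pow]
  have hr : Odd r := by
    by_contra hr
    obtain ⟨n, hn⟩ := even_iff_two_dvd.mp (Int.not_odd_iff_even.mp hr)
    have hle : Subgroup.zpowers (a ^ (2 : ℤ)) ≤ Subgroup.zpowers a :=
      Subgroup.zpowers_le.mpr (zpow_mem haN _)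
    have hnorm : (Subgroup.zpowers (a ^ (2 : ℤ))).Normal := by
      refine ⟨fun d hd g => ?_⟩
      obtain ⟨e, he⟩ := Subgroup.exists_forall_conj_eq_zpow a g
      rw [he d (hle hd)]
      exact zpow_mem hd e
    have hK : Subgroup.closure {u, y} ≤ Subgroup.zpowers (a ^ (2 : ℤ)) ⊔ Subgroup.zpowers u := by
      rw [Subgroup.closure_le]
      rintro z (rfl | rfl)
      · exact Subgroup.mem_sup_right (Subgroup.mem_zpowers _)
      · rw [hy, hn, zpow_mul]
        exact mul_mem (Subgroup.mem_sup_left (zpow_mem (Subgroup.mem_zpowers _) _))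
          (Subgroup.mem_sup_right (zpow_mem (Subgroup.mem_zpowers _) _))
    obtain ⟨d, hd, w, hw, hdw⟩ := Subgroup.mem_sup_of_normal_left.mp (hK (hgen ▸ Subgroup.mem_top a))
    have hw1 : w = 1 := by
      refine hdu w hw ?_
      rw [← inv_mul_eq_of_eq_mul hdw.symm]
      exact mul_mem (inv_mem (hle hd)) haN
    obtain ⟨i, hi⟩ := Subgroup.mem_zpowers_iff.mp hd
    refine ha (hG.eq_one_of_zpow_eq_one Nat.prime_two (i := 1 - 2 * i) (by push_cast; omega) ?_)
    rw [zpow_sub, zpow_one, mul_inv_eq_one, zpow_mul, hi, ← hdw, hw1, mul_one]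
  rcases Int.even_or_odd' t with ⟨s, rfl | rfl⟩
  · exact core r s hr (hy ▸ hdy)
  · obtain ⟨e, heo, he⟩ := hG.exists_odd_forall_conj_eq_zpow a u
    refine core (r * e) (s + 1) (hr.mul heo) ?_
    have : u * y = a ^ (r * e) * u ^ (2 * (s + 1)) := by
      rw [zpow_mul, ← he _ (zpow_mem haN r), hy]
      group
    exact this ▸ hduy

theorem exists_generator_of_closure_pair {p : ℕ} (hp : p.Prime) {Q : Type*} [Group Q]
    (hQ : IsPGroup p Q) [IsCyclic Q] {x y : Q} (hxy : Subgroup.closure {x, y} = ⊤) :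
    ∃ u ∈ ({x, y} : Set Q), ∀ q, q ∈ Subgroup.zpowers u := by
  obtain ⟨b, hb⟩ := IsCyclic.exists_generator (α := Q)
  have hgen : ∀ i : ℤ, ¬ (p : ℤ) ∣ i → ∀ q, q ∈ Subgroup.zpowers (b ^ i) := fun i hi q =>
    Subgroup.zpowers_le.mpr (hQ.mem_zpowers_zpow hp b hi) (hb q)
  obtain ⟨i, rfl⟩ := Subgroup.mem_zpowers_iff.mp (hb x)
  obtain ⟨j, rfl⟩ := Subgroup.mem_zpowers_iff.mp (hb y)
  by_cases hi : (p : ℤ) ∣ i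
  · by_cases hj : (p : ℤ) ∣ j
    · have hle : Subgroup.closure {b ^ i, b ^ j} ≤ Subgroup.zpowers (b ^ (p : ℤ)) := by
        rw [Subgroup.closure_le]
        obtain ⟨i, rfl⟩ := hi
        obtain ⟨j, rfl⟩ := hj
        rintro z (rfl | rfl) <;> rw [zpow_mul] <;> exact zpow_mem (Subgroup.mem_zpowers _) _
      obtain ⟨k, hk⟩ := Subgroup.mem_zpowers_iff.mp (hle (hxy ▸ Subgroup.mem_top b))
      have hb1 : b = 1 := by
        refine hQ.eq_one_of_zpow_eq_one hp (i := 1 - p * k) (fun hd => ?_)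
          (by rw [zpow_sub, zpow_one, mul_inv_eq_one, zpow_mul, hk])
        have := dvd_add hd (dvd_mul_right (p : ℤ) k)
        rw [sub_add_cancel] at this
        exact (Nat.prime_iff_prime_int.mp hp).not_dvd_one this
      refine ⟨b ^ i, by simp, fun q => ?_⟩
      have := hb q
      rw [hb1, Subgroup.zpowers_one_eq_bot, Subgroup.mem_bot] at this
      exact this ▸ one_mem _
    · exact ⟨b ^ j, by simp, hgen j hj⟩
  · exact ⟨b ^ i, by simp, hgen i hi⟩

theorem zpowers_subset_beauvilleSigma {G : Type*} [Group G] {x y g : G}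
    (hg : g = x ∨ g = y ∨ g = x * y) :
    (Subgroup.zpowers g : Set G) ⊆ beauvilleSigma x y := by
  intro z hz
  refine Set.mem_iUnion.mpr ⟨1, ?_⟩
  rcases hg with rfl | rfl | rfl
  · exact Or.inl (Or.inl ⟨z, hz, by simp⟩)
  · exact Or.inl (Or.inr ⟨z, hz, by simp⟩)
  · exact Or.inr ⟨z, hz, by simp⟩

/-- A non-abelian metacyclic `2`-group has no Beauville structure. -/
theorem IsPGroup.not_isBeauvilleStructure_of_two {G : Type*} [Group G] [Finite G]
    (hG : IsPGroup 2 G) (hna : ∃ a b : G, a * b ≠ b * a) (a : G) [(Subgroup.zpowers a).Normal]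
    [IsCyclic (G ⧸ Subgroup.zpowers a)] (x₁ y₁ x₂ y₂ : G) :
    ¬ IsBeauvilleStructure x₁ y₁ x₂ y₂ := by
  rintro ⟨hgen₁, hgen₂, hσ⟩
  have hQ : IsPGroup 2 (G ⧸ Subgroup.zpowers a) := hG.to_quotient _
  have : Fact (Nat.Prime 2) := ⟨Nat.prime_two⟩
  obtain ⟨n, hn⟩ := IsPGroup.iff_card.mp hQ
  obtain ⟨m, rfl⟩ : ∃ m, n = m + 1 := by
    refine Nat.exists_eq_add_one_of_ne_zero ?_
    rintro rfl
    obtain ⟨g, h, hgh⟩ := hna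
    have htop : Subgroup.zpowers a = ⊤ := Subgroup.index_eq_one.mp hn
    obtain ⟨i, rfl⟩ := Subgroup.mem_zpowers_iff.mp (htop ▸ Subgroup.mem_top g)
    obtain ⟨j, rfl⟩ := Subgroup.mem_zpowers_iff.mp (htop ▸ Subgroup.mem_top h)
    exact hgh (by rw [← zpow_add, ← zpow_add, add_comm])
  have hgenQ : ∀ x y : G, Subgroup.closure {x, y} = ⊤ → ∃ u ∈ ({x, y} : Set G),
      ∀ q, q ∈ Subgroup.zpowers (u : G ⧸ Subgroup.zpowers a) := by
    intro x y hxy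
    have hmap : Subgroup.closure {(x : G ⧸ Subgroup.zpowers a), (y : G ⧸ Subgroup.zpowers a)}
        = ⊤ := by
      have := congrArg (Subgroup.map (QuotientGroup.mk' (Subgroup.zpowers a))) hxy
      rwa [MonoidHom.map_closure, Set.image_pair,
        Subgroup.map_top_of_surjective _ (QuotientGroup.mk'_surjective _)] at this
    obtain ⟨u, rfl | rfl, hu⟩ := exists_generator_of_closure_pair Nat.prime_two hQ hmap
    · exact ⟨x, by simp, hu⟩
    · exact ⟨y, by simp, hu⟩
  have key : ∀ x y x' y' : G, Subgroup.closure {x, y} = ⊤ → Subgroup.closure {x', y'} = ⊤ →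
      beauvilleSigma x y ∩ beauvilleSigma x' y' = {1} →
      ¬ ∀ g, (g = x ∨ g = y ∨ g = x * y) →
        ∀ z ∈ Subgroup.zpowers g, z ∈ Subgroup.zpowers a → z = 1 := by
    intro x y x' y' hxy hxy' hσ hd
    obtain ⟨u, huxy, hu, ham⟩ : ∃ u ∈ ({x, y} : Set G),
        (∀ q, q ∈ Subgroup.zpowers (u : G ⧸ Subgroup.zpowers a)) ∧ a ^ 2 ^ m = 1 := by
      obtain ⟨u, huxy, hu⟩ := hgenQ x y hxy
      refine ⟨u, huxy, hu, ?_⟩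
      rcases huxy with rfl | rfl
      · exact hG.pow_two_pow_eq_one_of_disjoint hn hxy hu (hd _ (by simp)) (hd _ (by simp))
          (hd _ (by simp))
      · refine hG.pow_two_pow_eq_one_of_disjoint hn (Set.pair_comm x u ▸ hxy) hu
          (hd _ (by simp)) (hd _ (by simp)) fun z hz hza => ?_
        obtain ⟨i, rfl⟩ := Subgroup.mem_zpowers_iff.mp hz
        have hconj : (u * x) ^ i = u * (x * u) ^ i * u⁻¹ := by
          rw [← conj_zpow]; group
        rw [hconj] at hza ⊢
        have := hd (x * u) (by simp) ((x * u) ^ i) (zpow_mem (Subgroup.mem_zpowers _) i)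
          (by simpa [mul_assoc] using
            Subgroup.Normal.conj_mem (inferInstance : (Subgroup.zpowers a).Normal) _ hza u⁻¹)
        rw [this, mul_one, mul_inv_cancel]
    obtain ⟨v, hvxy, hv⟩ := hgenQ x' y' hxy'
    obtain ⟨j, t, hvt⟩ := exists_eq_zpow_mul_zpow hu v
    obtain ⟨e, heo, he⟩ := hG.exists_odd_forall_conj_eq_zpow a (u ^ t)
    obtain ⟨c, -, hc⟩ := exists_zpow_mul_pow_two_pow a (u ^ t) e j heo
      (he a (Subgroup.mem_zpowers a)) m
    have hac : a ^ (j * 2 ^ m * c) = 1 := by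
      have : a ^ (j * 2 ^ m * c) = (a ^ 2 ^ m) ^ (j * c) := by
        rw [← zpow_natCast, ← zpow_mul]
        congr 1
        push_cast
        ring
      rw [this, ham, one_zpow]
    rw [← hvt, hac, one_mul] at hc
    have hmem : v ^ 2 ^ m ∈ beauvilleSigma x y ∩ beauvilleSigma x' y' := by
      refine ⟨zpowers_subset_beauvilleSigma (g := u) ?_ ?_,
        zpowers_subset_beauvilleSigma (g := v) ?_ (pow_mem (Subgroup.mem_zpowers v) _)⟩
      · rcases huxy with rfl | rfl <;> simp
      · rw [hc]
        exact pow_mem (zpow_mem (Subgroup.mem_zpowers u) t) _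
      · rcases hvxy with rfl | rfl <;> simp
    rw [hσ, Set.mem_singleton_iff] at hmem
    have hdvd : Nat.card (G ⧸ Subgroup.zpowers a) ∣ 2 ^ m := by
      rw [← orderOf_eq_card_of_forall_mem_zpowers hv]
      exact orderOf_dvd_of_pow_eq_one (by rw [← QuotientGroup.mk_pow, hmem, QuotientGroup.mk_one])
    rw [hn, Nat.pow_dvd_pow_iff_le_right (by norm_num)] at hdvd
    omega
  have h₁ := key x₁ y₁ x₂ y₂ hgen₁ hgen₂ hσ
  have h₂ := key x₂ y₂ x₁ y₁ hgen₂ hgen₁ (Set.inter_comm _ _ ▸ hσ)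
  push Not at h₁ h₂
  obtain ⟨g, hg, w, hwg, hwa, hw1⟩ := h₁
  obtain ⟨g', hg', w', hwg', hwa', hw1'⟩ := h₂
  obtain ⟨z, hz1, hzw, hzw'⟩ := hG.exists_ne_one_mem_zpowers Nat.prime_two hwa hwa' hw1 hw1'
  have hz : z ∈ beauvilleSigma x₁ y₁ ∩ beauvilleSigma x₂ y₂ :=
    ⟨zpowers_subset_beauvilleSigma hg (Subgroup.zpowers_le.mpr hwg hzw),
      zpowers_subset_beauvilleSigma hg' (Subgroup.zpowers_le.mpr hwg' hzw')⟩
  rw [hσ] at hz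
  exact hz1 hz

/-- A non-abelian metacyclic Beauville `p`-group is a purely
non-strongly real Beauville group: none of its Beauville structures is strongly real. -/
theorem stmt10 (p : ℕ) (hp : p.Prime)
    (G : Type*) [Group G] [Finite G] (hpG : IsPGroup p G)
    (hna : ∃ a b : G, a * b ≠ b * a) (hmc : IsMetacyclic G)
    (hB : IsBeauvilleGroup G) :
    ∀ x₁ y₁ x₂ y₂ : G, IsBeauvilleStructure x₁ y₁ x₂ y₂ →
      ¬ IsStronglyRealStructure x₁ y₁ x₂ y₂ := by
  rintro x₁ y₁ x₂ y₂ hS ⟨θ, g₁, -, hx, hy, -, -⟩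
  obtain ⟨N, hcyc, hN, hQ⟩ := hmc
  obtain ⟨a, rfl⟩ := (Subgroup.isCyclic_iff_exists_zpowers_eq_top N).mp hcyc
  by_cases hp2 : p = 2
  · subst hp2
    exact hpG.not_isBeauvilleStructure_of_two hna a x₁ y₁ x₂ y₂ hS
  · obtain ⟨g, h, hgh⟩ := hna
    exact hgh (hpG.mul_comm_of_inverting_mulEquiv hp hp2 a hS.1 (θ.trans (MulAut.conj g₁))
      hx hy g h)
end

section
/- There exist infinitely many nilpotent purely non-strongly real Beauville groups; that is, for every natural number N there exists a finite nilpotent group G of order greater than N which is a Beauville group and none of whose Beauville structures is strongly real. -/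
/-- The underlying set of the group `F ⋉ H`, where `H` has coordinates `(b, c, d, e)`. -/
@[ext]
structure CubicGroup (F : Type*) where
  a : F
  b : F
  c : F
  d : F
  e : F

namespace CubicGroup

open scoped commutatorElement

section CommRing

variable {F : Type*} [CommRing F]

/-- `a` acts on `(b, c, d, e)` by translation of binary cubics, and `H` is the central
extension of `F⁴` defined by the cocycle `b * c' - c * b'`. -/
instance : Mul (CubicGroup F) where
  mul g h :=
    ⟨g.a + h.a, g.b + h.b, g.c + (h.c + g.a * h.b),
      g.d + (h.d + 2 * g.a * h.c + g.a ^ 2 * h.b),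
      g.e + (h.e + 3 * g.a * h.d + 3 * g.a ^ 2 * h.c + g.a ^ 3 * h.b)
        + (g.b * (h.c + g.a * h.b) - g.c * h.b)⟩

instance : One (CubicGroup F) where
  one := ⟨0, 0, 0, 0, 0⟩

instance : Inv (CubicGroup F) where
  inv g :=
    ⟨-g.a, -g.b, -g.c + g.a * g.b,
      -g.d + 2 * g.a * g.c - g.a ^ 2 * g.b,
      -g.e + 3 * g.a * g.d - 3 * g.a ^ 2 * g.c + g.a ^ 3 * g.b⟩

theorem mul_def (g h : CubicGroup F) : g * h =
    ⟨g.a + h.a, g.b + h.b, g.c + (h.c + g.a * h.b),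
      g.d + (h.d + 2 * g.a * h.c + g.a ^ 2 * h.b),
      g.e + (h.e + 3 * g.a * h.d + 3 * g.a ^ 2 * h.c + g.a ^ 3 * h.b)
        + (g.b * (h.c + g.a * h.b) - g.c * h.b)⟩ := rfl

theorem one_def : (1 : CubicGroup F) = ⟨0, 0, 0, 0, 0⟩ := rfl

theorem inv_def (g : CubicGroup F) : g⁻¹ =
    ⟨-g.a, -g.b, -g.c + g.a * g.b,
      -g.d + 2 * g.a * g.c - g.a ^ 2 * g.b,
      -g.e + 3 * g.a * g.d - 3 * g.a ^ 2 * g.c + g.a ^ 3 * g.b⟩ := rfl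

instance : Group (CubicGroup F) :=
  Group.ofLeftAxioms
    (fun g h k => by ext <;> simp only [mul_def] <;> ring)
    (fun g => by ext <;> simp only [mul_def, one_def] <;> ring)
    (fun g => by ext <;> simp only [mul_def, one_def, inv_def] <;> ring)

/-- The projection to the Frattini quotient, with coordinates `a` and `b`. -/
def proj : CubicGroup F →* Multiplicative (F × F) where
  toFun g := Multiplicative.ofAdd (g.a, g.b)
  map_one' := rfl
  map_mul' _ _ := rfl

theorem a_conj_zpow (g w : CubicGroup F) (i : ℤ) : (g⁻¹ * w ^ i * g).a = i * w.a := by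
  have h : proj (g⁻¹ * w ^ i * g) = proj w ^ i := by
    rw [map_mul, map_mul, map_inv, map_zpow, mul_right_comm, inv_mul_cancel, one_mul]
  simpa [proj] using congrArg (fun z => z.toAdd.1) h

theorem b_conj_zpow (g w : CubicGroup F) (i : ℤ) : (g⁻¹ * w ^ i * g).b = i * w.b := by
  have h : proj (g⁻¹ * w ^ i * g) = proj w ^ i := by
    rw [map_mul, map_mul, map_inv, map_zpow, mul_right_comm, inv_mul_cancel, one_mul]
  simpa [proj] using congrArg (fun z => z.toAdd.2) h

theorem pow_coords (g : CubicGroup F) (n : ℕ) :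
    (g ^ n).a = n * g.a ∧ (g ^ n).b = n * g.b ∧
      2 * (g ^ n).c = n * (2 * g.c + g.a * g.b * (n - 1)) ∧
      6 * (g ^ n).d =
        n * (6 * g.d + 6 * g.a * g.c * (n - 1) + g.a ^ 2 * g.b * (n - 1) * (2 * n - 1)) ∧
      12 * (g ^ n).e =
        n * (12 * g.e + 18 * g.a * g.d * (n - 1)
          + 6 * g.a ^ 2 * g.c * (n - 1) * (2 * n - 1)
          + 3 * g.a ^ 3 * g.b * n * (n - 1) ^ 2
          + 2 * g.a * g.b ^ 2 * (n - 1) * (n + 1)) := by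
  induction n with
  | zero => simp [one_def]
  | succ n ih =>
    obtain ⟨ha, hb, hc, hd, he⟩ := ih
    simp only [pow_succ, mul_def, ha, hb]
    push_cast
    refine ⟨by ring, by ring, ?_, ?_, ?_⟩
    · linear_combination hc
    · linear_combination hd
    · linear_combination he - 6 * g.b * hc

theorem commutator_c (P Q : CubicGroup F) (hP : P.b = 0) (hQ : Q.a = 0) :
    ⁅P, Q⁆.a = 0 ∧ ⁅P, Q⁆.b = 0 ∧ ⁅P, Q⁆.c = P.a * Q.b := by
  simp only [commutatorElement_def, mul_def, inv_def, hP, hQ]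
  refine ⟨?_, ?_, ?_⟩ <;> ring

theorem commutator_d (P Q : CubicGroup F) (hP : P.b = 0) (ha : Q.a = 0) (hb : Q.b = 0) :
    ⁅P, Q⁆.a = 0 ∧ ⁅P, Q⁆.b = 0 ∧ ⁅P, Q⁆.c = 0 ∧ ⁅P, Q⁆.d = 2 * P.a * Q.c := by
  simp only [commutatorElement_def, mul_def, inv_def, hP, ha, hb]
  refine ⟨?_, ?_, ?_, ?_⟩ <;> ring

theorem commutator_e (P Q : CubicGroup F) (hP : P.b = 0) (ha : Q.a = 0) (hb : Q.b = 0)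
    (hc : Q.c = 0) : ⁅P, Q⁆ = ⟨0, 0, 0, 0, 3 * P.a * Q.d⟩ := by
  ext <;> simp only [commutatorElement_def, mul_def, inv_def, hP, ha, hb, hc] <;> ring

theorem commutator_e' (P Q : CubicGroup F) (hP : P.a = 0) (ha : Q.a = 0) (hb : Q.b = 0) :
    ⁅P, Q⁆ = ⟨0, 0, 0, 0, 2 * P.b * Q.c⟩ := by
  ext <;> simp only [commutatorElement_def, mul_def, inv_def, hP, ha, hb] <;> ring

theorem quadruple_commutator (P Q : CubicGroup F) (hP : P.b = 0) (hQ : Q.a = 0) :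
    ⁅P, ⁅P, ⁅P, Q⁆⁆⁆ = ⟨0, 0, 0, 0, 6 * P.a ^ 3 * Q.b⟩ := by
  obtain ⟨h₁, h₂, h₃⟩ := commutator_c P Q hP hQ
  obtain ⟨k₁, k₂, k₃, k₄⟩ := commutator_d P _ hP h₁ h₂
  rw [commutator_e P _ hP k₁ k₂ k₃, k₄, h₃]
  ext <;> ring

theorem triple_commutator (P Q : CubicGroup F) (hP : P.b = 0) (hQ : Q.a = 0) :
    ⁅Q, ⁅P, Q⁆⁆ = ⟨0, 0, 0, 0, 2 * P.a * Q.b ^ 2⟩ := by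
  obtain ⟨h₁, h₂, h₃⟩ := commutator_c P Q hP hQ
  rw [commutator_e' Q _ hQ h₁ h₂, h₃]
  ext <;> ring

/-- `⁅P, ⁅P, ⁅P, Q⁆⁆⁆ = ⁅Q, ⁅P, Q⁆⁆ ^ 3` holds for the standard generators `P`, `Q`, but the two
sides have opposite signs after inverting `P` and `Q` modulo the Frattini subgroup. -/
theorem not_inverts_generators (h12 : (12 : F) ≠ 0) {x y : CubicGroup F}
    (hxy : Subgroup.closure {x, y} = ⊤) (ψ : CubicGroup F →* CubicGroup F)
    (hx : ψ x = x⁻¹) (hy : ψ y = y⁻¹) : False := by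
  have key : ∀ g, (ψ g).a = -g.a ∧ (ψ g).b = -g.b := by
    intro g
    have hg : g ∈ Subgroup.closure {x, y} := hxy ▸ Subgroup.mem_top g
    induction hg using Subgroup.closure_induction with
    | mem z hz =>
      rcases hz with rfl | rfl
      · rw [hx]; exact ⟨rfl, rfl⟩
      · rw [hy]; exact ⟨rfl, rfl⟩
    | one => rw [map_one]; simp [one_def]
    | mul u v _ _ hu hv =>
      rw [map_mul]
      simp only [mul_def, hu.1, hu.2, hv.1, hv.2]
      exact ⟨by ring, by ring⟩
    | inv u _ hu =>
      rw [map_inv]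
      simp only [inv_def, hu.1, hu.2, and_self]
  set P : CubicGroup F := ⟨1, 0, 0, 0, 0⟩ with hP
  set Q : CubicGroup F := ⟨0, 1, 0, 0, 0⟩ with hQ
  have rel : ⁅P, ⁅P, ⁅P, Q⁆⁆⁆ = ⁅Q, ⁅P, Q⁆⁆ * ⁅Q, ⁅P, Q⁆⁆ * ⁅Q, ⁅P, Q⁆⁆ := by
    rw [quadruple_commutator P Q rfl rfl, triple_commutator P Q rfl rfl]
    ext <;> simp only [mul_def, hP, hQ] <;> ring
  have rel' := congrArg ψ rel
  simp only [map_mul, map_commutatorElement] at rel'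
  have hPb : (ψ P).b = 0 := by rw [(key P).2, hP, neg_zero]
  have hQa : (ψ Q).a = 0 := by rw [(key Q).1, hQ, neg_zero]
  rw [quadruple_commutator _ _ hPb hQa, triple_commutator _ _ hPb hQa,
    (key P).1, (key Q).2] at rel'
  have he := congrArg CubicGroup.e rel'
  simp only [mul_def, hP, hQ] at he
  exact h12 (by linear_combination he)

theorem not_isStronglyRealStructure (h12 : (12 : F) ≠ 0) {x₁ y₁ x₂ y₂ : CubicGroup F}
    (h : Subgroup.closure {x₁, y₁} = ⊤) : ¬ IsStronglyRealStructure x₁ y₁ x₂ y₂ := by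
  rintro ⟨θ, g, -, hx, hy, -, -⟩
  exact not_inverts_generators h12 h ((MulAut.conj g).toMonoidHom.comp θ.toMonoidHom)
    (by simpa using hx) (by simpa using hy)

/-- The coordinates as an equivalence with a product. -/
def equivProd : CubicGroup F ≃ F × F × F × F × F where
  toFun g := (g.a, g.b, g.c, g.d, g.e)
  invFun t := ⟨t.1, t.2.1, t.2.2.1, t.2.2.2.1, t.2.2.2.2⟩
  left_inv _ := rfl
  right_inv _ := rfl

instance [Finite F] : Finite (CubicGroup F) := Finite.of_equiv _ equivProd.symm

theorem card_le [Finite F] : Nat.card F ≤ Nat.card (CubicGroup F) :=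
  Nat.card_le_card_of_injective (fun t : F => (⟨t, 0, 0, 0, 0⟩ : CubicGroup F))
    fun _ _ h => congrArg CubicGroup.a h

end CommRing

section ZMod

variable {p : ℕ} [Fact p.Prime]

theorem natCast_ne_zero_of_coprime {n : ℕ} (h : p.Coprime n) : (n : ZMod p) ≠ 0 := fun h0 =>
  (Fact.out : p.Prime).one_lt.ne'
    (Nat.Coprime.eq_one_of_dvd h ((ZMod.natCast_eq_zero_iff n p).mp h0))

theorem two_three_ne_zero (hp : 5 ≤ p) : (2 : ZMod p) ≠ 0 ∧ (3 : ZMod p) ≠ 0 := by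
  have hp' : p.Prime := Fact.out
  have h2 : p.Coprime 2 := (Nat.coprime_primes hp' Nat.prime_two).mpr (by omega)
  have h3 : p.Coprime 3 := (Nat.coprime_primes hp' Nat.prime_three).mpr (by omega)
  exact ⟨mod_cast natCast_ne_zero_of_coprime h2, mod_cast natCast_ne_zero_of_coprime h3⟩

theorem pow_prime_eq_one (hp : 5 ≤ p) (g : CubicGroup (ZMod p)) : g ^ p = 1 := by
  obtain ⟨h2, h3⟩ := two_three_ne_zero hp
  obtain ⟨ha, hb, hc, hd, he⟩ := pow_coords g p
  rw [CharP.cast_eq_zero, zero_mul] at ha hb hc hd he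
  have h6 : (6 : ZMod p) ≠ 0 := by
    rw [show (6 : ZMod p) = 2 * 3 by norm_num]; exact mul_ne_zero h2 h3
  have h12 : (12 : ZMod p) ≠ 0 := by
    rw [show (12 : ZMod p) = 2 * 6 by norm_num]; exact mul_ne_zero h2 h6
  ext
  · exact ha
  · exact hb
  · exact (mul_eq_zero.mp hc).resolve_left h2
  · exact (mul_eq_zero.mp hd).resolve_left h6
  · exact (mul_eq_zero.mp he).resolve_left h12

theorem isNilpotent (hp : 5 ≤ p) : Group.IsNilpotent (CubicGroup (ZMod p)) :=
  IsPGroup.isNilpotent (p := p) fun g => ⟨1, by rw [pow_one, pow_prime_eq_one hp]⟩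

theorem pow_eq_mk_a (n : ℕ) :
    (⟨1, 0, 0, 0, 0⟩ : CubicGroup (ZMod p)) ^ n = ⟨n, 0, 0, 0, 0⟩ := by
  induction n with
  | zero => simp [one_def]
  | succ n ih => rw [pow_succ, ih]; ext <;> simp [mul_def]

theorem pow_eq_mk_b (t : ZMod p) (n : ℕ) :
    (⟨0, t, 0, 0, 0⟩ : CubicGroup (ZMod p)) ^ n = ⟨0, n * t, 0, 0, 0⟩ := by
  induction n with
  | zero => simp [one_def]
  | succ n ih => rw [pow_succ, ih]; ext <;> simp [mul_def]; ring

theorem pow_eq_mk_e (t : ZMod p) (n : ℕ) :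
    (⟨0, 0, 0, 0, t⟩ : CubicGroup (ZMod p)) ^ n = ⟨0, 0, 0, 0, n * t⟩ := by
  induction n with
  | zero => simp [one_def]
  | succ n ih => rw [pow_succ, ih]; ext <;> simp [mul_def]; ring

/-- A subgroup containing `(1, 0, 0, 0, 0)` and a nonzero `(0, t, 0, 0, 0)` is everything. -/
theorem eq_top_of_mem (hp : 5 ≤ p) (H : Subgroup (CubicGroup (ZMod p)))
    (hx : ⟨1, 0, 0, 0, 0⟩ ∈ H) {t : ZMod p} (ht : t ≠ 0) (hy : ⟨0, t, 0, 0, 0⟩ ∈ H) :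
    H = ⊤ := by
  obtain ⟨h2, -⟩ := two_three_ne_zero hp
  have hA : ∀ s : ZMod p, ⟨s, 0, 0, 0, 0⟩ ∈ H := fun s => by
    simpa [pow_eq_mk_a] using H.pow_mem hx s.val
  have hB : ∀ s : ZMod p, ⟨0, s, 0, 0, 0⟩ ∈ H := fun s => by
    simpa [pow_eq_mk_b, ht] using H.pow_mem hy (s / t).val
  have hC : ∀ r s : ZMod p, ⟨0, 0, r * s, r ^ 2 * s, r ^ 3 * s - r * s ^ 2⟩ ∈ H := fun r s => by
    convert H.mul_mem (hB (-s)) (H.mul_mem (H.mul_mem (hA r) (hB s)) (hA (-r))) using 1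
    ext <;> simp only [mul_def] <;> ring
  have hD : ∀ s : ZMod p, ⟨0, 0, 0, s, 0⟩ ∈ H := fun s => by
    convert H.mul_mem (hC 1 (s / 2)) (hC (-1) (s / 2)) using 1
    ext <;> simp only [mul_def] <;> field_simp <;> ring
  have hE : ∀ s : ZMod p, ⟨0, 0, 0, 0, s⟩ ∈ H := fun s => by
    have h : (⟨0, 0, 0, 0, -2⟩ : CubicGroup (ZMod p)) ∈ H := by
      convert H.mul_mem (hC 1 1) (hC 1 (-1)) using 1
      ext <;> simp only [mul_def] <;> ring
    have := H.pow_mem h (s / -2).val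
    rwa [pow_eq_mk_e, ZMod.natCast_val, ZMod.cast_id,
      div_mul_cancel₀ _ (neg_ne_zero.mpr h2)] at this
  rw [Subgroup.eq_top_iff']
  intro g
  have hC' : ∀ s : ZMod p, ⟨0, 0, s, 0, 0⟩ ∈ H := fun s => by
    convert H.mul_mem (H.mul_mem (hC 1 s) (hD (-s))) (hE (s ^ 2 - s)) using 1
    ext <;> simp only [mul_def] <;> ring
  convert H.mul_mem (H.mul_mem (H.mul_mem (H.mul_mem (hE (g.e - g.b * g.c)) (hD g.d)) (hB g.b))
    (hC' g.c)) (hA g.a) using 1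
  ext <;> simp only [mul_def] <;> ring

theorem exists_of_mem_beauvilleSigma {G : Type*} [Group G] {x y z : G}
    (hz : z ∈ beauvilleSigma x y) :
    ∃ w, (w = x ∨ w = y ∨ w = x * y) ∧ ∃ (g : G) (i : ℤ), z = g⁻¹ * w ^ i * g := by
  simp only [beauvilleSigma, Set.mem_iUnion] at hz
  obtain ⟨g, (⟨_, ⟨i, rfl⟩, rfl⟩ | ⟨_, ⟨i, rfl⟩, rfl⟩) | ⟨_, ⟨i, rfl⟩, rfl⟩⟩ := hz
  exacts [⟨x, .inl rfl, g, i, rfl⟩, ⟨y, .inr (.inl rfl), g, i, rfl⟩,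
    ⟨x * y, .inr (.inr rfl), g, i, rfl⟩]

theorem one_mem_beauvilleSigma {G : Type*} [Group G] (x y : G) : 1 ∈ beauvilleSigma x y :=
  Set.mem_iUnion.mpr ⟨1, .inl (.inl ⟨1, Subgroup.one_mem _, by simp⟩)⟩

theorem conj_zpow_eq_one (hp : 5 ≤ p) {w w' g g' : CubicGroup (ZMod p)} {i j : ℤ}
    (hdet : w.a * w'.b - w.b * w'.a ≠ 0) (h : g⁻¹ * w ^ i * g = g'⁻¹ * w' ^ j * g') :
    g⁻¹ * w ^ i * g = 1 := by
  have ha := congrArg CubicGroup.a h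
  have hb := congrArg CubicGroup.b h
  rw [a_conj_zpow, a_conj_zpow] at ha
  rw [b_conj_zpow, b_conj_zpow] at hb
  have hi : (i : ZMod p) * (w.a * w'.b - w.b * w'.a) = 0 := by
    linear_combination w'.b * ha - w'.a * hb
  obtain ⟨k, rfl⟩ := (ZMod.intCast_zmod_eq_zero_iff_dvd i p).mp
    ((mul_eq_zero.mp hi).resolve_right hdet)
  rw [zpow_mul, zpow_natCast, pow_prime_eq_one hp, one_zpow, mul_one, inv_mul_cancel]

theorem isBeauvilleGroup (hp : 5 ≤ p) : IsBeauvilleGroup (CubicGroup (ZMod p)) := by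
  obtain ⟨h2, h3⟩ := two_three_ne_zero hp
  refine ⟨⟨1, 0, 0, 0, 0⟩, ⟨0, 1, 0, 0, 0⟩, ⟨1, 0, 0, 0, 0⟩ * ⟨0, 2, 0, 0, 0⟩,
    ⟨1, 0, 0, 0, 0⟩ * ⟨0, -1, 0, 0, 0⟩, ?_, ?_, ?_⟩
  · exact eq_top_of_mem hp _ (Subgroup.subset_closure (by simp)) one_ne_zero
      (Subgroup.subset_closure (by simp))
  · set H := Subgroup.closure {(⟨1, 0, 0, 0, 0⟩ * ⟨0, 2, 0, 0, 0⟩ : CubicGroup (ZMod p)),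
      ⟨1, 0, 0, 0, 0⟩ * ⟨0, -1, 0, 0, 0⟩}
    have hx : (⟨1, 0, 0, 0, 0⟩ * ⟨0, 2, 0, 0, 0⟩ : CubicGroup (ZMod p)) ∈ H :=
      Subgroup.subset_closure (by simp)
    have hy : (⟨1, 0, 0, 0, 0⟩ * ⟨0, -1, 0, 0, 0⟩ : CubicGroup (ZMod p)) ∈ H :=
      Subgroup.subset_closure (by simp)
    have h : (⟨0, 3, 0, 0, 0⟩ : CubicGroup (ZMod p)) ∈ H := by
      convert H.mul_mem (H.inv_mem hy) hx using 1
      ext <;> simp only [mul_def, inv_def] <;> ring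
    have h₁ : (⟨0, 1, 0, 0, 0⟩ : CubicGroup (ZMod p)) ∈ H := by
      have := H.pow_mem h (1 / 3 : ZMod p).val
      rwa [pow_eq_mk_b, ZMod.natCast_val, ZMod.cast_id, div_mul_cancel₀ _ h3] at this
    refine eq_top_of_mem hp H ?_ one_ne_zero h₁
    convert H.mul_mem hy h₁ using 1
    ext <;> simp only [mul_def] <;> ring
  · refine Set.eq_singleton_iff_unique_mem.mpr
      ⟨⟨one_mem_beauvilleSigma _ _, one_mem_beauvilleSigma _ _⟩, ?_⟩
    rintro z ⟨hz, hz'⟩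
    obtain ⟨w, hw, g, i, rfl⟩ := exists_of_mem_beauvilleSigma hz
    obtain ⟨w', hw', g', j, h⟩ := exists_of_mem_beauvilleSigma hz'
    refine conj_zpow_eq_one hp ?_ h
    rcases hw with rfl | rfl | rfl <;> rcases hw' with rfl | rfl | rfl <;>
      simp only [mul_def] <;> ring_nf <;> simp [h2]

end ZMod

end CubicGroup

/-- There exist infinitely many nilpotent purely non-strongly real
Beauville groups: for every `N` there is a finite nilpotent Beauville group of order
greater than `N` none of whose Beauville structures is strongly real. -/
theorem stmt12 (N : ℕ) :
    ∃ (G : Type) (inst : Group G),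
      Finite G ∧ @Group.IsNilpotent G inst ∧ N < Nat.card G ∧
      @IsBeauvilleGroup G inst ∧
      ∀ x₁ y₁ x₂ y₂ : G, @IsBeauvilleStructure G inst x₁ y₁ x₂ y₂ →
        ¬ @IsStronglyRealStructure G inst x₁ y₁ x₂ y₂ := by
  obtain ⟨p, hNp, hp⟩ := Nat.exists_infinite_primes (N + 5)
  have : Fact p.Prime := ⟨hp⟩
  have hp5 : 5 ≤ p := by omega
  obtain ⟨h2, h3⟩ := CubicGroup.two_three_ne_zero hp5
  refine ⟨CubicGroup (ZMod p), inferInstance, inferInstance, CubicGroup.isNilpotent hp5, ?_,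
    CubicGroup.isBeauvilleGroup hp5, fun x₁ y₁ x₂ y₂ h =>
      CubicGroup.not_isStronglyRealStructure ?_ h.1⟩
  · have := CubicGroup.card_le (F := ZMod p)
    rw [Nat.card_zmod] at this
    omega
  · rw [show (12 : ZMod p) = 2 * 2 * 3 by norm_num]
    exact mul_ne_zero (mul_ne_zero h2 h2) h3
end

section
/- Let G be a group, let x, y ∈ G, and let θ be an automorphism of G. Then the following are equivalent: (i) there exists g ∈ G such that θ(x) = g⁻¹x⁻¹g and θ(y) = g⁻¹y⁻¹g; (ii) for a = xy and for b equal to either x or y, there exists h ∈ G such that θ(a) = h⁻¹a⁻¹h and θ(b) = h⁻¹b⁻¹h. -/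
/-- For a group `G`, `x, y ∈ G` and an automorphism `θ` of `G`,
the following are equivalent: (i) there is `g ∈ G` with `θ(x) = (x⁻¹)^g` and
`θ(y) = (y⁻¹)^g`; (ii) for `a = xy` and each `b ∈ {x, y}`, there is `h ∈ G` with
`θ(a) = (a⁻¹)^h` and `θ(b) = (b⁻¹)^h`. -/
theorem stmt13 (G : Type*) [Group G] (x y : G) (θ : G ≃* G) :
    (∃ g : G, θ x = g⁻¹ * x⁻¹ * g ∧ θ y = g⁻¹ * y⁻¹ * g) ↔
      (∀ b ∈ ({x, y} : Set G), ∃ h : G,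
        θ (x * y) = h⁻¹ * (x * y)⁻¹ * h ∧ θ b = h⁻¹ * b⁻¹ * h) := by
  constructor
  · rintro ⟨g, hx, hy⟩ b (rfl | rfl)
    · refine ⟨b * g, ?_, ?_⟩
      · rw [map_mul, hx, hy]
        group
      · rw [hx]
        group
    · refine ⟨b⁻¹ * g, ?_, ?_⟩
      · rw [map_mul, hx, hy]
        group
      · rw [hy]
        group
  · intro H
    obtain ⟨h, hxy, hx⟩ := H x (Set.mem_insert x {y})
    refine ⟨x⁻¹ * h, ?_, ?_⟩
    · rw [hx]
      group
    · have hy : θ y = (θ x)⁻¹ * θ (x * y) := by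
        rw [map_mul, inv_mul_cancel_left]
      rw [hy, hxy, hx]
      group
end
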